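/- Let ℓ ≥ 1 be an odd integer and define E*(u) = − Σ_{1 ≤ m ≤ u} m (u² − m²)^{ℓ−1} ψ(u²/(2m) − m/2 − ℓ/2) for real u ≥ 2, where the sum runs over positive integers m ≤ u. Then limsup_{u→∞} E*(u) / (u^{2ℓ−1/2} (log log u · log log log u)^{1/4}) > 0; that is, there exists c > 0 such that for every u_0 there is u > u_0 with E*(u) ≥ c · u^{2ℓ−1/2} (log log u · log log log u)^{1/4}. -/

import Mathlib

open Finset

namespace HeisenbergCount

/-- `SqrtBound S x H`: `x` is an integer combination of square roots of products of entries of `S`,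
with `ℓ¹`-height at most `H`. -/
def SqrtBound : List ℕ → ℝ → ℝ → Prop
  | [], x, H => ∃ n : ℤ, x = n ∧ |(n : ℝ)| ≤ H
  | p :: S, x, H => ∃ a b A B : ℝ, SqrtBound S a A ∧ SqrtBound S b B ∧ x = a + b * √(p : ℝ) ∧
      A + B * √(p : ℝ) ≤ H

namespace SqrtBound

lemma mono {S : List ℕ} {x H H' : ℝ} (h : SqrtBound S x H) (hH : H ≤ H') : SqrtBound S x H' := by
  cases S with
  | nil => obtain ⟨n, hx, hn⟩ := h; exact ⟨n, hx, hn.trans hH⟩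
  | cons p S => obtain ⟨a, b, A, B, ha, hb, hx, hn⟩ := h
                exact ⟨a, b, A, B, ha, hb, hx, hn.trans hH⟩

lemma abs_le {S : List ℕ} : ∀ {x H : ℝ}, SqrtBound S x H → |x| ≤ H := by
  induction S with
  | nil => rintro x H ⟨n, rfl, h⟩; exact h
  | cons p S ih =>
    rintro x H ⟨a, b, A, B, ha, hb, rfl, h⟩
    refine (abs_add_le _ _).trans (le_trans ?_ h)
    rw [abs_mul, abs_of_nonneg (Real.sqrt_nonneg _)]
    have := ih ha
    have := ih hb
    gcongr

lemma nonneg {S : List ℕ} {x H : ℝ} (h : SqrtBound S x H) : 0 ≤ H := (abs_nonneg x).trans h.abs_le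

lemma intCast (S : List ℕ) (n : ℤ) : SqrtBound S n |(n : ℝ)| := by
  induction S generalizing n with
  | nil => exact ⟨n, rfl, le_rfl⟩
  | cons p S ih =>
    refine ⟨n, 0, |(n : ℝ)|, 0, ih n, ?_, by simp, by simp⟩
    simpa using ih 0

lemma add {S : List ℕ} : ∀ {x y H K : ℝ}, SqrtBound S x H → SqrtBound S y K →
    SqrtBound S (x + y) (H + K) := by
  induction S with
  | nil =>
    rintro x y H K ⟨n, rfl, h⟩ ⟨m, rfl, k⟩
    refine ⟨n + m, by push_cast; ring, ?_⟩
    push_cast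
    exact (abs_add_le _ _).trans (add_le_add h k)
  | cons p S ih =>
    rintro x y H K ⟨a, b, A, B, ha, hb, rfl, h⟩ ⟨a', b', A', B', ha', hb', rfl, h'⟩
    exact ⟨a + a', b + b', A + A', B + B', ih ha ha', ih hb hb', by ring, by linarith⟩

lemma mul {S : List ℕ} : ∀ {x y H K : ℝ}, SqrtBound S x H → SqrtBound S y K →
    SqrtBound S (x * y) (H * K) := by
  induction S with
  | nil =>
    rintro x y H K ⟨n, rfl, h⟩ ⟨m, rfl, k⟩
    refine ⟨n * m, by push_cast; ring, ?_⟩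
    push_cast
    rw [abs_mul]
    gcongr
    exact (abs_nonneg _).trans h
  | cons p S ih =>
    rintro x y H K ⟨a, b, A, B, ha, hb, rfl, h⟩ ⟨a', b', A', B', ha', hb', rfl, h'⟩
    have hp : SqrtBound S (p : ℝ) p := by simpa using intCast S p
    have hs : √(p : ℝ) * √(p : ℝ) = p := Real.mul_self_sqrt (Nat.cast_nonneg _)
    refine ⟨a * a' + p * (b * b'), a * b' + b * a', A * A' + p * (B * B'), A * B' + B * A',
      (ih ha ha').add (ih hp (ih hb hb')), (ih ha hb').add (ih hb ha'), ?_, ?_⟩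
    · linear_combination b * b' * hs
    · calc _ = (A + B * √(p : ℝ)) * (A' + B' * √(p : ℝ)) := by linear_combination -B * B' * hs
        _ ≤ H * K := by
          have h1 : 0 ≤ A' + B' * √(p : ℝ) := by
            have := ha'.nonneg; have := hb'.nonneg; positivity
          have h2 : 0 ≤ H := by
            have := ha.nonneg; have := hb.nonneg
            exact le_trans (by positivity) h
          exact mul_le_mul h h' h1 h2

lemma sqrt_mem {S : List ℕ} {p : ℕ} (hp : p ∈ S) : SqrtBound S √(p : ℝ) √(p : ℝ) := by
  induction S with
  | nil => simp at hp
  | cons q S ih =>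
    have h0 : SqrtBound S 0 0 := by simpa using intCast S 0
    have h1 : SqrtBound S 1 1 := by simpa using intCast S 1
    rcases List.mem_cons.1 hp with rfl | h
    · exact ⟨0, 1, 0, 1, h0, h1, by simp, by simp⟩
    · exact ⟨_, 0, _, 0, ih h, h0, by simp, by simp⟩

lemma sum {S : List ℕ} {ι : Type*} (s : Finset ι) {f g : ι → ℝ}
    (h : ∀ i ∈ s, SqrtBound S (f i) (g i)) : SqrtBound S (∑ i ∈ s, f i) (∑ i ∈ s, g i) := by
  classical
  induction s using Finset.induction_on with
  | empty => simpa using intCast S 0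
  | insert i s hi ih =>
    rw [Finset.sum_insert hi, Finset.sum_insert hi]
    exact (h i (by simp)).add (ih fun j hj => h j (by simp [hj]))

/-- A nonzero element of height `H` has absolute value at least `H ^ (1 - 2 ^ |S|)`. -/
lemma one_le_abs_mul_pow {S : List ℕ} : ∀ {x H : ℝ} {e : ℕ}, SqrtBound S x H → 1 ≤ H → x ≠ 0 →
    e + 1 = 2 ^ S.length → 1 ≤ |x| * H ^ e := by
  induction S with
  | nil =>
    rintro x H e ⟨n, rfl, h⟩ hH hx he
    obtain rfl : e = 0 := by simpa using he
    have : n ≠ 0 := by rintro rfl; simp at hx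
    have := Int.one_le_abs this
    simp only [pow_zero, mul_one]
    exact_mod_cast this
  | cons p S ih =>
    intro x H e hxH hH hx he
    obtain ⟨a, b, A, B, ha, hb, rfl, h⟩ := hxH
    obtain ⟨f, hf⟩ : ∃ f, f + 1 = 2 ^ S.length :=
      ⟨2 ^ S.length - 1, Nat.sub_add_cancel Nat.one_le_two_pow⟩
    have he' : e = f + f + 1 := by
      rw [List.length_cons, pow_succ, ← hf] at he; omega
    have hA := ha.nonneg
    have hB := hb.nonneg
    have hBp : 0 ≤ B * √(p : ℝ) := by positivity
    have hs : √(p : ℝ) * √(p : ℝ) = p := Real.mul_self_sqrt (Nat.cast_nonneg _)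
    by_cases hc : a - b * √(p : ℝ) = 0
    · have h2 : a + b * √(p : ℝ) = 2 * a := by linarith
      have ha0 : a ≠ 0 := by rintro rfl; simp [h2] at hx
      have := ih (ha.mono (by linarith : A ≤ H)) hH ha0 hf
      rw [h2, abs_mul, abs_two]
      calc (1 : ℝ) ≤ |a| * H ^ f := this
        _ ≤ 2 * |a| * H ^ e := by
          have : H ^ f ≤ H ^ e := pow_le_pow_right₀ hH (by omega)
          have := abs_nonneg a
          nlinarith [pow_nonneg (zero_le_one.trans hH) f, mul_le_mul_of_nonneg_left ‹H ^ f ≤ H ^ e› this]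
    · have hp : SqrtBound S (-(p : ℝ)) p := by simpa using intCast S (-p)
      have hxx : SqrtBound S ((a + b * √(p : ℝ)) * (a - b * √(p : ℝ))) (H * H) := by
        refine (show SqrtBound S _ _ from ?_ :
          SqrtBound S ((a + b * √(p : ℝ)) * (a - b * √(p : ℝ))) (A * A + p * (B * B))).mono ?_
        · have := (ha.mul ha).add (hp.mul (hb.mul hb))
          convert this using 1
          linear_combination -b * b * hs
        · calc A * A + p * (B * B) ≤ (A + B * √(p : ℝ)) * (A + B * √(p : ℝ)) := by
                have h3 := mul_nonneg hA hBp
                have h4 : B * √(p : ℝ) * (B * √(p : ℝ)) = p * (B * B) := by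
                  linear_combination B * B * hs
                linarith
            _ ≤ H * H := by gcongr
      have h1 := ih hxx (by nlinarith) (mul_ne_zero hx hc) hf
      have h2 : |a - b * √(p : ℝ)| ≤ H := by
        refine (abs_sub _ _).trans (le_trans ?_ h)
        rw [abs_mul, abs_of_nonneg (Real.sqrt_nonneg _)]
        have := ha.abs_le
        have := hb.abs_le
        gcongr
      calc (1 : ℝ) ≤ _ := h1
        _ = |a + b * √(p : ℝ)| * (H ^ f * H ^ f) * |a - b * √(p : ℝ)| := by
          rw [abs_mul, mul_pow]; ring
        _ ≤ |a + b * √(p : ℝ)| * (H ^ f * H ^ f) * H := by gcongr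
        _ = _ := by rw [he']; ring

end SqrtBound

/-- The field generated by the square roots of the elements of `S`. -/
noncomputable def sqrtField (S : Set ℕ) : Subfield ℝ :=
  Subfield.closure ((fun n : ℕ => √(n : ℝ)) '' S)

lemma sqrt_mem_sqrtField {S : Set ℕ} {p : ℕ} (hp : p ∈ S) : √(p : ℝ) ∈ sqrtField S :=
  Subfield.subset_closure ⟨p, hp, rfl⟩

lemma sqrtField_mono {S T : Set ℕ} (h : S ⊆ T) : sqrtField S ≤ sqrtField T :=
  Subfield.closure_mono (Set.image_mono h)

lemma exists_eq_add_mul_sqrt {S : Set ℕ} {p : ℕ} {x : ℝ} (hx : x ∈ sqrtField (insert p S)) :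
    ∃ a ∈ sqrtField S, ∃ b ∈ sqrtField S, x = a + b * √(p : ℝ) := by
  have hs : √(p : ℝ) * √(p : ℝ) = p := Real.mul_self_sqrt (Nat.cast_nonneg _)
  have hp : (p : ℝ) ∈ sqrtField S := natCast_mem _ p
  set K := sqrtField S with hK
  unfold sqrtField at hx
  induction hx using Subfield.closure_induction with
  | mem x hx =>
    obtain ⟨q, hq, rfl⟩ := hx
    rcases hq with rfl | hq
    · exact ⟨0, zero_mem _, 1, one_mem _, by simp⟩
    · exact ⟨_, sqrt_mem_sqrtField hq, 0, zero_mem _, by simp⟩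
  | one => exact ⟨1, one_mem _, 0, zero_mem _, by simp⟩
  | add x y _ _ hx hy =>
    obtain ⟨a, ha, b, hb, rfl⟩ := hx
    obtain ⟨c, hc, d, hd, rfl⟩ := hy
    exact ⟨a + c, add_mem ha hc, b + d, add_mem hb hd, by ring⟩
  | neg x _ hx =>
    obtain ⟨a, ha, b, hb, rfl⟩ := hx
    exact ⟨-a, neg_mem ha, -b, neg_mem hb, by ring⟩
  | inv x _ hx =>
    obtain ⟨a, ha, b, hb, rfl⟩ := hx
    by_cases h : a - b * √(p : ℝ) = 0
    · exact ⟨(2 * a)⁻¹, inv_mem (mul_mem (ofNat_mem K 2) ha), 0, zero_mem _, by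
        rw [show a + b * √(p : ℝ) = 2 * a by linarith]; simp⟩
    · by_cases h' : a + b * √(p : ℝ) = 0
      · exact ⟨0, zero_mem _, 0, zero_mem _, by simp [h']⟩
      have hN : a * a - p * (b * b) = (a + b * √(p : ℝ)) * (a - b * √(p : ℝ)) := by
        linear_combination b * b * hs
      have hN' : a * a - p * (b * b) ∈ K := sub_mem (mul_mem ha ha) (mul_mem hp (mul_mem hb hb))
      refine ⟨a / (a * a - p * (b * b)), div_mem ha hN', -b / (a * a - p * (b * b)),
        div_mem (neg_mem hb) hN', ?_⟩
      rw [hN]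
      field_simp
      ring
  | mul x y _ _ hx hy =>
    obtain ⟨a, ha, b, hb, rfl⟩ := hx
    obtain ⟨c, hc, d, hd, rfl⟩ := hy
    refine ⟨a * c + p * (b * d), add_mem (mul_mem ha hc) (mul_mem hp (mul_mem hb hd)),
      a * d + b * c, add_mem (mul_mem ha hd) (mul_mem hb hc), ?_⟩
    linear_combination b * d * hs

lemma sqrt_notMem_sqrtField (S : Finset ℕ) (hS : ∀ p ∈ S, p.Prime) (n : ℕ) (hn : ¬ IsSquare n)
    (hnS : ∀ p ∈ S, ¬ p ∣ n) : √(n : ℝ) ∉ sqrtField (S : Set ℕ) := by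
  induction S using Finset.induction_on generalizing n with
  | empty =>
    intro h
    have h0 : sqrtField ((∅ : Finset ℕ) : Set ℕ) ≤ (Rat.castHom ℝ).fieldRange :=
      Subfield.closure_le.2 (by simp)
    exact irrational_sqrt_natCast_iff.2 hn (h0 h)
  | insert p S hp ih =>
    have hpp : p.Prime := hS p (by simp)
    have hS' : ∀ q ∈ S, q.Prime := fun q hq => hS q (by simp [hq])
    have hpS : √(p : ℝ) ∉ sqrtField (S : Set ℕ) := by
      refine ih hS' p hpp.prime.not_isSquare fun q hq hqp => ?_
      rw [Nat.prime_dvd_prime_iff_eq (hS' q hq) hpp] at hqp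
      exact hp (hqp ▸ hq)
    intro h
    rw [Finset.coe_insert] at h
    obtain ⟨a, ha, b, hb, hab⟩ := exists_eq_add_mul_sqrt h
    have hs : √(p : ℝ) * √(p : ℝ) = p := Real.mul_self_sqrt (Nat.cast_nonneg _)
    have hsn : √(n : ℝ) * √(n : ℝ) = n := Real.mul_self_sqrt (Nat.cast_nonneg _)
    have hpK : (p : ℝ) ∈ sqrtField (S : Set ℕ) := natCast_mem _ p
    have hnK : (n : ℝ) ∈ sqrtField (S : Set ℕ) := natCast_mem _ n
    by_cases hab0 : a * b = 0
    · rcases mul_eq_zero.1 hab0 with rfl | rfl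
      · refine ih hS' (n * p) ?_ ?_ ?_
        · rintro ⟨m, hm⟩
          have : p ∣ m := by
            have : p ∣ m * m := hm ▸ dvd_mul_left p n
            rcases hpp.dvd_mul.1 this with h | h <;> exact h
          obtain ⟨k, rfl⟩ := this
          refine hnS p (by simp) ⟨k * k, ?_⟩
          apply Nat.eq_of_mul_eq_mul_right hpp.pos
          rw [hm]; ring
        · intro q hq hd
          rcases (hS' q hq).dvd_mul.1 hd with h | h
          · exact hnS q (by simp [hq]) h
          · rw [Nat.prime_dvd_prime_iff_eq (hS' q hq) hpp] at h
            exact hp (h ▸ hq)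
        · have : √((n * p : ℕ) : ℝ) = b * p := by
            push_cast
            rw [Real.sqrt_mul (Nat.cast_nonneg _), hab, ← hs]; ring_nf
            simp [Real.sq_sqrt]
          rw [this]
          exact mul_mem hb hpK
      · refine ih hS' n hn (fun q hq => hnS q (by simp [hq])) ?_
        simpa [hab] using ha
    · apply hpS
      have h1 : √(p : ℝ) = (n - a * a - p * (b * b)) / (2 * (a * b)) := by
        rw [eq_div_iff (by simpa using hab0), ← hsn, hab]
        linear_combination -b * b * hs
      rw [h1]
      exact div_mem (sub_mem (sub_mem hnK (mul_mem ha ha)) (mul_mem hpK (mul_mem hb hb)))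
        (mul_mem (ofNat_mem _ 2) (mul_mem ha hb))

lemma sum_mul_sqrt_ne_zero {S T : Finset ℕ} (hS : ∀ p ∈ S, p.Prime) (hT : ∀ p ∈ T, p.Prime)
    (hST : Disjoint S T) {c : ℕ → ℝ} (hc : ∀ p ∈ S, c p ∈ sqrtField (T : Set ℕ)) {q : ℕ}
    (hq : q ∈ S) (hcq : c q ≠ 0) : ∑ p ∈ S, c p * √(p : ℝ) ≠ 0 := by
  intro h
  have hU : ∀ p ∈ S.erase q ∪ T, p.Prime := by
    intro p hp
    rcases Finset.mem_union.1 hp with hp | hp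
    exacts [hS p (Finset.mem_of_mem_erase hp), hT p hp]
  refine sqrt_notMem_sqrtField (S.erase q ∪ T) hU q (hS q hq).prime.not_isSquare ?_ ?_
  · intro p hp hpq
    rw [Nat.prime_dvd_prime_iff_eq (hU p hp) (hS q hq)] at hpq
    subst hpq
    rcases Finset.mem_union.1 hp with hp | hp
    · simp at hp
    · exact Finset.disjoint_left.1 hST hq hp
  · rw [← Finset.add_sum_erase _ _ hq] at h
    have h1 : √(q : ℝ) = -(∑ p ∈ S.erase q, c p * √(p : ℝ)) / c q := by
      rw [eq_div_iff hcq]; linarith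
    have hle : sqrtField (T : Set ℕ) ≤ sqrtField ((S.erase q ∪ T : Finset ℕ) : Set ℕ) :=
      sqrtField_mono (by simp)
    rw [h1]
    refine div_mem (neg_mem (sum_mem fun p hp => mul_mem ?_ ?_)) (hle (hc q hq))
    · exact hle (hc p (Finset.mem_of_mem_erase hp))
    · exact sqrt_mem_sqrtField (by simp only [Finset.coe_union]; exact Or.inl hp)

lemma bilinear_sq_ne_intCast_aux {A B : Finset ℕ} (hA : ∀ p ∈ A, p.Prime) (hB : ∀ p ∈ B, p.Prime)
    (hAB : Disjoint A B) {ε : ℕ → ℕ → ℤ} {p p' r r' : ℕ} (hp : p ∈ A) (hp' : p' ∈ A) (hr : r ∈ B)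
    (hr' : r' ∈ B) (hε : ε p r ≠ 0) (hε' : ε p' r' ≠ 0) (hpp' : p ≠ p') (D : ℤ) :
    (∑ a ∈ A, ∑ b ∈ B, (ε a b : ℝ) * (√(a : ℝ) * √(b : ℝ))) ^ 2 ≠ D := by
  have hb : ∀ a, ∑ b ∈ B, (ε a b : ℝ) * √(b : ℝ) ∈ sqrtField (B : Set ℕ) := fun a =>
    sum_mem fun b hb => mul_mem (intCast_mem _ _) (sqrt_mem_sqrtField hb)
  have hne : ∀ a b, b ∈ B → ε a b ≠ 0 → ∑ b ∈ B, (ε a b : ℝ) * √(b : ℝ) ≠ 0 := fun a b hb h =>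
    sum_mul_sqrt_ne_zero (T := ∅) hB (by simp) (by simp) (fun _ _ => intCast_mem _ _) hb
      (by exact_mod_cast h)
  have hsum : ∑ a ∈ A, ∑ b ∈ B, (ε a b : ℝ) * (√(a : ℝ) * √(b : ℝ)) =
      ∑ a ∈ A, (∑ b ∈ B, (ε a b : ℝ) * √(b : ℝ)) * √(a : ℝ) := by
    refine Finset.sum_congr rfl fun a _ => ?_
    rw [Finset.sum_mul]
    exact Finset.sum_congr rfl fun b _ => by ring
  rw [hsum, ← Finset.add_sum_erase _ _ hp]
  have h1 := hne p r hr hε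
  have h2 : ∑ a ∈ A.erase p, (∑ b ∈ B, (ε a b : ℝ) * √(b : ℝ)) * √(a : ℝ) ≠ 0 :=
    sum_mul_sqrt_ne_zero (fun a ha => hA a (Finset.mem_of_mem_erase ha)) hB
      (hAB.mono_left (Finset.erase_subset _ _)) (fun a _ => hb a)
      (Finset.mem_erase.2 ⟨hpp'.symm, hp'⟩) (hne p' r' hr' hε')
  have hU : ∀ q ∈ A.erase p ∪ B, q.Prime := by
    intro q hq
    rcases Finset.mem_union.1 hq with hq | hq
    exacts [hA q (Finset.mem_of_mem_erase hq), hB q hq]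
  have hle : sqrtField (B : Set ℕ) ≤ sqrtField ((A.erase p ∪ B : Finset ℕ) : Set ℕ) :=
    sqrtField_mono (by simp)
  have h3 : ∑ a ∈ A.erase p, (∑ b ∈ B, (ε a b : ℝ) * √(b : ℝ)) * √(a : ℝ) ∈
      sqrtField ((A.erase p ∪ B : Finset ℕ) : Set ℕ) :=
    sum_mem fun a ha => mul_mem (hle (hb a))
      (sqrt_mem_sqrtField (by simp only [Finset.coe_union]; exact Or.inl ha))
  have h4 := hle (hb p)
  set x := ∑ b ∈ B, (ε p b : ℝ) * √(b : ℝ)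
  set y := ∑ a ∈ A.erase p, (∑ b ∈ B, (ε a b : ℝ) * √(b : ℝ)) * √(a : ℝ)
  intro h
  have hs : √(p : ℝ) * √(p : ℝ) = p := Real.mul_self_sqrt (Nat.cast_nonneg _)
  refine sqrt_notMem_sqrtField (A.erase p ∪ B) hU p (hA p hp).prime.not_isSquare ?_ ?_
  · intro q hq hqp
    rw [Nat.prime_dvd_prime_iff_eq (hU q hq) (hA p hp)] at hqp
    subst hqp
    rcases Finset.mem_union.1 hq with hq | hq
    · simp at hq
    · exact Finset.disjoint_left.1 hAB hp hq
  · have : √(p : ℝ) = (D - x * x * p - y * y) / (2 * (x * y)) := by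
      rw [eq_div_iff (by simp [h1, h2])]
      linear_combination h - x * x * hs
    rw [this]
    exact div_mem (sub_mem (sub_mem (intCast_mem _ _) (mul_mem (mul_mem h4 h4) (natCast_mem _ _)))
      (mul_mem h3 h3)) (mul_mem (ofNat_mem _ 2) (mul_mem h4 h3))

lemma bilinear_sq_ne_intCast {A B : Finset ℕ} (hA : ∀ p ∈ A, p.Prime) (hB : ∀ p ∈ B, p.Prime)
    (hAB : Disjoint A B) {ε : ℕ → ℕ → ℤ} {p p' r r' : ℕ} (hp : p ∈ A) (hp' : p' ∈ A) (hr : r ∈ B)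
    (hr' : r' ∈ B) (hε : ε p r ≠ 0) (hε' : ε p' r' ≠ 0) (hne : (p, r) ≠ (p', r')) (D : ℤ) :
    (∑ a ∈ A, ∑ b ∈ B, (ε a b : ℝ) * (√(a : ℝ) * √(b : ℝ))) ^ 2 ≠ D := by
  by_cases hpp : p = p'
  · have hrr : r ≠ r' := by rintro rfl; exact hne (by rw [hpp])
    have := bilinear_sq_ne_intCast_aux hB hA hAB.symm (ε := fun b a => ε a b) hr hr' hp hp' hε hε'
      hrr D
    rw [Finset.sum_comm]
    have hcomm : ∀ a b : ℕ, √(a : ℝ) * √(b : ℝ) = √(b : ℝ) * √(a : ℝ) := fun a b => mul_comm _ _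
    rw [Finset.sum_congr rfl fun b _ => Finset.sum_congr rfl fun a _ => by rw [hcomm a b]]
    exact this
  · exact bilinear_sq_ne_intCast_aux hA hB hAB hp hp' hr hr' hε hε' hpp D

/-- Quantitative form of `bilinear_sq_ne_intCast`. -/
lemma one_le_abs_bilinear_sq_sub {A B : Finset ℕ} (hA : ∀ p ∈ A, p.Prime)
    (hB : ∀ p ∈ B, p.Prime) (hAB : Disjoint A B) {ε : ℕ → ℕ → ℤ} (hε1 : ∀ a b, |ε a b| ≤ 1)
    {p p' r r' : ℕ} (hp : p ∈ A) (hp' : p' ∈ A)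
    (hr : r ∈ B) (hr' : r' ∈ B) (hε : ε p r ≠ 0) (hε' : ε p' r' ≠ 0) (hne : (p, r) ≠ (p', r'))
    {L : ℝ} (hL : ∑ a ∈ A, ∑ b ∈ B, √(a : ℝ) * √(b : ℝ) ≤ L) (D : ℤ) :
    1 ≤ |(∑ a ∈ A, ∑ b ∈ B, (ε a b : ℝ) * (√(a : ℝ) * √(b : ℝ))) ^ 2 - D| *
      (2 * L ^ 2 + 1) ^ (2 ^ (#A + #B)) := by
  set x := ∑ a ∈ A, ∑ b ∈ B, (ε a b : ℝ) * (√(a : ℝ) * √(b : ℝ)) with hx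
  have hSB : SqrtBound (A ∪ B).toList x L := by
    refine (SqrtBound.sum A fun a ha => SqrtBound.sum B fun b hb => ?_ :
      SqrtBound (A ∪ B).toList x (∑ a ∈ A, ∑ b ∈ B, 1 * (√(a : ℝ) * √(b : ℝ)))).mono
      (by simpa using hL)
    refine SqrtBound.mul ((SqrtBound.intCast _ (ε a b)).mono (by exact_mod_cast hε1 a b)) ?_
    exact (SqrtBound.sqrt_mem (by simp [ha])).mul (SqrtBound.sqrt_mem (by simp [hb]))
  have hL0 := hSB.nonneg
  have hxL : x ^ 2 ≤ L ^ 2 := sq_le_sq' (abs_le.1 hSB.abs_le).1 (abs_le.1 hSB.abs_le).2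
  have hH : 1 ≤ 2 * L ^ 2 + 1 := by nlinarith
  have hcard : (A ∪ B).toList.length = #A + #B := by
    rw [Finset.length_toList, Finset.card_union_of_disjoint hAB]
  obtain ⟨e, he⟩ : ∃ e, e + 1 = 2 ^ (#A + #B) :=
    ⟨2 ^ (#A + #B) - 1, Nat.sub_add_cancel Nat.one_le_two_pow⟩
  by_cases hD : |(D : ℝ)| ≤ L ^ 2 + 1
  · have h1 : SqrtBound (A ∪ B).toList (x ^ 2 - D) (2 * L ^ 2 + 1) := by
      have h2 := (hSB.mul hSB).add (SqrtBound.intCast (A ∪ B).toList (-D))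
      have h3 : x ^ 2 - D = x * x + ((-D : ℤ) : ℝ) := by push_cast; ring
      rw [h3]
      refine h2.mono ?_
      push_cast
      rw [abs_neg]
      nlinarith
    refine (h1.one_le_abs_mul_pow hH (sub_ne_zero.2 ?_) (hcard ▸ he)).trans ?_
    · exact bilinear_sq_ne_intCast hA hB hAB hp hp' hr hr' hε hε' hne D
    · gcongr
      omega
  · have h1 : 1 ≤ |x ^ 2 - D| := by
      have := abs_sub_abs_le_abs_sub (D : ℝ) (x ^ 2)
      rw [abs_sub_comm, abs_of_nonneg (sq_nonneg x)] at this
      push Not at hD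
      linarith
    exact one_le_mul_of_one_le_of_one_le h1 (one_le_pow₀ hH)

/-- The additive character `x ↦ exp (2πix)`. -/
noncomputable def ee (x : ℝ) : ℂ := Complex.exp ((2 * Real.pi * x : ℝ) * Complex.I)

lemma ee_add (x y : ℝ) : ee (x + y) = ee x * ee y := by
  simp only [ee, ← Complex.exp_add]; congr 1; push_cast; ring

@[simp] lemma ee_zero : ee 0 = 1 := by simp [ee]

@[simp] lemma norm_ee (x : ℝ) : ‖ee x‖ = 1 := Complex.norm_exp_ofReal_mul_I _

lemma conj_ee (x : ℝ) : (starRingEnd ℂ) (ee x) = ee (-x) := by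
  rw [ee, ee, ← Complex.exp_conj, map_mul, Complex.conj_I, Complex.conj_ofReal]
  congr 1; push_cast; ring

lemma ee_intCast (n : ℤ) : ee n = 1 := by
  rw [ee, Complex.exp_eq_one_iff]; exact ⟨n, by push_cast; ring⟩

lemma ee_sum {ι : Type*} (s : Finset ι) (f : ι → ℝ) : ee (∑ i ∈ s, f i) = ∏ i ∈ s, ee (f i) := by
  classical
  induction s using Finset.induction_on with
  | empty => simp
  | insert i s hi ih => rw [Finset.sum_insert hi, Finset.prod_insert hi, ee_add, ih]

@[fun_prop] lemma continuous_ee : Continuous ee := by unfold ee; fun_prop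

lemma hasDerivAt_ee {f : ℝ → ℝ} {f' x : ℝ} (hf : HasDerivAt f f' x) :
    HasDerivAt (fun x => ee (f x)) (2 * Real.pi * Complex.I * f' * ee (f x)) x := by
  have h := (((hf.const_mul (2 * Real.pi)).ofReal_comp).mul_const Complex.I).cexp
  unfold ee
  convert h using 1
  push_cast; ring

lemma norm_integral_ee_le {l U : ℝ} (hl : l ≠ 0) :
    ‖∫ u in (0 : ℝ)..U, ee (-(l * u))‖ ≤ 1 / |l| := by
  have h2 : (2 * Real.pi * Complex.I * l : ℂ) ≠ 0 := by simp [Real.pi_ne_zero, hl]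
  have h : ∀ u ∈ Set.uIcc 0 U, HasDerivAt (fun u => -(2 * Real.pi * Complex.I * l)⁻¹ * ee (-(l * u)))
      (ee (-(l * u))) u := by
    intro u _
    have hd : HasDerivAt (fun u : ℝ => -(l * u)) (-l) u := by
      simpa using ((hasDerivAt_id' u).const_mul l).fun_neg
    refine ((hasDerivAt_ee hd).const_mul (-(2 * Real.pi * Complex.I * l : ℂ)⁻¹)).congr_deriv ?_
    rw [Complex.ofReal_neg, show ∀ z e : ℂ, -z⁻¹ * (2 * Real.pi * Complex.I * -l * e) =
      z⁻¹ * (2 * Real.pi * Complex.I * l) * e by intros; ring, inv_mul_cancel₀ h2, one_mul]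
  rw [intervalIntegral.integral_eq_sub_of_hasDerivAt h
    (Continuous.intervalIntegrable (by fun_prop) _ _), ← mul_sub, norm_mul, norm_neg, norm_inv]
  have h3 : ‖ee (-(l * U)) - ee (-(l * 0))‖ ≤ 2 := by
    refine (norm_sub_le _ _).trans ?_
    simp only [norm_ee]; norm_num
  have h4 : ‖(2 * Real.pi * Complex.I * l : ℂ)‖ = 2 * Real.pi * |l| := by
    simp [abs_of_pos Real.pi_pos]
  have hl' : 0 < |l| := abs_pos.2 hl
  rw [h4, inv_mul_le_iff₀ (by positivity)]
  refine h3.trans ?_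
  field_simp
  nlinarith [Real.pi_gt_three]

/-- The Fourier coefficients of one factor of a Riesz product. -/
noncomputable def rieszCoeff (ω : ℂ) (j : ℤ) : ℂ :=
  if j = 0 then 1 else if j = 1 then ω / 2 else (starRingEnd ℂ) ω / 2

lemma norm_rieszCoeff_le {ω : ℂ} (hω : ‖ω‖ = 1) (j : ℤ) : ‖rieszCoeff ω j‖ ≤ 1 := by
  unfold rieszCoeff
  split_ifs <;> simp [hω] <;> norm_num

section Riesz

variable {ι : Type*} [Fintype ι]

/-- The Riesz product with frequencies `μ` and phases `ω`. -/
noncomputable def riesz (μ : ι → ℝ) (ω : ι → ℂ) (u : ℝ) : ℝ :=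
  ∏ i, (1 + (ω i * ee (-(μ i * u))).re)

lemma riesz_nonneg (μ : ι → ℝ) {ω : ι → ℂ} (hω : ∀ i, ‖ω i‖ = 1) (u : ℝ) : 0 ≤ riesz μ ω u := by
  refine Finset.prod_nonneg fun i _ => ?_
  have := (abs_le.1 (Complex.abs_re_le_norm (ω i * ee (-(μ i * u))))).1
  rw [norm_mul, hω, norm_ee] at this
  linarith

@[fun_prop] lemma continuous_riesz (μ : ι → ℝ) (ω : ι → ℂ) : Continuous (riesz μ ω) := by
  unfold riesz; fun_prop

lemma norm_prod_rieszCoeff_le {ω : ι → ℂ} (hω : ∀ i, ‖ω i‖ = 1) (ε : ι → ℤ) :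
    ‖∏ i, rieszCoeff (ω i) (ε i)‖ ≤ 1 := by
  rw [norm_prod]
  exact Finset.prod_le_one (fun _ _ => norm_nonneg _) fun i _ => norm_rieszCoeff_le (hω i) _

variable [DecidableEq ι]

/-- The sign vectors indexing the expansion of a Riesz product. -/
def signVectors (ι : Type*) [Fintype ι] [DecidableEq ι] : Finset (ι → ℤ) :=
  Fintype.piFinset fun _ => {-1, 0, 1}

lemma mem_signVectors {ε : ι → ℤ} : ε ∈ signVectors ι ↔ ∀ i, ε i = -1 ∨ ε i = 0 ∨ ε i = 1 := by
  simp [signVectors]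

lemma card_signVectors : #(signVectors ι) = 3 ^ Fintype.card ι := by
  simp [signVectors]

lemma riesz_eq_sum (μ : ι → ℝ) (ω : ι → ℂ) (u : ℝ) :
    (riesz μ ω u : ℂ) = ∑ ε ∈ signVectors ι,
      (∏ i, rieszCoeff (ω i) (ε i)) * ee (-((∑ i, ε i * μ i) * u)) := by
  have h : ∀ i, ((1 + (ω i * ee (-(μ i * u))).re : ℝ) : ℂ) =
      ∑ j ∈ ({-1, 0, 1} : Finset ℤ), rieszCoeff (ω i) j * ee (-(j * μ i * u)) := by
    intro i
    rw [Finset.sum_insert (by decide), Finset.sum_insert (by decide), Finset.sum_singleton]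
    push_cast
    rw [Complex.re_eq_add_conj, map_mul, conj_ee]
    simp [rieszCoeff]
    ring_nf
  rw [riesz, Complex.ofReal_prod, Finset.prod_congr rfl fun i _ => h i, Finset.prod_univ_sum]
  refine Finset.sum_congr rfl fun ε _ => ?_
  rw [Finset.prod_mul_distrib, ← ee_sum, Finset.sum_mul, Finset.sum_neg_distrib]

lemma integral_mul_riesz (μ : ι → ℝ) (ω : ι → ℂ) {F : ℝ → ℝ} {U : ℝ}
    (hF : IntervalIntegrable F MeasureTheory.volume 0 U) :
    ((∫ u in (0 : ℝ)..U, F u * riesz μ ω u : ℝ) : ℂ) = ∑ ε ∈ signVectors ι,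
      (∏ i, rieszCoeff (ω i) (ε i)) *
        ∫ u in (0 : ℝ)..U, (F u : ℂ) * ee (-((∑ i, ε i * μ i) * u)) := by
  rw [← intervalIntegral.integral_ofReal]
  simp_rw [← intervalIntegral.integral_const_mul]
  rw [← intervalIntegral.integral_finsetSum]
  · refine intervalIntegral.integral_congr fun u _ => ?_
    simp only [Complex.ofReal_mul, riesz_eq_sum, Finset.mul_sum]
    exact Finset.sum_congr rfl fun ε _ => by ring
  · intro ε _
    refine IntervalIntegrable.const_mul ?_ _
    exact IntervalIntegrable.mul_continuousOn ⟨hF.1.ofReal, hF.2.ofReal⟩ (by fun_prop)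

lemma integral_riesz_le (μ : ι → ℝ) {ω : ι → ℂ} (hω : ∀ i, ‖ω i‖ = 1) {U δ : ℝ}
    (hδ : 0 < δ)
    (h : ∀ ε ∈ signVectors ι, ε ≠ 0 → δ ≤ |∑ i, ε i * μ i|) :
    ∫ u in (0 : ℝ)..U, riesz μ ω u ≤ U + 3 ^ Fintype.card ι / δ := by
  have h1 := integral_mul_riesz μ ω (F := fun _ => 1) (U := U) (by simp)
  have h0 : (0 : ι → ℤ) ∈ signVectors ι := mem_signVectors.2 fun _ => by simp
  rw [← Finset.add_sum_erase _ _ h0] at h1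
  simp only [one_mul, Complex.ofReal_one, Pi.zero_apply, Int.cast_zero, zero_mul,
    Finset.sum_const_zero, neg_zero, ee_zero, intervalIntegral.integral_const, sub_zero,
    rieszCoeff, if_true, Finset.prod_const_one] at h1
  have h2 := congrArg Complex.re h1
  rw [Complex.ofReal_re] at h2
  rw [h2, Complex.add_re]
  refine add_le_add (by simp) ((Complex.re_le_norm _).trans ((norm_sum_le _ _).trans ?_))
  refine (Finset.sum_le_card_nsmul _ _ (1 / δ) fun ε hε => ?_).trans ?_
  · rw [Finset.mem_erase] at hε
    have h3 := h ε hε.2 hε.1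
    have h4 : ∑ i, ε i * μ i ≠ 0 := by
      intro h5; rw [h5, abs_zero] at h3; linarith
    rw [norm_mul]
    calc _ ≤ 1 * (1 / |∑ i, ε i * μ i|) := by
          refine mul_le_mul (norm_prod_rieszCoeff_le hω ε) (norm_integral_ee_le h4)
            (norm_nonneg _) zero_le_one
      _ ≤ 1 / δ := by rw [one_mul]; gcongr
  · rw [nsmul_eq_mul, mul_one_div]
    gcongr
    calc ((#((signVectors ι).erase 0) : ℕ) : ℝ) ≤ (#(signVectors ι) : ℕ) := by
          exact_mod_cast Finset.card_le_card (Finset.erase_subset _ _)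
      _ = _ := by rw [card_signVectors]; push_cast; rfl

/-- Testing `F` against a Riesz product detects the Fourier coefficients at the frequencies `μ`. -/
lemma sum_re_le_integral_mul_riesz (μ : ι → ℝ) {ω : ι → ℂ} (hω : ∀ i, ‖ω i‖ = 1) {F : ℝ → ℝ}
    {U E : ℝ} (hF : IntervalIntegrable F MeasureTheory.volume 0 U)
    (hE0 : 0 ≤ E) (hE : ∀ ε ∈ signVectors ι, (∀ i, ε ≠ Pi.single i 1) → (∀ i, ε ≠ Pi.single i (-1)) →
      ‖∫ u in (0 : ℝ)..U, (F u : ℂ) * ee (-((∑ i, ε i * μ i) * u))‖ ≤ E) :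
    ∑ i, (ω i * ∫ u in (0 : ℝ)..U, (F u : ℂ) * ee (-(μ i * u))).re - 3 ^ Fintype.card ι * E ≤
      ∫ u in (0 : ℝ)..U, F u * riesz μ ω u := by
  classical
  have h1 := congrArg Complex.re (integral_mul_riesz μ ω hF)
  rw [Complex.ofReal_re] at h1
  set Φ : (ι → ℤ) → ℂ := fun ε => (∏ i, rieszCoeff (ω i) (ε i)) *
        ∫ u in (0 : ℝ)..U, (F u : ℂ) * ee (-((∑ i, ε i * μ i) * u)) with hΦ
  set P : Finset (ι → ℤ) := Finset.univ.image fun i : ι => Pi.single i (1 : ℤ) with hP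
  set N : Finset (ι → ℤ) := Finset.univ.image fun i : ι => Pi.single i (-1 : ℤ) with hN
  have hsub : P ∪ N ⊆ signVectors ι := by
    intro ε hε
    rw [mem_signVectors]
    simp only [hP, hN, Finset.mem_union, Finset.mem_image, Finset.mem_univ, true_and] at hε
    intro j
    rcases hε with ⟨i, rfl⟩ | ⟨i, rfl⟩ <;> by_cases hij : j = i
    · subst hij; simp
    · simp [hij]
    · subst hij; simp
    · simp [hij]
  have hdisj : Disjoint P N := by
    rw [Finset.disjoint_left]
    simp only [hP, hN, Finset.mem_image, Finset.mem_univ, true_and]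
    rintro _ ⟨i, rfl⟩ ⟨j, hj⟩
    have := congrFun hj i
    simp only [Pi.single_apply] at this
    split_ifs at this; simp at this
  have hinj : ∀ s : ℤ, s ≠ 0 → Function.Injective fun i : ι => (Pi.single i s : ι → ℤ) := by
    intro s hs i j hij
    have := congrFun hij i
    simp only [Pi.single_apply, if_true] at this
    by_contra hne
    simp [hne, hs] at this
  have hsingle : ∀ (i : ι) (s : ℤ), Φ (Pi.single i s) = rieszCoeff (ω i) s *
      ∫ u in (0 : ℝ)..U, (F u : ℂ) * ee (-((s * μ i) * u)) := by
    intro i s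
    have e1 : ∏ j, rieszCoeff (ω j) ((Pi.single i s : ι → ℤ) j) = rieszCoeff (ω i) s := by
      rw [Fintype.prod_eq_single i]
      · simp
      · intro j hj
        simp [hj, rieszCoeff]
    have e2 : ∑ j, (((Pi.single i s : ι → ℤ) j : ℤ) : ℝ) * μ j = s * μ i := by
      rw [Fintype.sum_eq_single i]
      · simp
      · intro j hj
        simp [hj]
    simp only [hΦ, e1, e2]
  have hconj : ∀ i, ∫ u in (0 : ℝ)..U, (F u : ℂ) * ee (-((-1 * μ i) * u)) =
      (starRingEnd ℂ) (∫ u in (0 : ℝ)..U, (F u : ℂ) * ee (-(μ i * u))) := by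
    intro i
    rw [intervalIntegral.intervalIntegral_eq_integral_uIoc,
      intervalIntegral.intervalIntegral_eq_integral_uIoc, Complex.real_smul, Complex.real_smul,
      map_mul, Complex.conj_ofReal, ← integral_conj]
    congr 2
    ext u
    rw [map_mul, Complex.conj_ofReal, conj_ee]
    ring_nf
  have hPs : ∑ ε ∈ P, Φ ε = ∑ i, Φ (Pi.single i 1) :=
    Finset.sum_image fun i _ j _ h => hinj 1 one_ne_zero h
  have hNs : ∑ ε ∈ N, Φ ε = ∑ i, Φ (Pi.single i (-1)) :=
    Finset.sum_image fun i _ j _ h => hinj (-1) (by norm_num) h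
  have h2 : ∀ i, Φ (Pi.single i 1) + Φ (Pi.single i (-1)) =
      ((ω i * ∫ u in (0 : ℝ)..U, (F u : ℂ) * ee (-(μ i * u))).re : ℂ) := by
    intro i
    have hc := hconj i
    rw [hsingle, hsingle, Complex.re_eq_add_conj, map_mul]
    push_cast
    rw [hc]
    simp [rieszCoeff]
    ring
  have h3 : ‖∑ ε ∈ signVectors ι \ (P ∪ N), Φ ε‖ ≤ 3 ^ Fintype.card ι * E := by
    refine (norm_sum_le _ _).trans ((Finset.sum_le_card_nsmul _ _ E fun ε hε => ?_).trans ?_)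
    · simp only [Finset.mem_sdiff, Finset.mem_union, not_or, hP, hN, Finset.mem_image,
        Finset.mem_univ, true_and, not_exists] at hε
      rw [hΦ, norm_mul]
      calc _ ≤ 1 * E := by
            refine mul_le_mul (norm_prod_rieszCoeff_le hω ε) ?_ (norm_nonneg _) zero_le_one
            exact hE ε hε.1 (fun i h => hε.2.1 i h.symm) (fun i h => hε.2.2 i h.symm)
        _ = E := one_mul E
    · rw [nsmul_eq_mul]
      gcongr
      calc ((#(signVectors ι \ (P ∪ N)) : ℕ) : ℝ) ≤ (#(signVectors ι) : ℕ) := by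
            exact_mod_cast Finset.card_le_card Finset.sdiff_subset
        _ = _ := by rw [card_signVectors]; push_cast; rfl
  have h4 := (abs_le.1 ((Complex.abs_re_le_norm _).trans h3)).1
  rw [h1, ← Finset.sum_sdiff hsub, Finset.sum_union hdisj, hPs, hNs, ← Finset.sum_add_distrib,
    Complex.add_re, Finset.sum_congr rfl fun i _ => h2 i, ← Complex.ofReal_sum, Complex.ofReal_re]
  linarith

end Riesz

/-- Integration by parts bound: a factor with derivative of constant sign only costs its size. -/
lemma norm_integral_mul_le_of_primitive {G G' : ℝ → ℝ} {f : ℝ → ℂ} {a b B : ℝ} (hab : a ≤ b)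
    (hG : ∀ x ∈ Set.Icc a b, HasDerivAt G (G' x) x) (hG'c : ContinuousOn G' (Set.Icc a b))
    (hsign : (∀ x ∈ Set.Icc a b, 0 ≤ G' x) ∨ ∀ x ∈ Set.Icc a b, G' x ≤ 0) (hf : Continuous f)
    (hB : ∀ x ∈ Set.Icc a b, ‖∫ t in a..x, f t‖ ≤ B) :
    ‖∫ u in a..b, (G u : ℂ) * f u‖ ≤ B * (|G b| + |G b - G a|) := by
  have hB0 : 0 ≤ B := (norm_nonneg _).trans (hB a ⟨le_rfl, hab⟩)
  have hui : Set.uIcc a b = Set.Icc a b := Set.uIcc_of_le hab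
  have hG'i : IntervalIntegrable G' MeasureTheory.volume a b :=
    ContinuousOn.intervalIntegrable (by rwa [hui])
  have hibp := intervalIntegral.integral_mul_deriv_eq_deriv_mul (a := a) (b := b)
    (u := fun x => (G x : ℂ)) (u' := fun x => (G' x : ℂ)) (v := fun x => ∫ t in a..x, f t) (v' := f)
    (fun x hx => (hG x (hui ▸ hx)).ofReal_comp)
    (fun x _ => (hf.integral_hasStrictDerivAt a x).hasDerivAt) ⟨hG'i.1.ofReal, hG'i.2.ofReal⟩
    (hf.intervalIntegrable _ _)
  rw [hibp, intervalIntegral.integral_same, mul_zero, sub_zero, mul_add]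
  refine (norm_sub_le _ _).trans (add_le_add ?_ ?_)
  · rw [norm_mul, Complex.norm_real, Real.norm_eq_abs, mul_comm]
    exact mul_le_mul_of_nonneg_right (hB b ⟨hab, le_rfl⟩) (abs_nonneg _)
  · have hintegral : ∫ x in a..b, G' x = G b - G a :=
      intervalIntegral.integral_eq_sub_of_hasDerivAt (fun x hx => hG x (hui ▸ hx)) hG'i
    have habs : ∫ x in a..b, |G' x| = |G b - G a| := by
      rcases hsign with h | h
      · rw [← hintegral, abs_of_nonneg (intervalIntegral.integral_nonneg hab h)]
        exact intervalIntegral.integral_congr fun x hx => abs_of_nonneg (h x (hui ▸ hx))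
      · have : ∫ x in a..b, |G' x| = ∫ x in a..b, -G' x :=
          intervalIntegral.integral_congr fun x hx => abs_of_nonpos (h x (hui ▸ hx))
        have h0 : 0 ≤ ∫ x in a..b, -G' x :=
          intervalIntegral.integral_nonneg hab fun x hx => neg_nonneg.2 (h x hx)
        rw [this]
        rw [intervalIntegral.integral_neg, hintegral] at h0 ⊢
        rw [abs_of_nonpos (by linarith)]
    rw [← habs, ← intervalIntegral.integral_const_mul]
    refine intervalIntegral.norm_integral_le_of_norm_le hab (Filter.Eventually.of_forall ?_)
      (hG'i.abs.const_mul B)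
    intro x hx
    rw [norm_mul, Complex.norm_real, Real.norm_eq_abs, mul_comm]
    exact mul_le_mul_of_nonneg_right (hB x ⟨hx.1.le, hx.2⟩) (abs_nonneg _)

lemma integral_deriv_mul_ee {φ φ' : ℝ → ℝ} (hφ : ∀ x, HasDerivAt φ (φ' x) x)
    (hφ' : Continuous φ') (a b : ℝ) :
    ∫ t in a..b, (φ' t : ℂ) * ee (φ t) =
      (2 * Real.pi * Complex.I)⁻¹ * (ee (φ b) - ee (φ a)) := by
  have h2 : (2 * Real.pi * Complex.I : ℂ) ≠ 0 := by simp [Real.pi_ne_zero]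
  have hc : Continuous φ := continuous_iff_continuousAt.2 fun x => (hφ x).continuousAt
  have h : ∀ x, HasDerivAt (fun x => (2 * Real.pi * Complex.I : ℂ)⁻¹ * ee (φ x))
      (φ' x * ee (φ x)) x := fun x => by
    refine ((hasDerivAt_ee (hφ x)).const_mul _).congr_deriv ?_
    rw [mul_assoc (2 * Real.pi * Complex.I : ℂ), inv_mul_cancel_left₀ h2]
  rw [intervalIntegral.integral_eq_sub_of_hasDerivAt (fun x _ => h x)
    (Continuous.intervalIntegrable (by fun_prop) _ _), mul_sub]

lemma norm_integral_deriv_mul_ee_le {φ φ' : ℝ → ℝ} (hφ : ∀ x, HasDerivAt φ (φ' x) x)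
    (hφ' : Continuous φ') (a b : ℝ) : ‖∫ t in a..b, (φ' t : ℂ) * ee (φ t)‖ ≤ 1 / Real.pi := by
  rw [integral_deriv_mul_ee hφ hφ', norm_mul, norm_inv]
  have h3 : ‖ee (φ b) - ee (φ a)‖ ≤ 2 := by
    refine (norm_sub_le _ _).trans ?_
    simp only [norm_ee]; norm_num
  have h4 : ‖(2 * Real.pi * Complex.I : ℂ)‖ = 2 * Real.pi := by
    simp [abs_of_pos Real.pi_pos]
  rw [h4, inv_mul_le_iff₀ (by positivity)]
  refine h3.trans (le_of_eq ?_)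
  field_simp

/-- First derivative test for a phase with affine derivative `d + e * x`. -/
lemma norm_integral_ee_le_of_deriv {φ : ℝ → ℝ} {d e a b c : ℝ} (hab : a ≤ b) (hc : 0 < c)
    (hφ : ∀ x, HasDerivAt φ (d + e * x) x)
    (h : (∀ x ∈ Set.Icc a b, c ≤ d + e * x) ∨ ∀ x ∈ Set.Icc a b, c ≤ -(d + e * x)) :
    ‖∫ t in a..b, ee (φ t)‖ ≤ 1 / c := by
  have hφc : Continuous φ := continuous_iff_continuousAt.2 fun x => (hφ x).continuousAt
  have habs : ∀ x ∈ Set.Icc a b, c ≤ |d + e * x| := fun x hx => by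
    rcases h with h | h
    · exact (h x hx).trans (le_abs_self _)
    · exact (h x hx).trans (neg_le_abs _)
  have hne : ∀ x ∈ Set.Icc a b, d + e * x ≠ 0 := fun x hx h0 => by
    have := habs x hx
    rw [h0, abs_zero] at this; linarith
  have hG : ∀ x ∈ Set.Icc a b, HasDerivAt (fun x => (d + e * x)⁻¹) (-e / (d + e * x) ^ 2) x := by
    intro x hx
    have h1 : HasDerivAt (fun x => d + e * x) e x := by
      simpa using ((hasDerivAt_id' x).const_mul e).const_add d
    exact h1.fun_inv (hne x hx)
  have hintegral : ∫ t in a..b, ee (φ t) =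
      ∫ t in a..b, (((d + e * t)⁻¹ : ℝ) : ℂ) * (((d + e * t : ℝ) : ℂ) * ee (φ t)) := by
    refine intervalIntegral.integral_congr fun x hx => ?_
    rw [Set.uIcc_of_le hab] at hx
    rw [Complex.ofReal_inv, inv_mul_cancel_left₀ (by exact_mod_cast hne x hx)]
  rw [hintegral]
  refine (norm_integral_mul_le_of_primitive hab hG ?_ ?_ (by fun_prop) fun x _ =>
    norm_integral_deriv_mul_ee_le hφ (by fun_prop) a x).trans ?_
  · refine ContinuousOn.div (by fun_prop) (by fun_prop) fun x hx => pow_ne_zero 2 (hne x hx)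
  · rcases le_total 0 e with he | he
    · right; intro x _; exact div_nonpos_of_nonpos_of_nonneg (by linarith) (sq_nonneg _)
    · left; intro x _; exact div_nonneg (by linarith) (sq_nonneg _)
  · have hinv : ∀ x ∈ Set.Icc a b, |(d + e * x)⁻¹| ≤ 1 / c := fun x hx => by
      rw [abs_inv, ← one_div]
      exact one_div_le_one_div_of_le hc (habs x hx)
    have h1 := hinv a ⟨le_rfl, hab⟩
    have h2 := hinv b ⟨hab, le_rfl⟩
    have h3 : |(d + e * b)⁻¹ - (d + e * a)⁻¹| ≤ 1 / c + 1 / c :=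
      (abs_sub _ _).trans (add_le_add h2 h1)
    have hc' : 0 < 1 / c := by positivity
    rw [div_mul_eq_mul_div, one_mul, div_le_iff₀ Real.pi_pos]
    nlinarith [Real.pi_gt_three]

/-- The Fresnel integral. -/
noncomputable def fresnel (x : ℝ) : ℂ := ∫ t in (0 : ℝ)..x, ee (t ^ 2)

lemma fresnel_neg (x : ℝ) : fresnel (-x) = -fresnel x := by
  unfold fresnel
  have := intervalIntegral.integral_comp_neg (a := 0) (b := x) (fun t => ee (t ^ 2))
  simp only [neg_sq, neg_zero] at this
  rw [this, intervalIntegral.integral_symm]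

lemma fresnel_sub (x y : ℝ) : fresnel y - fresnel x = ∫ t in x..y, ee (t ^ 2) :=
  intervalIntegral.integral_interval_sub_left (Continuous.intervalIntegrable (by fun_prop) _ _)
    (Continuous.intervalIntegrable (by fun_prop) _ _)

lemma norm_fresnel_sub_le {x y : ℝ} (hx : 0 < x) (hxy : x ≤ y) :
    ‖fresnel y - fresnel x‖ ≤ 1 / x := by
  rw [fresnel_sub]
  refine (norm_integral_ee_le_of_deriv (d := 0) (e := 2) (c := 2 * x) hxy (by positivity)
    (fun t => ?_) (Or.inl fun t ht => by nlinarith [ht.1])).trans ?_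
  · simpa using hasDerivAt_pow 2 t
  · apply one_div_le_one_div_of_le hx; linarith

lemma exists_fresnel_limit : ∃ κ : ℂ, Filter.Tendsto fresnel Filter.atTop (nhds κ) := by
  apply cauchySeq_tendsto_of_complete
  rw [Metric.cauchySeq_iff']
  intro ε hε
  refine ⟨2 / ε, fun x hx => ?_⟩
  rw [dist_eq_norm]
  refine (norm_fresnel_sub_le (by positivity) hx).trans_lt ?_
  rw [one_div_div]; linarith

/-- The full Fresnel integral `∫_{-∞}^{∞} exp (2πit²) dt`. -/
noncomputable def fresnelConst : ℂ := 2 * exists_fresnel_limit.choose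

lemma tendsto_fresnel : Filter.Tendsto fresnel Filter.atTop (nhds (fresnelConst / 2)) := by
  have := exists_fresnel_limit.choose_spec
  rwa [fresnelConst, mul_div_cancel_left₀ _ two_ne_zero]

lemma norm_fresnel_sub_const_le {x : ℝ} (hx : 0 < x) :
    ‖fresnel x - fresnelConst / 2‖ ≤ 1 / x := by
  have h1 : Filter.Tendsto (fun y => ‖fresnel y - fresnel x‖) Filter.atTop
      (nhds ‖fresnelConst / 2 - fresnel x‖) := (tendsto_fresnel.sub_const _).norm
  rw [norm_sub_rev]
  refine le_of_tendsto h1 ?_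
  filter_upwards [Filter.eventually_ge_atTop x] with y hy using norm_fresnel_sub_le hx hy

lemma norm_fresnel_le (x : ℝ) : ‖fresnel x‖ ≤ 2 := by
  have key : ∀ x : ℝ, 0 ≤ x → ‖fresnel x‖ ≤ 2 := by
    intro x hx
    have h0 : ∀ y : ℝ, 0 ≤ y → y ≤ 1 → ‖fresnel y‖ ≤ 1 := fun y hy hy1 => by
      refine (intervalIntegral.norm_integral_le_of_norm_le_const (C := 1) fun t _ => ?_).trans ?_
      · simp
      · rw [one_mul, sub_zero, abs_of_nonneg hy]; exact hy1
    rcases le_total x 1 with h | h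
    · exact (h0 x hx h).trans one_le_two
    · have := norm_fresnel_sub_le one_pos h
      have h1 := h0 1 zero_le_one le_rfl
      calc ‖fresnel x‖ = ‖(fresnel x - fresnel 1) + fresnel 1‖ := by rw [sub_add_cancel]
        _ ≤ _ := norm_add_le _ _
        _ ≤ 2 := by linarith
  rcases le_total 0 x with h | h
  · exact key x h
  · have := key (-x) (by linarith)
    rwa [fresnel_neg, norm_neg] at this

lemma norm_fresnelConst_le : ‖fresnelConst‖ ≤ 4 := by
  have h := le_of_tendsto tendsto_fresnel.norm (Filter.Eventually.of_forall norm_fresnel_le)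
  rw [norm_div] at h
  norm_num at h
  linarith

lemma im_fresnel {x : ℝ} : (fresnel x).im = ∫ t in (0 : ℝ)..x, Real.sin (2 * Real.pi * t ^ 2) := by
  have h := Complex.imCLM.intervalIntegral_comp_comm (a := 0) (b := x)
    (μ := MeasureTheory.volume) (f := fun t => ee (t ^ 2))
    (Continuous.intervalIntegrable (by fun_prop) _ _)
  rw [fresnel]
  simp only [Complex.imCLM_apply] at h
  rw [← h]
  refine intervalIntegral.integral_congr fun t _ => ?_
  simp only [ee]
  rw [Complex.exp_ofReal_mul_I_im]

lemma le_im_fresnel {x : ℝ} (hx : 1 / 2 ≤ x) : 1 / 6 - 1 / (2 * Real.pi) ≤ (fresnel x).im := by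
  have hpi := Real.pi_pos
  have hc : ∀ a b, IntervalIntegrable (fun t : ℝ => Real.sin (2 * Real.pi * t ^ 2))
    MeasureTheory.volume a b := fun a b => Continuous.intervalIntegrable (by fun_prop) _ _
  rw [im_fresnel, ← intervalIntegral.integral_add_adjacent_intervals (hc 0 (1/2)) (hc (1/2) x)]
  have h1 : (1 : ℝ) / 6 ≤ ∫ t in (0 : ℝ)..(1/2), Real.sin (2 * Real.pi * t ^ 2) := by
    have e : ∫ t in (0 : ℝ)..(1/2), 4 * t ^ 2 = 1 / 6 := by
      rw [intervalIntegral.integral_const_mul, integral_pow]; norm_num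
    rw [← e]
    refine intervalIntegral.integral_mono_on (by norm_num)
      (Continuous.intervalIntegrable (by fun_prop) _ _) (hc _ _) fun t ht => ?_
    have ht2 : t ^ 2 ≤ 1 / 4 := by nlinarith [ht.1, ht.2]
    have := Real.mul_le_sin (x := 2 * Real.pi * t ^ 2) (by positivity) (by nlinarith)
    refine le_trans (le_of_eq ?_) this
    field_simp; ring
  have hd : ∀ t ∈ Set.uIcc (1/2) x, HasDerivAt
      (fun t : ℝ => (1 - Real.cos (2 * Real.pi * t ^ 2)) / (4 * Real.pi * t))
      (Real.sin (2 * Real.pi * t ^ 2) -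
        (1 - Real.cos (2 * Real.pi * t ^ 2)) / (4 * Real.pi * t ^ 2)) t := by
    intro t ht
    rw [Set.uIcc_of_le hx] at ht
    have ht0 : 0 < t := by linarith [ht.1]
    have e1 : HasDerivAt (fun t : ℝ => 2 * Real.pi * t ^ 2) (2 * Real.pi * (2 * t)) t := by
      simpa using (hasDerivAt_pow 2 t).const_mul (2 * Real.pi)
    have e2 := (e1.cos.const_sub 1)
    have e3 : HasDerivAt (fun t : ℝ => 4 * Real.pi * t) (4 * Real.pi) t := by
      simpa using (hasDerivAt_id' t).const_mul (4 * Real.pi)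
    refine (e2.fun_div e3 (by positivity)).congr_deriv ?_
    field_simp
    ring
  have hcont : ContinuousOn (fun t : ℝ => Real.sin (2 * Real.pi * t ^ 2) -
        (1 - Real.cos (2 * Real.pi * t ^ 2)) / (4 * Real.pi * t ^ 2)) (Set.uIcc (1/2) x) := by
    refine ContinuousOn.sub (by fun_prop) (ContinuousOn.div (by fun_prop) (by fun_prop) ?_)
    intro t ht
    rw [Set.uIcc_of_le hx] at ht
    have ht0 : 0 < t := by linarith [ht.1]
    positivity
  have h2 := intervalIntegral.integral_eq_sub_of_hasDerivAt hd hcont.intervalIntegrable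
  have h3 : ∫ t in (1/2)..x, (Real.sin (2 * Real.pi * t ^ 2) -
        (1 - Real.cos (2 * Real.pi * t ^ 2)) / (4 * Real.pi * t ^ 2)) ≤
      ∫ t in (1/2)..x, Real.sin (2 * Real.pi * t ^ 2) := by
    refine intervalIntegral.integral_mono_on hx hcont.intervalIntegrable (hc _ _) fun t _ => ?_
    have : 0 ≤ (1 - Real.cos (2 * Real.pi * t ^ 2)) / (4 * Real.pi * t ^ 2) :=
      div_nonneg (by linarith [Real.cos_le_one (2 * Real.pi * t ^ 2)]) (by positivity)
    linarith
  have h4 : 0 ≤ (1 - Real.cos (2 * Real.pi * x ^ 2)) / (4 * Real.pi * x) :=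
    div_nonneg (by linarith [Real.cos_le_one (2 * Real.pi * x ^ 2)]) (by positivity)
  have h5 : (1 - Real.cos (2 * Real.pi * (1/2) ^ 2)) / (4 * Real.pi * (1/2)) =
      1 / (2 * Real.pi) := by
    rw [show 2 * Real.pi * (1/2) ^ 2 = Real.pi / 2 by ring, Real.cos_pi_div_two]
    congr 1 <;> ring
  rw [h5] at h2
  linarith

lemma fresnelConst_ne_zero : fresnelConst ≠ 0 := by
  intro h
  have h1 := tendsto_fresnel
  rw [h, zero_div] at h1
  have h2 := ((Complex.continuous_im.tendsto _).comp h1)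
  have h3 := ge_of_tendsto h2 (b := 1 / 6 - 1 / (2 * Real.pi))
    (by filter_upwards [Filter.eventually_ge_atTop (1/2 : ℝ)] with x hx using le_im_fresnel hx)
  have h4 : 1 / (2 * Real.pi) < 1 / 6 := by
    apply one_div_lt_one_div_of_lt (by norm_num); linarith [Real.pi_gt_three]
  simp only [Complex.zero_im] at h3
  linarith

lemma hasDerivAt_sq_sub_pow (a : ℝ) (n : ℕ) (x : ℝ) :
    HasDerivAt (fun u : ℝ => (u ^ 2 - a ^ 2) ^ n) (n * (x ^ 2 - a ^ 2) ^ (n - 1) * (2 * x)) x := by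
  have h : HasDerivAt (fun u : ℝ => u ^ 2 - a ^ 2) (2 * x) x := by
    simpa using (hasDerivAt_pow 2 x).sub_const (a ^ 2)
  exact h.fun_pow n

lemma sq_sub_pow_nonneg {a u : ℝ} (ha : 0 ≤ a) (hu : a ≤ u) (n : ℕ) : 0 ≤ (u ^ 2 - a ^ 2) ^ n :=
  pow_nonneg (by nlinarith) n

lemma sq_sub_pow_le {a u V : ℝ} (ha : 0 ≤ a) (hu : a ≤ u) (hV : u ≤ V) (n : ℕ) :
    (u ^ 2 - a ^ 2) ^ n ≤ V ^ (2 * n) := by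
  rw [pow_mul]
  exact pow_le_pow_left₀ (by nlinarith) (by nlinarith) n

/-- The non-stationary integrals. -/
lemma norm_integral_sq_sub_pow_mul_ee_le {φ : ℝ → ℝ} {d e a b c : ℝ} (n : ℕ) (ha : 0 ≤ a)
    (hab : a ≤ b) (hc : 0 < c) (hφ : ∀ x, HasDerivAt φ (d + e * x) x)
    (h : (∀ x ∈ Set.Icc a b, c ≤ d + e * x) ∨ ∀ x ∈ Set.Icc a b, c ≤ -(d + e * x)) :
    ‖∫ t in a..b, (((t ^ 2 - a ^ 2) ^ n : ℝ) : ℂ) * ee (φ t)‖ ≤ 2 * b ^ (2 * n) / c := by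
  have hφc : Continuous φ := continuous_iff_continuousAt.2 fun x => (hφ x).continuousAt
  refine (norm_integral_mul_le_of_primitive hab (fun x _ => hasDerivAt_sq_sub_pow a n x)
    (by fun_prop) (Or.inl fun x hx => ?_) (by fun_prop) fun x hx =>
      norm_integral_ee_le_of_deriv hx.1 hc hφ ?_).trans ?_
  · exact mul_nonneg (mul_nonneg n.cast_nonneg (sq_sub_pow_nonneg ha hx.1 _))
      (by linarith [hx.1])
  · exact h.imp (fun h y hy => h y ⟨hy.1, hy.2.trans hx.2⟩) fun h y hy => h y ⟨hy.1, hy.2.trans hx.2⟩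
  · have h1 := sq_sub_pow_nonneg ha hab n
    have h2 := sq_sub_pow_le ha hab le_rfl n
    have h3 := sq_sub_pow_nonneg ha le_rfl n
    have h4 : (a ^ 2 - a ^ 2) ^ n ≤ (b ^ 2 - a ^ 2) ^ n :=
      pow_le_pow_left₀ (by simp) (by nlinarith) n
    rw [abs_of_nonneg h1, abs_of_nonneg (by linarith), div_mul_eq_mul_div, one_mul]
    gcongr
    linarith

/-- Near a stationary point `c`, the amplitude may be frozen at `c`. -/
lemma norm_integral_sq_sub_pow_sub_le {α a b c V : ℝ} (n : ℕ) (hα : 0 < α) (ha : 0 ≤ a)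
    (hab : a ≤ b) (hac : a ≤ c) (hbV : b ≤ V) (hcV : c ≤ V) :
    ‖(∫ t in a..b, (((t ^ 2 - a ^ 2) ^ n : ℝ) : ℂ) * ee (α * (t - c) ^ 2)) -
      (((c ^ 2 - a ^ 2) ^ n : ℝ) : ℂ) * ∫ t in a..b, ee (α * (t - c) ^ 2)‖ * V ≤
      n * V ^ (2 * n) / α := by
  have hV : 0 ≤ V := ha.trans (hac.trans hcV)
  induction n with
  | zero => simp
  | succ n ih =>
    have hsplit : ∫ t in a..b, (((t ^ 2 - a ^ 2) ^ (n + 1) : ℝ) : ℂ) * ee (α * (t - c) ^ 2) =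
        ((c ^ 2 - a ^ 2 : ℝ) : ℂ) *
          (∫ t in a..b, (((t ^ 2 - a ^ 2) ^ n : ℝ) : ℂ) * ee (α * (t - c) ^ 2)) +
        ∫ t in a..b, (((t + c) * (t ^ 2 - a ^ 2) ^ n : ℝ) : ℂ) *
          (((t - c : ℝ) : ℂ) * ee (α * (t - c) ^ 2)) := by
      rw [← intervalIntegral.integral_const_mul, ← intervalIntegral.integral_add
        (Continuous.intervalIntegrable (by fun_prop) _ _)
        (Continuous.intervalIntegrable (by fun_prop) _ _)]
      refine intervalIntegral.integral_congr fun t _ => ?_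
      push_cast
      ring
    have hφ : ∀ x, HasDerivAt (fun t => α * (t - c) ^ 2) (2 * α * (x - c)) x := fun x => by
      have := (((hasDerivAt_id' x).sub_const c).fun_pow 2).const_mul α
      refine this.congr_deriv ?_
      push_cast; ring
    have hB : ∀ x ∈ Set.Icc a b, ‖∫ t in a..x, ((t - c : ℝ) : ℂ) * ee (α * (t - c) ^ 2)‖ ≤
        1 / (2 * Real.pi * α) := by
      intro x _
      have h1 := norm_integral_deriv_mul_ee_le hφ (by fun_prop) a x
      have h2 : ∫ t in a..x, ((2 * α * (t - c) : ℝ) : ℂ) * ee (α * (t - c) ^ 2) =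
          ((2 * α : ℝ) : ℂ) * ∫ t in a..x, ((t - c : ℝ) : ℂ) * ee (α * (t - c) ^ 2) := by
        rw [← intervalIntegral.integral_const_mul]
        refine intervalIntegral.integral_congr fun t _ => ?_
        push_cast; ring
      rw [h2, norm_mul, Complex.norm_real, Real.norm_of_nonneg (by positivity)] at h1
      rw [show 1 / (2 * Real.pi * α) = 1 / Real.pi / (2 * α) by field_simp, le_div_iff₀ (by positivity)]
      linarith
    have hmain : ‖∫ t in a..b, (((t + c) * (t ^ 2 - a ^ 2) ^ n : ℝ) : ℂ) *
          (((t - c : ℝ) : ℂ) * ee (α * (t - c) ^ 2))‖ ≤ V ^ (2 * n + 1) / α := by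
      have hG : ∀ x ∈ Set.Icc a b, HasDerivAt (fun t => (t + c) * (t ^ 2 - a ^ 2) ^ n)
          ((x ^ 2 - a ^ 2) ^ n + (x + c) * (n * (x ^ 2 - a ^ 2) ^ (n - 1) * (2 * x))) x := by
        intro x _
        have := ((hasDerivAt_id' x).add_const c).fun_mul (hasDerivAt_sq_sub_pow a n x)
        simpa using this
      refine (norm_integral_mul_le_of_primitive hab hG (by fun_prop) (Or.inl fun x hx => ?_)
        (by fun_prop) hB).trans ?_
      · have := sq_sub_pow_nonneg ha hx.1 (n - 1)
        have := sq_sub_pow_nonneg ha hx.1 n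
        have : 0 ≤ x := ha.trans hx.1
        have : 0 ≤ c := ha.trans hac
        positivity
      · have h0 : (a ^ 2 - a ^ 2) ^ n ≤ (b ^ 2 - a ^ 2) ^ n :=
          pow_le_pow_left₀ (by simp) (by nlinarith) n
        have h00 := sq_sub_pow_nonneg ha le_rfl n
        have h1 : 0 ≤ (a + c) * (a ^ 2 - a ^ 2) ^ n := mul_nonneg (by linarith) h00
        have h2 : (a + c) * (a ^ 2 - a ^ 2) ^ n ≤ (b + c) * (b ^ 2 - a ^ 2) ^ n :=
          mul_le_mul (by linarith) h0 h00 (by linarith)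
        have h3 : (b + c) * (b ^ 2 - a ^ 2) ^ n ≤ 2 * V * V ^ (2 * n) :=
          mul_le_mul (by linarith) (sq_sub_pow_le ha hab hbV n) (sq_sub_pow_nonneg ha hab n)
            (by linarith)
        rw [abs_of_nonneg (h1.trans h2), abs_of_nonneg (by linarith), div_mul_eq_mul_div, one_mul,
          div_le_div_iff₀ (by positivity) hα]
        have h4 : V ^ (2 * n + 1) = V * V ^ (2 * n) := by ring
        have h5 : 0 ≤ V * V ^ (2 * n) := by positivity
        rw [h4]
        have h6 := Real.pi_gt_three
        have h7 : (b + c) * (b ^ 2 - a ^ 2) ^ n + ((b + c) * (b ^ 2 - a ^ 2) ^ n -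
          (a + c) * (a ^ 2 - a ^ 2) ^ n) ≤ 4 * (V * V ^ (2 * n)) := by linarith
        calc _ ≤ 4 * (V * V ^ (2 * n)) * α := mul_le_mul_of_nonneg_right h7 hα.le
          _ ≤ (2 * Real.pi) * (V * V ^ (2 * n)) * α := by gcongr; linarith
          _ = _ := by ring
    rw [hsplit]
    have hrw : ∀ x y z : ℂ, ((c ^ 2 - a ^ 2 : ℝ) : ℂ) * x + z -
        (((c ^ 2 - a ^ 2) ^ (n + 1) : ℝ) : ℂ) * y =
        ((c ^ 2 - a ^ 2 : ℝ) : ℂ) * (x - (((c ^ 2 - a ^ 2) ^ n : ℝ) : ℂ) * y) + z := by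
      intros; push_cast; ring
    rw [hrw]
    have h8 : 0 ≤ c ^ 2 - a ^ 2 := by nlinarith
    have h9 : c ^ 2 - a ^ 2 ≤ V ^ 2 := by nlinarith
    calc _ ≤ ((c ^ 2 - a ^ 2) * ‖(∫ t in a..b, (((t ^ 2 - a ^ 2) ^ n : ℝ) : ℂ) *
            ee (α * (t - c) ^ 2)) - (((c ^ 2 - a ^ 2) ^ n : ℝ) : ℂ) *
            ∫ t in a..b, ee (α * (t - c) ^ 2)‖ + V ^ (2 * n + 1) / α) * V := by
          refine mul_le_mul_of_nonneg_right ((norm_add_le _ _).trans (add_le_add ?_ hmain)) hV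
          rw [norm_mul, Complex.norm_real, Real.norm_of_nonneg h8]
      _ = (c ^ 2 - a ^ 2) * (‖(∫ t in a..b, (((t ^ 2 - a ^ 2) ^ n : ℝ) : ℂ) *
            ee (α * (t - c) ^ 2)) - (((c ^ 2 - a ^ 2) ^ n : ℝ) : ℂ) *
            ∫ t in a..b, ee (α * (t - c) ^ 2)‖ * V) + V ^ (2 * n + 2) / α := by ring
      _ ≤ V ^ 2 * (n * V ^ (2 * n) / α) + V ^ (2 * n + 2) / α := by gcongr
      _ = _ := by push_cast; ring

lemma integral_ee_sq_eq {α : ℝ} (hα : 0 < α) (a b c : ℝ) :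
    ∫ t in a..b, ee (α * (t - c) ^ 2) =
      ((√α)⁻¹ : ℝ) * (fresnel (√α * (b - c)) + fresnel (√α * (c - a))) := by
  have hs : √α ≠ 0 := (Real.sqrt_pos.2 hα).ne'
  have h := intervalIntegral.integral_comp_mul_sub (a := a) (b := b) (fun t => ee (t ^ 2)) hs (√α * c)
  have h1 : ∫ t in a..b, ee (α * (t - c) ^ 2) = ∫ t in a..b, ee ((√α * t - √α * c) ^ 2) := by
    refine intervalIntegral.integral_congr fun t _ => ?_
    rw [← mul_sub, mul_pow, Real.sq_sqrt hα.le]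
  rw [h1, h, ← fresnel_sub, Complex.real_smul]
  rw [show √α * a - √α * c = -(√α * (c - a)) by ring, fresnel_neg, sub_neg_eq_add,
    mul_sub (√α) b]

lemma norm_fresnel_sub_const_le_four (x : ℝ) : ‖fresnel x - fresnelConst / 2‖ ≤ 4 := by
  refine (norm_sub_le _ _).trans ?_
  have h1 := norm_fresnel_le x
  have h2 := norm_fresnelConst_le
  rw [norm_div]
  norm_num
  linarith

lemma norm_integral_ee_sq_sub_le {α : ℝ} (hα : 0 < α) {a b c : ℝ} (hac : a < c) :
    ‖(∫ t in a..b, ee (α * (t - c) ^ 2)) - if c < b then fresnelConst * ((√α)⁻¹ : ℝ) else 0‖ ≤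
      1 / (α * (c - a)) + 4 / √α ∧
    (b ≠ c → ‖(∫ t in a..b, ee (α * (t - c) ^ 2)) -
      if c < b then fresnelConst * ((√α)⁻¹ : ℝ) else 0‖ ≤
      1 / (α * (c - a)) + 1 / (α * |b - c|)) := by
  have hs : 0 < √α := Real.sqrt_pos.2 hα
  have hsq : √α * √α = α := Real.mul_self_sqrt hα.le
  have h1 : (√α)⁻¹ * ‖fresnel (√α * (c - a)) - fresnelConst / 2‖ ≤ 1 / (α * (c - a)) := by
    have := norm_fresnel_sub_const_le (x := √α * (c - a)) (mul_pos hs (by linarith))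
    calc _ ≤ (√α)⁻¹ * (1 / (√α * (c - a))) := by gcongr
      _ = 1 / (√α * √α * (c - a)) := by field_simp
      _ = _ := by rw [hsq]
  have h2 : ∀ x : ℝ, (√α)⁻¹ * ‖fresnel x - fresnelConst / 2‖ ≤ 4 / √α := fun x => by
    rw [div_eq_mul_inv, mul_comm]
    exact mul_le_mul_of_nonneg_right (norm_fresnel_sub_const_le_four x) (by positivity)
  have h3 : ∀ x : ℝ, 0 < x → (√α)⁻¹ * ‖fresnel (√α * x) - fresnelConst / 2‖ ≤ 1 / (α * x) := by
    intro x hx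
    have := norm_fresnel_sub_const_le (x := √α * x) (mul_pos hs hx)
    calc _ ≤ (√α)⁻¹ * (1 / (√α * x)) := by gcongr
      _ = 1 / (√α * √α * x) := by field_simp
      _ = _ := by rw [hsq]
  have key : ∃ x : ℝ, (b ≠ c → x = √α * |b - c|) ∧
      ‖(∫ t in a..b, ee (α * (t - c) ^ 2)) -
        if c < b then fresnelConst * ((√α)⁻¹ : ℝ) else 0‖ ≤
      (√α)⁻¹ * ‖fresnel (√α * (c - a)) - fresnelConst / 2‖ +
        (√α)⁻¹ * ‖fresnel x - fresnelConst / 2‖ := by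
    refine ⟨√α * |b - c|, fun _ => rfl, ?_⟩
    rw [integral_ee_sq_eq hα]
    split_ifs with hcb
    · rw [abs_of_pos (by linarith)]
      have : ∀ x y : ℂ, ((√α)⁻¹ : ℝ) * (x + y) - fresnelConst * ((√α)⁻¹ : ℝ) =
        ((√α)⁻¹ : ℝ) * (y - fresnelConst / 2) + ((√α)⁻¹ : ℝ) * (x - fresnelConst / 2) := by
        intros; ring
      rw [this]
      refine (norm_add_le _ _).trans (le_of_eq ?_)
      rw [norm_mul, norm_mul, Complex.norm_real, Real.norm_of_nonneg (by positivity)]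
    · rw [abs_of_nonpos (by linarith)]
      have : ∀ y : ℂ, ((√α)⁻¹ : ℝ) * (fresnel (√α * (b - c)) + y) - 0 =
        ((√α)⁻¹ : ℝ) * (y - fresnelConst / 2) -
          ((√α)⁻¹ : ℝ) * (fresnel (√α * -(b - c)) - fresnelConst / 2) := by
        intro y
        rw [mul_neg, fresnel_neg]; ring
      rw [this]
      refine (norm_sub_le _ _).trans (le_of_eq ?_)
      rw [norm_mul, norm_mul, Complex.norm_real, Real.norm_of_nonneg (by positivity)]
  obtain ⟨x, hx, hle⟩ := key
  refine ⟨hle.trans (add_le_add h1 (h2 x)), fun hbc => hle.trans (add_le_add h1 ?_)⟩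
  rw [hx hbc]
  exact h3 _ (abs_pos.2 (sub_ne_zero.2 hbc))

/-- The oscillatory integral attached to the `k`-th harmonic of the `m`-th summand. -/
noncomputable def osc (n ℓ : ℕ) (l U : ℝ) (m : ℕ) (k : ℝ) : ℂ :=
  ∫ u in (m : ℝ)..U, (((u ^ 2 - (m : ℝ) ^ 2) ^ n : ℝ) : ℂ) *
    ee (k * (u ^ 2 / (2 * m) - m / 2 - ℓ / 2) - l * u)

lemma hasDerivAt_phase (ℓ : ℕ) (l k : ℝ) {m : ℕ} (x : ℝ) :
    HasDerivAt (fun u : ℝ => k * (u ^ 2 / (2 * m) - m / 2 - ℓ / 2) - l * u)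
      (-l + k / m * x) x := by
  have h1 := ((((hasDerivAt_pow 2 x).div_const (2 * (m : ℝ))).sub_const ((m : ℝ) / 2)).sub_const
    ((ℓ : ℝ) / 2)).const_mul k
  refine (h1.sub ((hasDerivAt_id' x).const_mul l)).congr_deriv ?_
  push_cast
  ring

lemma norm_osc_le_of_lt {n ℓ m : ℕ} {l U k : ℝ} (hm : 1 ≤ m) (hmU : m ≤ U) (hl : 0 ≤ l)
    (hk : l < k) : ‖osc n ℓ l U m k‖ ≤ 2 * U ^ (2 * n) / (k - l) := by
  have hm' : (1 : ℝ) ≤ m := by exact_mod_cast hm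
  refine norm_integral_sq_sub_pow_mul_ee_le n m.cast_nonneg hmU (by linarith)
    (hasDerivAt_phase ℓ l k) (Or.inl fun x hx => ?_)
  have : k ≤ k / m * x := by
    rw [div_mul_eq_mul_div, le_div_iff₀ (by linarith)]
    exact mul_le_mul_of_nonneg_left hx.1 (by linarith)
  linarith

lemma norm_osc_neg_le {n ℓ m : ℕ} {l U k : ℝ} (hm : 1 ≤ m) (hmU : m ≤ U) (hl : 0 ≤ l)
    (hk : 0 < k) : ‖osc n ℓ l U m (-k)‖ ≤ 2 * U ^ (2 * n) / k := by
  have hm' : (1 : ℝ) ≤ m := by exact_mod_cast hm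
  refine norm_integral_sq_sub_pow_mul_ee_le n m.cast_nonneg hmU hk
    (hasDerivAt_phase ℓ l (-k)) (Or.inr fun x hx => ?_)
  have : k ≤ k / m * x := by
    rw [div_mul_eq_mul_div, le_div_iff₀ (by linarith)]
    exact mul_le_mul_of_nonneg_left hx.1 (by linarith)
  rw [neg_div, neg_mul]
  linarith

/-- The contribution of the stationary point to `osc`. -/
noncomputable def oscMain (n ℓ : ℕ) (l U : ℝ) (m : ℕ) (k : ℝ) : ℂ :=
  if l * m < k * U then
    ee (-(m * ((l ^ 2 / k + k) / 2)) - k * ℓ / 2) * ((((l * m / k) ^ 2 - (m : ℝ) ^ 2) ^ n : ℝ) : ℂ) *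
      (fresnelConst * (√(2 * m / k) : ℝ))
  else 0

lemma norm_osc_sub_le {n ℓ m : ℕ} {l U k γ : ℝ} (hm : 1 ≤ m) (hmU : m ≤ U) (hk : 1 ≤ k)
    (hγ : 0 < γ) (hkl : k + γ ≤ l) :
    ‖osc n ℓ l U m k - oscMain n ℓ l U m k‖ ≤
      (l * U) ^ (2 * n) * (2 * n + 2 / γ + 6 * √U) ∧
    ∀ T : ℝ, 0 < T → T ≤ |k * U - l * m| → ‖osc n ℓ l U m k - oscMain n ℓ l U m k‖ ≤
      (l * U) ^ (2 * n) * (2 * n + 2 / γ + 2 * U / T) := by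
  have hm' : (1 : ℝ) ≤ m := by exact_mod_cast hm
  have hm0 : (0 : ℝ) < m := by linarith
  have hk0 : 0 < k := by linarith
  set α : ℝ := k / (2 * m) with hα
  set c : ℝ := l * m / k with hc
  have hα0 : 0 < α := by positivity
  have hmc : (m : ℝ) < c := by
    rw [hc, lt_div_iff₀ hk0, mul_comm]
    exact mul_lt_mul_of_pos_right (by linarith) hm0
  set V : ℝ := l * U with hV
  have hUV : U ≤ V := by rw [hV]; nlinarith
  have hcV : c ≤ V := by
    rw [hc, div_le_iff₀ hk0, hV]
    have : l * m ≤ l * U := mul_le_mul_of_nonneg_left hmU (by linarith)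
    nlinarith
  have hV0 : 0 < V := by linarith
  set Z : ℂ := ee (-(m * ((l ^ 2 / k + k) / 2)) - k * ℓ / 2) with hZ
  have hZn : ‖Z‖ = 1 := norm_ee _
  set E : ℂ := ∫ t in (m : ℝ)..U, ee (α * (t - c) ^ 2) with hE
  have hosc : osc n ℓ l U m k =
      Z * ∫ t in (m : ℝ)..U, (((t ^ 2 - (m : ℝ) ^ 2) ^ n : ℝ) : ℂ) * ee (α * (t - c) ^ 2) := by
    rw [osc, ← intervalIntegral.integral_const_mul]
    refine intervalIntegral.integral_congr fun t _ => ?_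
    have : k * (t ^ 2 / (2 * m) - m / 2 - ℓ / 2) - l * t =
        (-(m * ((l ^ 2 / k + k) / 2)) - k * ℓ / 2) + α * (t - c) ^ 2 := by
      rw [hα, hc]
      field_simp
      ring
    simp only [this, ee_add, hZ]
    ring
  have hsq : (√α)⁻¹ = √(2 * m / k) := by
    rw [← Real.sqrt_inv, hα, inv_div]
  have hmain : oscMain n ℓ l U m k = Z * ((((c ^ 2 - (m : ℝ) ^ 2) ^ n : ℝ) : ℂ) *
      if c < U then fresnelConst * ((√α)⁻¹ : ℝ) else 0) := by
    have hiff : l * m < k * U ↔ c < U := by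
      rw [hc, div_lt_iff₀ hk0, mul_comm U]
    rw [oscMain, hsq]
    simp only [hiff]
    split_ifs
    · ring
    · simp
  have h1 : ‖(∫ t in (m : ℝ)..U, (((t ^ 2 - (m : ℝ) ^ 2) ^ n : ℝ) : ℂ) * ee (α * (t - c) ^ 2)) -
      (((c ^ 2 - (m : ℝ) ^ 2) ^ n : ℝ) : ℂ) * E‖ ≤ 2 * n * V ^ (2 * n) := by
    have := norm_integral_sq_sub_pow_sub_le n hα0 m.cast_nonneg hmU hmc.le hUV hcV
    rw [← le_div_iff₀ hV0] at this
    refine this.trans ?_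
    rw [div_div, div_le_iff₀ (by positivity), hα]
    have : (1 : ℝ) ≤ 2 * (k / (2 * m) * V) := by
      rw [div_mul_eq_mul_div, ← mul_div_assoc, le_div_iff₀ (by positivity)]
      nlinarith
    have h2 : 0 ≤ n * V ^ (2 * n) := by positivity
    nlinarith
  have h2 : 0 ≤ (c ^ 2 - (m : ℝ) ^ 2) ^ n := sq_sub_pow_nonneg m.cast_nonneg hmc.le n
  have h3 : (c ^ 2 - (m : ℝ) ^ 2) ^ n ≤ V ^ (2 * n) := sq_sub_pow_le m.cast_nonneg hmc.le hcV n
  have hcomb : ∀ R : ℝ, ‖E - if c < U then fresnelConst * ((√α)⁻¹ : ℝ) else 0‖ ≤ 2 / γ + R →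
      ‖osc n ℓ l U m k - oscMain n ℓ l U m k‖ ≤ V ^ (2 * n) * (2 * n + 2 / γ + R) := by
    intro R hR
    rw [hosc, hmain, ← mul_sub, norm_mul, hZn, one_mul]
    have : ∀ x y : ℂ, x - (((c ^ 2 - (m : ℝ) ^ 2) ^ n : ℝ) : ℂ) * y =
      (x - (((c ^ 2 - (m : ℝ) ^ 2) ^ n : ℝ) : ℂ) * E) +
        (((c ^ 2 - (m : ℝ) ^ 2) ^ n : ℝ) : ℂ) * (E - y) := by intros; ring
    rw [this]
    refine (norm_add_le _ _).trans ?_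
    rw [norm_mul, Complex.norm_real, Real.norm_of_nonneg h2]
    calc _ ≤ 2 * n * V ^ (2 * n) + V ^ (2 * n) * (2 / γ + R) :=
          add_le_add h1 (mul_le_mul h3 hR (norm_nonneg _) (by positivity))
      _ = _ := by ring
  obtain ⟨hA, hB⟩ := norm_integral_ee_sq_sub_le hα0 (b := U) hmc
  have h4 : 1 / (α * (c - m)) ≤ 2 / γ := by
    rw [div_le_div_iff₀ (mul_pos hα0 (by linarith)) hγ, one_mul]
    have : α * (c - m) = (l - k) / 2 := by
      rw [hα, hc]; field_simp
    rw [this]; linarith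
  refine ⟨hcomb _ (hA.trans (add_le_add h4 ?_)), fun T hT hTle => hcomb _ ((hB ?_).trans
    (add_le_add h4 ?_))⟩
  · rw [div_eq_mul_inv, hsq]
    have h5 : √(2 * m / k) ≤ 3 / 2 * √U := by
      rw [show (3 / 2 : ℝ) * √U = √(9 / 4 * U) by
        rw [Real.sqrt_mul (by norm_num), show (9 / 4 : ℝ) = (3 / 2) ^ 2 by norm_num,
          Real.sqrt_sq (by norm_num)]]
      apply Real.sqrt_le_sqrt
      rw [div_le_iff₀ hk0]
      nlinarith
    linarith
  · rintro rfl
    rw [hc] at hTle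
    have : k * (l * m / k) - l * m = 0 := by field_simp; ring
    rw [this, abs_zero] at hTle
    linarith
  · have h6 : α * |U - c| = |k * U - l * m| / (2 * m) := by
      have : k * U - l * m = k * (U - c) := by rw [hc]; field_simp
      rw [this, abs_mul, abs_of_pos hk0, hα]; ring
    rw [h6, one_div_div]
    exact div_le_div₀ (by linarith) (by linarith) hT hTle

lemma card_le_of_forall_mem_Ioo {s : Finset ℕ} {x y : ℝ} (hxy : x ≤ y)
    (h : ∀ m ∈ s, x < m ∧ (m : ℝ) < y) : (#s : ℝ) ≤ y - x + 1 := by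
  rcases s.eq_empty_or_nonempty with rfl | hs
  · simp; linarith
  · have h1 := Finset.card_le_card (s := s) (t := Finset.Icc (s.min' hs) (s.max' hs)) fun m hm =>
      Finset.mem_Icc.2 ⟨s.min'_le m hm, s.le_max' m hm⟩
    rw [Nat.card_Icc] at h1
    have h2 : s.min' hs ≤ s.max' hs := s.min'_le _ (s.max'_mem hs)
    have h3 : #s + s.min' hs ≤ s.max' hs + 1 := by omega
    have h4 : (#s : ℝ) + s.min' hs ≤ s.max' hs + 1 := by exact_mod_cast h3
    have h5 := (h _ (s.min'_mem hs)).1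
    have h6 := (h _ (s.max'_mem hs)).2
    linarith

lemma norm_sum_osc_sub_le {n ℓ : ℕ} {l Y k γ : ℝ} (hY : 1 ≤ Y) (hk : 1 ≤ k)
    (hγ : 0 < γ) (hγ1 : γ ≤ 1) (hkl : k + γ ≤ l) :
    ‖∑ m ∈ Finset.Icc 1 ⌊Y ^ 4⌋₊, (m : ℂ) * osc n ℓ l (Y ^ 4) m k -
      ∑ m ∈ Finset.Icc 1 ⌊Y ^ 4⌋₊, (m : ℂ) * oscMain n ℓ l (Y ^ 4) m k‖ ≤
      (l * Y ^ 4) ^ (2 * n) * Y ^ 9 * ((2 * n + 22) / γ) := by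
  classical
  set U : ℝ := Y ^ 4 with hU
  have hU1 : 1 ≤ U := one_le_pow₀ hY
  have hsqrt : √U = Y ^ 2 := by
    rw [hU, show Y ^ 4 = (Y ^ 2) ^ 2 by ring, Real.sqrt_sq (by positivity)]
  set near := (Finset.Icc 1 ⌊U⌋₊).filter fun m : ℕ => |k * U - l * m| < Y ^ 3 with hnear
  have hl : 1 < l := by linarith
  have hcard : (#near : ℝ) ≤ 3 * Y ^ 3 := by
    have h1 : (#near : ℝ) ≤ (k * U + Y ^ 3) / l - (k * U - Y ^ 3) / l + 1 := by
      refine card_le_of_forall_mem_Ioo ?_ fun m hm => ?_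
      · gcongr
        have : 0 ≤ Y ^ 3 := by positivity
        linarith
      · have := abs_lt.1 (Finset.mem_filter.1 hm).2
        constructor
        · rw [div_lt_iff₀ (by linarith)]; linarith
        · rw [lt_div_iff₀ (by linarith)]; linarith
    have h2 : (k * U + Y ^ 3) / l - (k * U - Y ^ 3) / l = 2 * Y ^ 3 / l := by ring
    have h3 : 2 * Y ^ 3 / l ≤ 2 * Y ^ 3 := div_le_self (by positivity) hl.le
    have h4 : 1 ≤ Y ^ 3 := one_le_pow₀ hY
    linarith
  have hV : 0 ≤ (l * U) ^ (2 * n) := by positivity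
  have hbound : ∀ m ∈ Finset.Icc 1 ⌊U⌋₊, ‖(m : ℂ) * osc n ℓ l U m k - (m : ℂ) * oscMain n ℓ l U m k‖ ≤
      (l * U) ^ (2 * n) * (U * (2 * n + 2 / γ + 2 * Y)) +
        if m ∈ near then (l * U) ^ (2 * n) * (6 * (U * Y ^ 2)) else 0 := by
    intro m hm
    have hm1 := (Finset.mem_Icc.1 hm).1
    have hmU : (m : ℝ) ≤ U := (Nat.le_floor_iff (by linarith)).1 (Finset.mem_Icc.1 hm).2
    obtain ⟨hA, hB⟩ := norm_osc_sub_le (n := n) (ℓ := ℓ) hm1 hmU hk hγ hkl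
    rw [← mul_sub, norm_mul, Complex.norm_natCast]
    split_ifs with hmn
    · rw [hsqrt] at hA
      calc _ ≤ U * ((l * U) ^ (2 * n) * (2 * n + 2 / γ + 6 * Y ^ 2)) :=
            mul_le_mul hmU hA (norm_nonneg _) (by linarith)
        _ = (l * U) ^ (2 * n) * (U * (2 * n + 2 / γ)) + (l * U) ^ (2 * n) * (6 * (U * Y ^ 2)) := by
            ring
        _ ≤ _ := by
            have : 2 * (n : ℝ) + 2 / γ ≤ 2 * n + 2 / γ + 2 * Y := by linarith
            gcongr
    · have hfar : Y ^ 3 ≤ |k * U - l * m| := by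
        by_contra h
        exact hmn (Finset.mem_filter.2 ⟨hm, not_le.1 h⟩)
      have := hB _ (by positivity) hfar
      rw [show 2 * U / Y ^ 3 = 2 * Y by rw [hU]; field_simp] at this
      rw [add_zero]
      calc _ ≤ U * ((l * U) ^ (2 * n) * (2 * n + 2 / γ + 2 * Y)) :=
            mul_le_mul hmU this (norm_nonneg _) (by linarith)
        _ = _ := by ring
  rw [← Finset.sum_sub_distrib]
  refine (norm_sum_le _ _).trans ((Finset.sum_le_sum hbound).trans ?_)
  rw [Finset.sum_add_distrib, ← Finset.sum_filter, Finset.filter_mem_eq_inter,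
    Finset.inter_eq_right.2 (Finset.filter_subset _ _), Finset.sum_const, Finset.sum_const,
    nsmul_eq_mul, nsmul_eq_mul, Nat.card_Icc, Nat.add_sub_cancel]
  have hfl : ((⌊U⌋₊ : ℕ) : ℝ) ≤ U := Nat.floor_le (by linarith)
  calc _ ≤ U * ((l * U) ^ (2 * n) * (U * (2 * n + 2 / γ + 2 * Y))) +
        3 * Y ^ 3 * ((l * U) ^ (2 * n) * (6 * (U * Y ^ 2))) := by gcongr
    _ = (l * U) ^ (2 * n) * (Y ^ 8 * (2 * n + 2 / γ) + 20 * Y ^ 9) := by rw [hU]; ring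
    _ ≤ (l * U) ^ (2 * n) * (Y ^ 9 * (2 * n / γ + 2 / γ) + 20 * Y ^ 9 / γ) := by
        gcongr
        · norm_num
        · exact le_div_self (by positivity) hγ hγ1
        · exact le_div_self (by positivity) hγ hγ1
    _ = _ := by ring

/-- The tail of the Fourier expansion of the sawtooth function. -/
noncomputable def sawtoothTail (K : ℕ) (x : ℝ) : ℝ :=
  (1 / 2 - Int.fract x) - ∑ k ∈ Finset.Icc 1 K, Real.sin (2 * Real.pi * k * x) / (Real.pi * k)

/-- A continuous antiderivative of `sawtoothTail`. -/
noncomputable def sawtoothTailPrimitive (K : ℕ) (x : ℝ) : ℝ :=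
  (∑ k ∈ Finset.Icc 1 K, 1 / (k : ℝ) ^ 2 * Real.cos (2 * Real.pi * k * x)) / (2 * Real.pi ^ 2) -
    ∑' k : ℕ, 1 / (k : ℝ) ^ 2 * Real.cos (2 * Real.pi * k * x) / (2 * Real.pi ^ 2)

lemma summable_cos_div_sq (x : ℝ) :
    Summable fun k : ℕ => 1 / (k : ℝ) ^ 2 * Real.cos (2 * Real.pi * k * x) := by
  refine Summable.of_norm_bounded (Real.summable_one_div_nat_pow.2 one_lt_two) fun k => ?_
  rw [norm_mul, Real.norm_of_nonneg (by positivity)]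
  exact mul_le_of_le_one_right (by positivity) (Real.abs_cos_le_one _)

lemma tsum_cos_div_sq (x : ℝ) :
    ∑' k : ℕ, 1 / (k : ℝ) ^ 2 * Real.cos (2 * Real.pi * k * x) =
      Real.pi ^ 2 * (Int.fract x ^ 2 - Int.fract x + 1 / 6) := by
  have h := hasSum_one_div_nat_pow_mul_cos one_ne_zero (x := Int.fract x)
    ⟨Int.fract_nonneg x, (Int.fract_lt_one x).le⟩
  have hB : (Polynomial.map (algebraMap ℚ ℝ) (Polynomial.bernoulli (2 * 1))).eval (Int.fract x) =
      Int.fract x ^ 2 - Int.fract x + 1 / 6 := by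
    simp [Polynomial.bernoulli, Finset.sum_range_succ, bernoulli_two, bernoulli_one]
    ring
  rw [hB] at h
  convert h.tsum_eq using 2
  · ext k
    congr 1
    have : 2 * Real.pi * k * x = 2 * Real.pi * k * Int.fract x + ((k * ⌊x⌋ : ℤ) : ℝ) * (2 * Real.pi) := by
      conv_lhs => rw [← Int.fract_add_floor x]
      push_cast; ring
    rw [this, Real.cos_add_int_mul_two_pi]
  · norm_num [Nat.factorial]
    ring

lemma continuous_sawtoothTailPrimitive (K : ℕ) : Continuous (sawtoothTailPrimitive K) := by
  unfold sawtoothTailPrimitive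
  refine Continuous.sub (by fun_prop) ?_
  simp_rw [tsum_div_const]
  refine Continuous.div_const ?_ _
  refine continuous_tsum (fun k => by fun_prop) (Real.summable_one_div_nat_pow.2 one_lt_two) ?_
  intro k x
  rw [norm_mul, Real.norm_of_nonneg (by positivity)]
  exact mul_le_of_le_one_right (by positivity) (Real.abs_cos_le_one _)

lemma hasDerivAt_sawtoothTailPrimitive (K : ℕ) {x : ℝ} (hx : ∀ z : ℤ, x ≠ z) :
    HasDerivAt (sawtoothTailPrimitive K) (sawtoothTail K x) x := by
  have hpi := Real.pi_ne_zero
  have h1 : HasDerivAt (fun x => (∑ k ∈ Finset.Icc 1 K, 1 / (k : ℝ) ^ 2 *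
      Real.cos (2 * Real.pi * k * x)) / (2 * Real.pi ^ 2))
      (-∑ k ∈ Finset.Icc 1 K, Real.sin (2 * Real.pi * k * x) / (Real.pi * k)) x := by
    have : ∀ k ∈ Finset.Icc 1 K, HasDerivAt (fun x => 1 / (k : ℝ) ^ 2 * Real.cos (2 * Real.pi * k * x))
        (1 / (k : ℝ) ^ 2 * (-Real.sin (2 * Real.pi * k * x) * (2 * Real.pi * k))) x := by
      intro k _
      have := ((hasDerivAt_id' x).const_mul (2 * Real.pi * k)).cos.const_mul (1 / (k : ℝ) ^ 2)
      simpa using this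
    refine ((HasDerivAt.fun_sum this).div_const _).congr_deriv ?_
    rw [Finset.sum_div, ← Finset.sum_neg_distrib]
    refine Finset.sum_congr rfl fun k hk => ?_
    have hk0 : (k : ℝ) ≠ 0 := by
      have := (Finset.mem_Icc.1 hk).1
      positivity
    field_simp
  have h2 : HasDerivAt (fun x => ∑' k : ℕ, 1 / (k : ℝ) ^ 2 * Real.cos (2 * Real.pi * k * x) /
      (2 * Real.pi ^ 2)) (Int.fract x - 1 / 2) x := by
    have e : (fun x => ∑' k : ℕ, 1 / (k : ℝ) ^ 2 * Real.cos (2 * Real.pi * k * x) /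
      (2 * Real.pi ^ 2)) = fun x => (Int.fract x ^ 2 - Int.fract x + 1 / 6) / 2 := by
      ext y
      rw [tsum_div_const, tsum_cos_div_sq]
      field_simp
    rw [e]
    have hev : (fun y => ((y - ⌊x⌋) ^ 2 - (y - ⌊x⌋) + 1 / 6) / 2) =ᶠ[nhds x]
        fun y => (Int.fract y ^ 2 - Int.fract y + 1 / 6) / 2 := by
      have hlt : (⌊x⌋ : ℝ) < x := lt_of_le_of_ne (Int.floor_le x) fun h => hx _ h.symm
      filter_upwards [Ioo_mem_nhds hlt (Int.lt_floor_add_one x)] with y hy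
      have : ⌊y⌋ = ⌊x⌋ := Int.floor_eq_iff.2 ⟨hy.1.le, hy.2⟩
      rw [Int.fract, this]
    have h3 : HasDerivAt (fun y : ℝ => y - ⌊x⌋) 1 x := (hasDerivAt_id' x).sub_const _
    have h4 := ((((h3.fun_pow 2).fun_sub h3).add_const (1 / 6)).div_const 2)
    refine (h4.congr_of_eventuallyEq hev.symm).congr_deriv ?_
    rw [Int.fract]
    push_cast
    ring
  refine (h1.sub h2).congr_deriv ?_
  rw [sawtoothTail]
  ring

/-- The tail of the series `∑ 1 / k ^ 2`. -/
noncomputable def invSqTail (K : ℕ) : ℝ :=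
  ∑' k : ℕ, 1 / (k : ℝ) ^ 2 - ∑ k ∈ Finset.Icc 1 K, 1 / (k : ℝ) ^ 2

lemma sum_Icc_one_eq_range {M : Type*} [AddCommMonoid M] (f : ℕ → M) (h0 : f 0 = 0) (K : ℕ) :
    ∑ k ∈ Finset.Icc 1 K, f k = ∑ k ∈ Finset.range (K + 1), f k := by
  rw [Finset.sum_range_succ', h0, add_zero, Finset.range_eq_Ico, Finset.sum_Ico_add' f 0 K 1]
  rfl

lemma tendsto_invSqTail : Filter.Tendsto invSqTail Filter.atTop (nhds 0) := by
  have h := (Real.summable_one_div_nat_pow.2 one_lt_two).hasSum.tendsto_sum_nat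
  have h2 := (h.comp (Filter.tendsto_add_atTop_nat 1)).const_sub (∑' k : ℕ, 1 / (k : ℝ) ^ 2)
  rw [sub_self] at h2
  refine h2.congr fun K => ?_
  rw [invSqTail, sum_Icc_one_eq_range _ (by simp)]
  rfl

lemma abs_sawtoothTailPrimitive_le (K : ℕ) (x : ℝ) :
    |sawtoothTailPrimitive K x| ≤ invSqTail K := by
  have hs := summable_cos_div_sq x
  have h1 := Real.summable_one_div_nat_pow.2 one_lt_two
  have key : |(∑ k ∈ Finset.Icc 1 K, 1 / (k : ℝ) ^ 2 * Real.cos (2 * Real.pi * k * x)) -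
      ∑' k : ℕ, 1 / (k : ℝ) ^ 2 * Real.cos (2 * Real.pi * k * x)| ≤ invSqTail K := by
    rw [abs_le, invSqTail]
    have ha := (h1.sub hs).sum_le_tsum (Finset.Icc 1 K) fun k _ => by
      have := mul_le_of_le_one_right (a := 1 / (k : ℝ) ^ 2) (by positivity)
        (Real.cos_le_one (2 * Real.pi * k * x))
      linarith
    have hb := (h1.add hs).sum_le_tsum (Finset.Icc 1 K) fun k _ => by
      have := mul_le_mul_of_nonneg_left (Real.neg_one_le_cos (2 * Real.pi * k * x))
        (a := 1 / (k : ℝ) ^ 2) (by positivity)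
      linarith
    rw [Finset.sum_sub_distrib, h1.tsum_sub hs] at ha
    rw [Finset.sum_add_distrib, h1.tsum_add hs] at hb
    constructor <;> linarith
  rw [sawtoothTailPrimitive, tsum_div_const, ← sub_div, abs_div,
    abs_of_pos (a := 2 * Real.pi ^ 2) (by positivity)]
  refine (div_le_self (abs_nonneg _) ?_).trans key
  nlinarith [Real.pi_gt_three]

lemma measurable_sawtoothTail (K : ℕ) : Measurable (sawtoothTail K) := by
  unfold sawtoothTail
  refine Measurable.sub (measurable_const.sub measurable_fract) ?_
  exact Continuous.measurable (by fun_prop)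

lemma abs_sawtoothTail_le (K : ℕ) (x : ℝ) : |sawtoothTail K x| ≤ 1 + K := by
  rw [sawtoothTail]
  refine (abs_sub _ _).trans (add_le_add ?_ ?_)
  · rw [abs_le]
    constructor <;> linarith [Int.fract_nonneg x, Int.fract_lt_one x]
  · refine (Finset.abs_sum_le_sum_abs _ _).trans ((Finset.sum_le_card_nsmul _ _ 1 ?_).trans ?_)
    · intro k hk
      have hk1 : (1 : ℝ) ≤ k := by exact_mod_cast (Finset.mem_Icc.1 hk).1
      have : 1 ≤ Real.pi * k := by nlinarith [Real.pi_gt_three]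
      rw [abs_div, abs_of_pos (by linarith : 0 < Real.pi * k)]
      exact div_le_one_of_le₀ ((Real.abs_sin_le_one _).trans this) (by linarith)
    · simp

lemma intervalIntegrable_mul_of_bounded {f : ℝ → ℝ} {G : ℝ → ℂ} {a b C : ℝ} (hab : a ≤ b)
    (hf : Measurable f) (hC : ∀ x, |f x| ≤ C) (hG : ContinuousOn G (Set.Icc a b)) :
    IntervalIntegrable (fun u => G u * (f u : ℂ)) MeasureTheory.volume a b := by
  have h : IntervalIntegrable (fun u => (f u : ℂ)) MeasureTheory.volume a b := by
    rw [intervalIntegrable_iff]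
    refine MeasureTheory.Measure.integrableOn_of_bounded (M := C) (by simp)
      (Complex.measurable_ofReal.comp hf).aestronglyMeasurable
      (Filter.Eventually.of_forall fun x => ?_)
    rw [Complex.norm_real]; exact hC x
  exact h.continuousOn_mul (by rwa [Set.uIcc_of_le hab])

lemma tendsto_integral_mul_sawtoothTail {G G' : ℝ → ℂ} {w w' : ℝ → ℝ} {a b : ℝ} (hab : a ≤ b)
    (hG : ∀ x ∈ Set.Icc a b, HasDerivAt G (G' x) x) (hG' : ContinuousOn G' (Set.Icc a b))
    (hw : ∀ x, HasDerivAt w (w' x) x) (hw' : Continuous w')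
    (hinj : Set.InjOn w (Set.Icc a b)) :
    Filter.Tendsto (fun K => ∫ u in a..b, G u * w' u * (sawtoothTail K (w u) : ℂ))
      Filter.atTop (nhds 0) := by
  have hwc : Continuous w := continuous_iff_continuousAt.2 fun x => (hw x).continuousAt
  have hGc : ContinuousOn G (Set.Icc a b) := fun x hx => (hG x hx).continuousAt.continuousWithinAt
  set C : ℝ := ‖G b‖ + ‖G a‖ + ∫ u in a..b, ‖G' u‖ with hC
  have hG'i : IntervalIntegrable G' MeasureTheory.volume a b :=
    ContinuousOn.intervalIntegrable (by rwa [Set.uIcc_of_le hab])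
  suffices hle : ∀ K, ‖∫ u in a..b, G u * w' u * (sawtoothTail K (w u) : ℂ)‖ ≤ invSqTail K * C by
    refine squeeze_zero_norm hle ?_
    simpa using tendsto_invSqTail.mul_const C
  intro K
  have hPc := continuous_sawtoothTailPrimitive K
  have hη0 : 0 ≤ invSqTail K := (abs_nonneg _).trans (abs_sawtoothTailPrimitive_le K 0)
  set s : Set ℝ := {u | u ∈ Set.Icc a b ∧ ∃ z : ℤ, w u = z} with hs
  have hsc : s.Countable := by
    have : s = ⋃ z : ℤ, {u | u ∈ Set.Icc a b ∧ w u = z} := by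
      ext u; simp [hs]
    rw [this]
    refine Set.countable_iUnion fun z => Set.Subsingleton.countable ?_
    rintro u ⟨hu, hu'⟩ v ⟨hv, hv'⟩
    exact hinj hu hv (hu'.trans hv'.symm)
  have hi1 : IntervalIntegrable (fun u => G' u * (sawtoothTailPrimitive K (w u) : ℂ))
      MeasureTheory.volume a b :=
    hG'i.mul_continuousOn (by fun_prop)
  have hi2 : IntervalIntegrable (fun u => G u * w' u * (sawtoothTail K (w u) : ℂ))
      MeasureTheory.volume a b :=
    intervalIntegrable_mul_of_bounded hab ((measurable_sawtoothTail K).comp hwc.measurable)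
      (fun x => abs_sawtoothTail_le K _) (hGc.mul (by fun_prop))
  have hftc := MeasureTheory.integral_eq_of_hasDerivAt_off_countable_of_le
    (fun u => G u * (sawtoothTailPrimitive K (w u) : ℂ))
    (fun u => G' u * (sawtoothTailPrimitive K (w u) : ℂ) + G u * w' u * (sawtoothTail K (w u) : ℂ))
    hab hsc (hGc.mul (by fun_prop)) (fun x hx => by
      have hxI : x ∈ Set.Icc a b := ⟨hx.1.1.le, hx.1.2.le⟩
      have hxz : ∀ z : ℤ, w x ≠ z := fun z hz => hx.2 ⟨hxI, z, hz⟩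
      have h1 := ((hasDerivAt_sawtoothTailPrimitive K hxz).comp x (hw x)).ofReal_comp
      refine ((hG x hxI).fun_mul h1).congr_deriv ?_
      simp only [Function.comp_apply]
      push_cast; ring) (hi1.add hi2)
  rw [intervalIntegral.integral_add hi1 hi2] at hftc
  have hb : ∀ x, ‖G x * (sawtoothTailPrimitive K (w x) : ℂ)‖ ≤ invSqTail K * ‖G x‖ := fun x => by
    rw [norm_mul, Complex.norm_real, mul_comm]
    exact mul_le_mul_of_nonneg_right (abs_sawtoothTailPrimitive_le K _) (norm_nonneg _)
  have hintegral : ‖∫ u in a..b, G' u * (sawtoothTailPrimitive K (w u) : ℂ)‖ ≤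
      invSqTail K * ∫ u in a..b, ‖G' u‖ := by
    rw [← intervalIntegral.integral_const_mul]
    refine intervalIntegral.norm_integral_le_of_norm_le hab (Filter.Eventually.of_forall ?_)
      (hG'i.norm.const_mul _)
    intro x _
    rw [norm_mul, Complex.norm_real, mul_comm]
    exact mul_le_mul_of_nonneg_right (abs_sawtoothTailPrimitive_le K _) (norm_nonneg _)
  have heq : ∫ u in a..b, G u * w' u * (sawtoothTail K (w u) : ℂ) =
      (G b * (sawtoothTailPrimitive K (w b) : ℂ) - G a * (sawtoothTailPrimitive K (w a) : ℂ)) -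
        ∫ u in a..b, G' u * (sawtoothTailPrimitive K (w u) : ℂ) := by
    rw [← hftc]; ring
  rw [heq, hC, mul_add, mul_add]
  exact (norm_sub_le _ _).trans (add_le_add ((norm_sub_le _ _).trans (add_le_add (hb b) (hb a))) hintegral)

/-- The Fourier integral of a single summand of `E*`. -/
noncomputable def sawOsc (n ℓ : ℕ) (l U : ℝ) (m : ℕ) : ℂ :=
  ∫ u in (m : ℝ)..U, (((u ^ 2 - (m : ℝ) ^ 2) ^ n : ℝ) : ℂ) * ee (-(l * u)) *
    ((1 / 2 - Int.fract (u ^ 2 / (2 * m) - m / 2 - ℓ / 2) : ℝ) : ℂ)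

lemma sin_div_eq (k : ℕ) (x : ℝ) :
    ((Real.sin (2 * Real.pi * k * x) / (Real.pi * k) : ℝ) : ℂ) =
      (ee (k * x) - ee (-k * x)) / (2 * Real.pi * Complex.I * k) := by
  have h : ee (k * x) - ee (-k * x) = 2 * Complex.I * Real.sin (2 * Real.pi * k * x) := by
    rw [ee, ee, show 2 * Real.pi * (k * x) = 2 * Real.pi * k * x by ring,
      show 2 * Real.pi * (-k * x) = -(2 * Real.pi * k * x) by ring, Complex.ofReal_sin, Complex.sin]
    push_cast
    ring_nf
    rw [Complex.I_sq]
    ring_nf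
  rw [h]
  rcases Nat.eq_zero_or_pos k with rfl | hk
  · simp
  · have : (k : ℂ) ≠ 0 := by exact_mod_cast hk.ne'
    have h2 : (Real.pi : ℂ) ≠ 0 := by exact_mod_cast Real.pi_ne_zero
    push_cast
    field_simp

lemma tendsto_sum_osc (n ℓ : ℕ) (l U : ℝ) {m : ℕ} (hm : 1 ≤ m) (hmU : m ≤ U) :
    Filter.Tendsto (fun K : ℕ => ∑ k ∈ Finset.Icc 1 K,
      (osc n ℓ l U m k - osc n ℓ l U m (-k)) / (2 * Real.pi * Complex.I * k))
      Filter.atTop (nhds (sawOsc n ℓ l U m)) := by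
  have hm0 : (0 : ℝ) < m := by exact_mod_cast hm
  set w : ℝ → ℝ := fun u => u ^ 2 / (2 * m) - m / 2 - ℓ / 2 with hw
  set w' : ℝ → ℝ := fun u => u / m with hw'
  set h : ℝ → ℂ := fun u => (((u ^ 2 - (m : ℝ) ^ 2) ^ n : ℝ) : ℂ) * ee (-(l * u)) with hh
  have hhc : Continuous h := by rw [hh]; fun_prop
  set h' : ℝ → ℂ := fun x => ((n * (x ^ 2 - (m : ℝ) ^ 2) ^ (n - 1) * (2 * x) : ℝ) : ℂ) * ee (-(l * x)) +
    (((x ^ 2 - (m : ℝ) ^ 2) ^ n : ℝ) : ℂ) * (2 * Real.pi * Complex.I * (-l : ℝ) * ee (-(l * x)))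
    with hh'
  have hd : ∀ x, HasDerivAt h (h' x) x := fun x => by
    have hl : HasDerivAt (fun u : ℝ => -(l * u)) (-l) x := by
      simpa using ((hasDerivAt_id' x).const_mul l).fun_neg
    exact (hasDerivAt_sq_sub_pow m n x).ofReal_comp.fun_mul (hasDerivAt_ee hl)
  have hwd : ∀ x, HasDerivAt w (w' x) x := fun x => by
    refine ((((hasDerivAt_pow 2 x).div_const (2 * (m : ℝ))).sub_const ((m : ℝ) / 2)).sub_const
      ((ℓ : ℝ) / 2)).congr_deriv ?_
    rw [hw']; push_cast; field_simp
  have hpos : ∀ x ∈ Set.Icc (m : ℝ) U, x ≠ 0 := fun x hx => by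
    have := hx.1; intro h0; linarith
  have hG : ∀ x ∈ Set.Icc (m : ℝ) U, HasDerivAt (fun u => h u * ((m * u⁻¹ : ℝ) : ℂ))
      (h' x * ((m * x⁻¹ : ℝ) : ℂ) + h x * ((m * (-(x ^ 2)⁻¹) : ℝ) : ℂ)) x := fun x hx =>
    (hd x).fun_mul ((hasDerivAt_inv (hpos x hx)).const_mul (m : ℝ)).ofReal_comp
  have hinvc : ContinuousOn (fun x : ℝ => ((m * x⁻¹ : ℝ) : ℂ)) (Set.Icc (m : ℝ) U) :=
    Complex.continuous_ofReal.comp_continuousOn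
      (continuousOn_const.mul (continuousOn_id.inv₀ hpos))
  have hinvc2 : ContinuousOn (fun x : ℝ => ((m * (-(x ^ 2)⁻¹) : ℝ) : ℂ)) (Set.Icc (m : ℝ) U) :=
    Complex.continuous_ofReal.comp_continuousOn
      (continuousOn_const.mul ((continuousOn_id.pow 2).inv₀ fun x hx => pow_ne_zero 2 (hpos x hx)).neg)
  have hh'c : Continuous h' := by rw [hh']; fun_prop
  have hinj : Set.InjOn w (Set.Icc (m : ℝ) U) := by
    intro x hx y hy hxy
    simp only [hw, sub_left_inj] at hxy
    rw [div_left_inj' (by positivity)] at hxy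
    exact (pow_left_inj₀ (by linarith [hx.1]) (by linarith [hy.1]) two_ne_zero).1 hxy
  have hlim := tendsto_integral_mul_sawtoothTail hmU hG
    ((hh'c.continuousOn.mul hinvc).add (hhc.continuousOn.mul hinvc2)) hwd (by fun_prop) hinj
  have hK : ∀ K : ℕ, ∫ u in (m : ℝ)..U, h u * ((m * u⁻¹ : ℝ) : ℂ) * w' u * (sawtoothTail K (w u) : ℂ) =
      sawOsc n ℓ l U m - ∑ k ∈ Finset.Icc 1 K,
      (osc n ℓ l U m k - osc n ℓ l U m (-k)) / (2 * Real.pi * Complex.I * k) := by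
    intro K
    have hosc : ∀ k : ℝ, osc n ℓ l U m k = ∫ u in (m : ℝ)..U, h u * ee (k * w u) := fun k => by
      refine intervalIntegral.integral_congr fun u _ => ?_
      simp only [hh, hw]
      rw [sub_eq_add_neg (k * _), ee_add]; ring
    have hsum : ∑ k ∈ Finset.Icc 1 K,
        (osc n ℓ l U m k - osc n ℓ l U m (-k)) / (2 * Real.pi * Complex.I * k) =
        ∫ u in (m : ℝ)..U, h u *
          ((∑ k ∈ Finset.Icc 1 K, Real.sin (2 * Real.pi * k * w u) / (Real.pi * k) : ℝ) : ℂ) := by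
      simp_rw [Complex.ofReal_sum, Finset.mul_sum]
      rw [intervalIntegral.integral_finsetSum fun k _ =>
        Continuous.intervalIntegrable (by fun_prop) _ _]
      refine Finset.sum_congr rfl fun k _ => ?_
      rw [hosc, hosc, ← intervalIntegral.integral_sub
        (Continuous.intervalIntegrable (by fun_prop) _ _)
        (Continuous.intervalIntegrable (by fun_prop) _ _), ← intervalIntegral.integral_div]
      refine intervalIntegral.integral_congr fun u _ => ?_
      rw [sin_div_eq, ← mul_sub, mul_div_assoc]
    have hi : IntervalIntegrable (fun u => h u * ((1 / 2 - Int.fract (w u) : ℝ) : ℂ))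
        MeasureTheory.volume (m : ℝ) U := by
      refine intervalIntegrable_mul_of_bounded (C := 1) hmU ?_ (fun x => ?_) hhc.continuousOn
      · exact measurable_const.sub (measurable_fract.comp (Continuous.measurable (by fun_prop)))
      · rw [abs_le]
        constructor <;> linarith [Int.fract_nonneg (w x), Int.fract_lt_one (w x)]
    rw [hsum, sawOsc, ← intervalIntegral.integral_sub hi
      (Continuous.intervalIntegrable (by fun_prop) _ _)]
    refine intervalIntegral.integral_congr fun u hu => ?_
    rw [Set.uIcc_of_le hmU] at hu
    have hu0 : (u : ℂ) ≠ 0 := by exact_mod_cast hpos u hu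
    have hm0' : (m : ℂ) ≠ 0 := by exact_mod_cast hm0.ne'
    simp only [sawtoothTail, hw']
    generalize (∑ k ∈ Finset.Icc 1 K, Real.sin (2 * Real.pi * k * w u) / (Real.pi * k)) = S
    push_cast
    field_simp
  have := hlim.const_sub (sawOsc n ℓ l U m)
  rw [sub_zero] at this
  refine this.congr fun K => ?_
  rw [hK, sub_sub_cancel]

lemma mul_le_sub_of_gap {l k γ : ℝ} (hl : 0 ≤ l) (hlk : l < k) (hγ : γ ≤ k - l)
    (hγ1 : γ ≤ 1) :
    γ * k ≤ (k - l) * (l + 1) := by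
  rcases le_total k (l + 1) with h | h
  · exact mul_le_mul hγ h (by linarith) (by linarith)
  · nlinarith [mul_nonneg hl (show 0 ≤ k - l - 1 by linarith),
      mul_le_mul_of_nonneg_right hγ1 (show 0 ≤ k by linarith)]

lemma norm_sawOsc_sub_le {n ℓ m : ℕ} {l U γ : ℝ} (hm : 1 ≤ m) (hmU : m ≤ U) (hl : 0 ≤ l)
    (hγ : 0 < γ) (hγ1 : γ ≤ 1) (hgap : ∀ k : ℕ, 1 ≤ k → γ ≤ |l - k|) :
    ‖sawOsc n ℓ l U m - ∑ k ∈ Finset.Icc 1 ⌊l⌋₊, osc n ℓ l U m k / (2 * Real.pi * Complex.I * k)‖ ≤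
      2 * U ^ (2 * n) * (l + 1) / γ := by
  have hm' : (1 : ℝ) ≤ m := by exact_mod_cast hm
  have hU : 0 < U := by linarith
  have hlim := ((tendsto_sum_osc n ℓ l U hm hmU).sub_const
    (∑ k ∈ Finset.Icc 1 ⌊l⌋₊, osc n ℓ l U m k / (2 * Real.pi * Complex.I * k))).norm
  refine le_of_tendsto hlim ?_
  filter_upwards [Filter.eventually_ge_atTop ⌊l⌋₊] with K hK
  have hsub : Finset.Icc 1 ⌊l⌋₊ = (Finset.Icc 1 K).filter fun k => k ≤ ⌊l⌋₊ := by
    ext k; simp only [Finset.mem_Icc, Finset.mem_filter]; omega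
  rw [hsub, Finset.sum_filter, ← Finset.sum_sub_distrib]
  set D : ℝ := 2 * U ^ (2 * n) * (l + 1) / γ with hD
  have hDpos : 0 < D := by positivity
  have hterm : ∀ k ∈ Finset.Icc 1 K,
      ‖(osc n ℓ l U m k - osc n ℓ l U m (-k)) / (2 * Real.pi * Complex.I * k) -
        (if k ≤ ⌊l⌋₊ then osc n ℓ l U m k / (2 * Real.pi * Complex.I * k) else 0)‖ ≤
      D / Real.pi * (1 / (k : ℝ) ^ 2) := by
    intro k hk
    have hk1 := (Finset.mem_Icc.1 hk).1
    have hk1' : (1 : ℝ) ≤ k := by exact_mod_cast hk1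
    have hk0 : (0 : ℝ) < k := by linarith
    have hneg : ‖osc n ℓ l U m (-k)‖ ≤ D / k := by
      refine (norm_osc_neg_le hm hmU hl hk0).trans ?_
      gcongr
      rw [hD, le_div_iff₀ hγ]
      have h0 : 0 ≤ 2 * U ^ (2 * n) := by positivity
      exact mul_le_mul_of_nonneg_left (by linarith) h0
    have hnorm : ‖(2 * Real.pi * Complex.I * k : ℂ)‖ = 2 * Real.pi * k := by
      simp [abs_of_pos Real.pi_pos]
    have hnum : ∀ z : ℂ, ‖z‖ ≤ 2 * (D / k) →
        ‖z / (2 * Real.pi * Complex.I * k)‖ ≤ D / Real.pi * (1 / (k : ℝ) ^ 2) := by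
      intro z hz
      rw [norm_div, hnorm, div_le_iff₀ (by positivity)]
      refine hz.trans (le_of_eq ?_)
      field_simp
    split_ifs with hkl
    · rw [← sub_div]
      refine hnum _ ?_
      rw [sub_sub_cancel_left, norm_neg]
      have : 0 ≤ D / k := by positivity
      linarith
    · rw [sub_zero]
      refine hnum _ ((norm_sub_le _ _).trans ?_)
      have hlk : l < k := Nat.lt_of_floor_lt (not_le.1 hkl)
      have hg := hgap k hk1
      rw [abs_of_neg (by linarith)] at hg
      have hpos : ‖osc n ℓ l U m k‖ ≤ D / k := by
        refine (norm_osc_le_of_lt hm hmU hl hlk).trans ?_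
        rw [hD, div_div, div_le_div_iff₀ (by linarith) (by positivity)]
        have h0 : 0 ≤ 2 * U ^ (2 * n) := by positivity
        have := mul_le_mul_of_nonneg_left (mul_le_sub_of_gap hl hlk (by linarith) hγ1) h0
        linarith
      linarith
  refine (norm_sum_le _ _).trans ((Finset.sum_le_sum hterm).trans ?_)
  rw [← Finset.mul_sum]
  have hz : ∑ k ∈ Finset.Icc 1 K, 1 / (k : ℝ) ^ 2 ≤ Real.pi ^ 2 / 6 :=
    sum_le_hasSum _ (fun k _ => by positivity) hasSum_zeta_two
  have hpi := Real.pi_pos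
  calc _ ≤ D / Real.pi * (Real.pi ^ 2 / 6) := by gcongr
    _ = D * (Real.pi / 6) := by field_simp
    _ ≤ D * 1 := by gcongr; linarith [Real.pi_lt_four]
    _ = D := mul_one D

/-- The arithmetic error term `E*`. -/
noncomputable def Estar (ℓ : ℕ) (u : ℝ) : ℝ :=
  -∑ m ∈ Finset.Icc 1 ⌊u⌋₊, (m : ℝ) * (u ^ 2 - (m : ℝ) ^ 2) ^ (ℓ - 1) *
    (Int.fract (u ^ 2 / (2 * m) - (m : ℝ) / 2 - (ℓ : ℝ) / 2) - 1 / 2)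

/-- A single summand of `E*`, without the restriction `m ≤ u`. -/
noncomputable def estarSummand (ℓ m : ℕ) (u : ℝ) : ℝ :=
  (m : ℝ) * (u ^ 2 - (m : ℝ) ^ 2) ^ (ℓ - 1) *
    (1 / 2 - Int.fract (u ^ 2 / (2 * m) - (m : ℝ) / 2 - (ℓ : ℝ) / 2))

lemma Estar_eq_sum_indicator {ℓ : ℕ} {u U : ℝ} (hu : 0 ≤ u) (huU : u ≤ U) :
    Estar ℓ u = ∑ m ∈ Finset.Icc 1 ⌊U⌋₊, (Set.Ici (m : ℝ)).indicator (estarSummand ℓ m) u := by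
  have hsub : Finset.Icc 1 ⌊u⌋₊ = (Finset.Icc 1 ⌊U⌋₊).filter fun m : ℕ => (m : ℝ) ≤ u := by
    ext m
    have := Nat.floor_le_floor huU
    simp only [Finset.mem_Icc, Finset.mem_filter, ← Nat.le_floor_iff hu]
    omega
  rw [Estar, hsub, Finset.sum_filter, ← Finset.sum_neg_distrib]
  refine Finset.sum_congr rfl fun m _ => ?_
  simp only [Set.indicator, Set.mem_Ici, estarSummand]
  split_ifs
  · ring
  · simp

lemma intervalIntegrable_indicator_estarSummand (ℓ m : ℕ) {U : ℝ} (hU : 0 ≤ U) :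
    IntervalIntegrable ((Set.Ici (m : ℝ)).indicator (estarSummand ℓ m))
      MeasureTheory.volume 0 U := by
  have h : IntervalIntegrable (estarSummand ℓ m) MeasureTheory.volume 0 U := by
    unfold estarSummand
    have hf : IntervalIntegrable (fun u : ℝ => 1 / 2 -
        Int.fract (u ^ 2 / (2 * m) - (m : ℝ) / 2 - (ℓ : ℝ) / 2)) MeasureTheory.volume 0 U := by
      rw [intervalIntegrable_iff]
      refine MeasureTheory.Measure.integrableOn_of_bounded (M := 1) (by simp)
        (Measurable.aestronglyMeasurable ?_) (Filter.Eventually.of_forall fun x => ?_)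
      · exact measurable_const.sub (measurable_fract.comp (Continuous.measurable (by fun_prop)))
      · rw [Real.norm_eq_abs, abs_le]
        constructor <;> linarith [Int.fract_nonneg (x ^ 2 / (2 * m) - (m : ℝ) / 2 - (ℓ : ℝ) / 2),
          Int.fract_lt_one (x ^ 2 / (2 * m) - (m : ℝ) / 2 - (ℓ : ℝ) / 2)]
    exact hf.continuousOn_mul (by fun_prop)
  rw [intervalIntegrable_iff_integrableOn_Ioc_of_le hU] at h ⊢
  exact MeasureTheory.IntegrableOn.indicator h measurableSet_Ici

lemma intervalIntegrable_Estar (ℓ : ℕ) {U : ℝ} (hU : 0 ≤ U) :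
    IntervalIntegrable (Estar ℓ) MeasureTheory.volume 0 U := by
  have h : IntervalIntegrable (∑ m ∈ Finset.Icc 1 ⌊U⌋₊,
      (Set.Ici (m : ℝ)).indicator (estarSummand ℓ m)) MeasureTheory.volume 0 U :=
    IntervalIntegrable.sum _ fun m _ => intervalIntegrable_indicator_estarSummand ℓ m hU
  refine h.congr fun u hu => ?_
  rw [Set.uIoc_of_le hU] at hu
  rw [Finset.sum_apply]
  exact (Estar_eq_sum_indicator hu.1.le hu.2).symm

lemma integral_Estar_mul_ee (ℓ : ℕ) (l : ℝ) {U : ℝ} (hU : 0 ≤ U) :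
    ∫ u in (0 : ℝ)..U, (Estar ℓ u : ℂ) * ee (-(l * u)) =
      ∑ m ∈ Finset.Icc 1 ⌊U⌋₊, (m : ℂ) * sawOsc (ℓ - 1) ℓ l U m := by
  have h1 : ∫ u in (0 : ℝ)..U, (Estar ℓ u : ℂ) * ee (-(l * u)) =
      ∫ u in (0 : ℝ)..U, ∑ m ∈ Finset.Icc 1 ⌊U⌋₊,
        (((Set.Ici (m : ℝ)).indicator (estarSummand ℓ m) u : ℝ) : ℂ) * ee (-(l * u)) := by
    refine intervalIntegral.integral_congr fun u hu => ?_
    rw [Set.uIcc_of_le hU] at hu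
    simp only [Estar_eq_sum_indicator hu.1 hu.2, Complex.ofReal_sum, Finset.sum_mul]
  rw [h1, intervalIntegral.integral_finsetSum]
  · refine Finset.sum_congr rfl fun m hm => ?_
    have hm1 := (Finset.mem_Icc.1 hm).1
    have hm0 : (0 : ℝ) < m := by exact_mod_cast hm1
    have hmU : (m : ℝ) ≤ U := (Nat.le_floor_iff hU).1 (Finset.mem_Icc.1 hm).2
    have h2 : ∀ u : ℝ, (((Set.Ici (m : ℝ)).indicator (estarSummand ℓ m) u : ℝ) : ℂ) * ee (-(l * u)) =
        (Set.Ici (m : ℝ)).indicator (fun u => (estarSummand ℓ m u : ℂ) * ee (-(l * u))) u := by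
      intro u
      simp only [Set.indicator]
      split_ifs <;> simp
    simp_rw [h2]
    have h3 : Set.Ioc 0 U ∩ Set.Ici (m : ℝ) = Set.Icc (m : ℝ) U := by
      ext u
      simp only [Set.mem_inter_iff, Set.mem_Ioc, Set.mem_Ici, Set.mem_Icc]
      constructor
      · rintro ⟨⟨_, h⟩, h'⟩; exact ⟨h', h⟩
      · rintro ⟨h, h'⟩; exact ⟨⟨by linarith, h'⟩, h⟩
    rw [intervalIntegral.integral_of_le hU, MeasureTheory.setIntegral_indicator measurableSet_Ici, h3,
      MeasureTheory.integral_Icc_eq_integral_Ioc, ← intervalIntegral.integral_of_le hmU, sawOsc,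
      ← intervalIntegral.integral_const_mul]
    refine intervalIntegral.integral_congr fun u _ => ?_
    simp only [estarSummand]
    push_cast
    ring
  · intro m _
    have h := intervalIntegrable_indicator_estarSummand ℓ m hU
    exact IntervalIntegrable.mul_continuousOn ⟨h.1.ofReal, h.2.ofReal⟩ (by fun_prop)

/-- The stationary phase contribution of the frequency `k` to the Fourier integral of `E*`. -/
noncomputable def mainSum (n ℓ : ℕ) (l U k : ℝ) : ℂ :=
  ∑ m ∈ Icc 1 ⌊U⌋₊, (m : ℂ) * oscMain n ℓ l U m k

lemma norm_two_pi_I_mul (k : ℕ) : ‖(2 * Real.pi * Complex.I * k : ℂ)‖ = 2 * Real.pi * k := by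
  simp [abs_of_pos Real.pi_pos]

lemma norm_div_two_pi_I_mul_le {k : ℕ} (hk : 1 ≤ k) (z : ℂ) :
    ‖z / (2 * Real.pi * Complex.I * k)‖ ≤ ‖z‖ := by
  have hk' : (1 : ℝ) ≤ k := by exact_mod_cast hk
  rw [norm_div, norm_two_pi_I_mul]
  refine div_le_self (norm_nonneg _) ?_
  nlinarith [Real.pi_gt_three]

lemma norm_integral_Estar_sub_le {ℓ : ℕ} {l Y γ : ℝ} (hY : 1 ≤ Y) (hl : 0 ≤ l) (hγ : 0 < γ)
    (hγ1 : γ ≤ 1) (hgap : ∀ k : ℕ, 1 ≤ k → γ ≤ |l - k|) :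
    ‖(∫ u in (0 : ℝ)..Y ^ 4, (Estar ℓ u : ℂ) * ee (-(l * u))) -
      ∑ k ∈ Icc 1 ⌊l⌋₊, mainSum (ℓ - 1) ℓ l (Y ^ 4) k / (2 * Real.pi * Complex.I * k)‖ ≤
      (l + 1) ^ (2 * (ℓ - 1) + 1) * Y ^ (8 * (ℓ - 1) + 9) * ((2 * (ℓ - 1 : ℕ) + 24) / γ) := by
  set n := ℓ - 1 with hn
  set U := Y ^ 4 with hU
  have hU0 : 0 ≤ U := by positivity
  have hU1 : 1 ≤ U := one_le_pow₀ hY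
  rw [integral_Estar_mul_ee ℓ l hU0, ← hn]
  have hfl : (⌊U⌋₊ : ℝ) ≤ U := Nat.floor_le hU0
  have h1 : ‖∑ m ∈ Icc 1 ⌊U⌋₊, (m : ℂ) * sawOsc n ℓ l U m - ∑ m ∈ Icc 1 ⌊U⌋₊, (m : ℂ) *
      ∑ k ∈ Icc 1 ⌊l⌋₊, osc n ℓ l U m k / (2 * Real.pi * Complex.I * k)‖ ≤
      U * (U * (2 * U ^ (2 * n) * (l + 1) / γ)) := by
    rw [← Finset.sum_sub_distrib]
    refine (norm_sum_le_of_le (n := fun _ => U * (2 * U ^ (2 * n) * (l + 1) / γ)) _ fun m hm => ?_).trans ?_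
    · have hmU : (m : ℝ) ≤ U := (Nat.le_floor_iff hU0).1 (Finset.mem_Icc.1 hm).2
      rw [← mul_sub, norm_mul, Complex.norm_natCast]
      exact mul_le_mul hmU (norm_sawOsc_sub_le (Finset.mem_Icc.1 hm).1 hmU hl hγ hγ1 hgap)
        (norm_nonneg _) hU0
    · rw [Finset.sum_const, Nat.card_Icc, nsmul_eq_mul, Nat.add_sub_cancel]
      gcongr
  have h2 : ∑ m ∈ Icc 1 ⌊U⌋₊, (m : ℂ) *
      ∑ k ∈ Icc 1 ⌊l⌋₊, osc n ℓ l U m k / (2 * Real.pi * Complex.I * k) =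
      ∑ k ∈ Icc 1 ⌊l⌋₊, (∑ m ∈ Icc 1 ⌊U⌋₊, (m : ℂ) * osc n ℓ l U m k) /
        (2 * Real.pi * Complex.I * k) := by
    simp_rw [Finset.mul_sum, Finset.sum_div]
    rw [Finset.sum_comm]
    simp_rw [mul_div_assoc]
  have h3 : ‖∑ k ∈ Icc 1 ⌊l⌋₊, (∑ m ∈ Icc 1 ⌊U⌋₊, (m : ℂ) * osc n ℓ l U m k) /
        (2 * Real.pi * Complex.I * k) -
      ∑ k ∈ Icc 1 ⌊l⌋₊, mainSum n ℓ l U k / (2 * Real.pi * Complex.I * k)‖ ≤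
      l * ((l * U) ^ (2 * n) * Y ^ 9 * ((2 * n + 22) / γ)) := by
    rw [← Finset.sum_sub_distrib]
    refine (norm_sum_le_of_le (n := fun _ => (l * U) ^ (2 * n) * Y ^ 9 * ((2 * n + 22) / γ)) _
      fun k hk => ?_).trans ?_
    · obtain ⟨hk1, hk2⟩ := Finset.mem_Icc.1 hk
      have hkl : (k : ℝ) ≤ l := (Nat.le_floor_iff hl).1 hk2
      have hg := hgap k hk1
      rw [abs_of_nonneg (by linarith)] at hg
      rw [← sub_div]
      exact (norm_div_two_pi_I_mul_le hk1 _).trans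
        (norm_sum_osc_sub_le hY (by exact_mod_cast hk1) hγ hγ1 (by linarith))
    · rw [Finset.sum_const, Nat.card_Icc, nsmul_eq_mul, Nat.add_sub_cancel]
      gcongr
      exact Nat.floor_le hl
  rw [h2] at h1
  refine (norm_sub_le_norm_sub_add_norm_sub _ _ _).trans ((add_le_add h1 h3).trans ?_)
  have e1 : U * (U * (2 * U ^ (2 * n) * (l + 1) / γ)) ≤
      (l + 1) ^ (2 * n + 1) * Y ^ (8 * n + 9) * (2 / γ) := by
    have : U * (U * (2 * U ^ (2 * n) * (l + 1) / γ)) = (l + 1) ^ 1 * Y ^ (8 * n + 8) * (2 / γ) := by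
      rw [hU]; ring
    rw [this]
    gcongr <;> linarith
  have e2 : l * ((l * U) ^ (2 * n) * Y ^ 9 * ((2 * n + 22) / γ)) ≤
      (l + 1) ^ (2 * n + 1) * Y ^ (8 * n + 9) * ((2 * n + 22) / γ) := by
    have : l * ((l * U) ^ (2 * n) * Y ^ 9 * ((2 * n + 22) / γ)) =
        l ^ (2 * n + 1) * Y ^ (8 * n + 9) * ((2 * n + 22) / γ) := by
      rw [hU]; ring
    rw [this]
    gcongr
    linarith
  calc _ ≤ _ := add_le_add e1 e2
    _ = _ := by ring

lemma norm_one_sub_mul_sum_le {a : ℕ → ℝ} (ha : Monotone a) (ha0 : 0 ≤ a 0) {z : ℂ} (hz : ‖z‖ = 1)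
    (N : ℕ) : ‖(1 - z) * ∑ m ∈ Icc 1 N, (a m : ℂ) * z ^ m‖ ≤ 2 * a N := by
  have key : ‖(1 - z) * ∑ m ∈ Icc 1 N, (a m : ℂ) * z ^ m + a N * z ^ (N + 1)‖ ≤ a N := by
    induction N with
    | zero => simp [hz, abs_of_nonneg ha0]
    | succ N ih =>
      rw [Finset.sum_Icc_succ_top (by omega)]
      have : (1 - z) * (∑ m ∈ Icc 1 N, (a m : ℂ) * z ^ m + a (N + 1) * z ^ (N + 1)) +
          a (N + 1) * z ^ (N + 1 + 1) = ((1 - z) * ∑ m ∈ Icc 1 N, (a m : ℂ) * z ^ m +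
          a N * z ^ (N + 1)) + ((a (N + 1) - a N : ℝ) : ℂ) * z ^ (N + 1) := by
        push_cast; ring
      rw [this]
      refine (norm_add_le _ _).trans ?_
      rw [norm_mul, norm_pow, hz, one_pow, mul_one, Complex.norm_real, Real.norm_eq_abs,
        abs_of_nonneg (sub_nonneg.2 (ha (Nat.le_succ N)))]
      linarith
  have h0 : 0 ≤ a N := ha0.trans (ha (Nat.zero_le N))
  have h1 : ‖(a N : ℂ) * z ^ (N + 1)‖ = a N := by
    rw [norm_mul, norm_pow, hz, one_pow, mul_one, Complex.norm_real, Real.norm_eq_abs,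
      abs_of_nonneg h0]
  calc _ = ‖((1 - z) * ∑ m ∈ Icc 1 N, (a m : ℂ) * z ^ m + a N * z ^ (N + 1)) -
        a N * z ^ (N + 1)‖ := by rw [add_sub_cancel_right]
    _ ≤ _ := (norm_sub_le _ _).trans (by rw [h1]; linarith)

lemma le_norm_one_sub_ee {d x : ℝ} (h : ∀ j : ℤ, d ≤ |x - j|) : d ≤ ‖1 - ee (-x)‖ := by
  set y := x - round x with hy
  have hy2 : |y| ≤ 1 / 2 := abs_sub_round x
  have h1 : ee (-x) = ee (-y) := by
    rw [hy, neg_sub, sub_eq_add_neg, ee_add, ee_intCast, one_mul]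
  have h2 : ‖1 - ee (-y)‖ = 2 * |Real.sin (Real.pi * y)| := by
    have : (1 : ℂ) - ee (-y) = ee (-y / 2) * (2 * Complex.I * (Real.sin (Real.pi * y) : ℂ)) := by
      have e1 : (1 : ℂ) = ee (-y / 2) * ee (y / 2) := by rw [← ee_add, neg_div, neg_add_cancel, ee_zero]
      have e2 : ee (-y) = ee (-y / 2) * ee (-y / 2) := by rw [← ee_add, add_halves]
      have e3 : ee (y / 2) - ee (-y / 2) = 2 * Complex.I * (Real.sin (Real.pi * y) : ℂ) := by
        rw [ee, ee, show 2 * Real.pi * (y / 2) = Real.pi * y by ring,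
          show 2 * Real.pi * (-y / 2) = -(Real.pi * y) by ring, Complex.ofReal_sin, Complex.sin]
        push_cast
        ring_nf
        rw [Complex.I_sq]
        ring_nf
      rw [← e3, mul_sub, ← e1, ← e2]
    rw [this, norm_mul, norm_ee, one_mul, norm_mul, norm_mul, Complex.norm_I, Complex.norm_real,
      Real.norm_eq_abs]
    simp
  rw [h1, h2]
  have h3 := Real.mul_abs_le_abs_sin (x := Real.pi * y) (by
    rw [abs_mul, abs_of_pos Real.pi_pos]; nlinarith [Real.pi_pos])
  rw [abs_mul, abs_of_pos Real.pi_pos, ← mul_assoc, div_mul_cancel₀ _ Real.pi_ne_zero] at h3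
  have := h (round x)
  rw [← hy] at this
  linarith [abs_nonneg y]

/-- The weights of the exponential sums produced by the stationary phase terms. -/
noncomputable def weight (n m : ℕ) : ℝ := (m : ℝ) ^ (2 * n + 1) * √m

lemma monotone_weight (n : ℕ) : Monotone (weight n) := fun a b h => by
  have : (a : ℝ) ≤ b := by exact_mod_cast h
  unfold weight
  gcongr

lemma weight_nonneg (n m : ℕ) : 0 ≤ weight n m := by unfold weight; positivity

lemma mainSum_eq (n ℓ : ℕ) {l U k : ℝ} (hU : 0 < U) (hk : 0 < k) (hkl : k ≤ l) :
    mainSum n ℓ l U k = ee (-(k * ℓ / 2)) * fresnelConst *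
      (((l ^ 2 / k ^ 2 - 1) ^ n * √(2 / k) : ℝ) : ℂ) *
      ∑ m ∈ Icc 1 (⌈k * U / l⌉₊ - 1), (weight n m : ℂ) * ee (-((l ^ 2 / k + k) / 2)) ^ m := by
  have hl : 0 < l := hk.trans_le hkl
  have hset : Icc 1 (⌈k * U / l⌉₊ - 1) = (Icc 1 ⌊U⌋₊).filter fun m : ℕ => l * m < k * U := by
    ext m
    have h1 : l * m < k * U ↔ m < ⌈k * U / l⌉₊ := by
      rw [Nat.lt_ceil, lt_div_iff₀ hl, mul_comm]
    have h2 : l * m < k * U → m ≤ ⌊U⌋₊ := fun h => Nat.le_floor (by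
      by_contra! hc
      nlinarith [mul_le_mul_of_nonneg_right hkl hU.le])
    simp only [Finset.mem_Icc, Finset.mem_filter]
    constructor
    · rintro ⟨h, h'⟩
      have : l * m < k * U := h1.2 (by omega)
      exact ⟨⟨h, h2 this⟩, this⟩
    · rintro ⟨⟨h, _⟩, h'⟩
      have := h1.1 h'
      exact ⟨h, by omega⟩
  rw [hset, Finset.sum_filter, Finset.mul_sum, mainSum]
  refine Finset.sum_congr rfl fun m _ => ?_
  rw [oscMain]
  split_ifs with h
  · have e1 : ee (-(m * ((l ^ 2 / k + k) / 2)) - k * ℓ / 2) =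
        ee (-((l ^ 2 / k + k) / 2)) ^ m * ee (-(k * ℓ / 2)) := by
      rw [sub_eq_add_neg, ee_add]
      congr 1
      rw [ee, ee, ← Complex.exp_nat_mul]
      congr 1
      push_cast
      ring
    have e2 : (l * m / k) ^ 2 - (m : ℝ) ^ 2 = (l ^ 2 / k ^ 2 - 1) * (m : ℝ) ^ 2 := by
      field_simp
    have e3 : √(2 * m / k) = √(2 / k) * √m := by
      rw [← Real.sqrt_mul (by positivity)]; congr 1; ring
    rw [e1, e2, e3, mul_pow, weight]
    push_cast
    ring
  · simp

lemma norm_mainSum_mul_le (n ℓ : ℕ) {l Y k d : ℝ} (hY : 1 ≤ Y) (hk : 1 ≤ k) (hkl : k ≤ l)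
    (hd : 0 < d) (h : ∀ j : ℤ, d ≤ |(l ^ 2 / k + k) / 2 - j|) :
    ‖mainSum n ℓ l (Y ^ 4) k‖ ≤ l ^ (2 * n) * Y ^ (8 * n + 6) * (16 / d) := by
  have hY0 : 0 < Y := by linarith
  have hl : 0 < l := by linarith
  have hU : 0 < Y ^ 4 := by positivity
  set z := ee (-((l ^ 2 / k + k) / 2)) with hz
  set N := ⌈k * Y ^ 4 / l⌉₊ - 1 with hN
  have hNU : (N : ℝ) ≤ Y ^ 4 := by
    have h1 : k * Y ^ 4 / l ≤ Y ^ 4 := by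
      rw [div_le_iff₀ hl, mul_comm]; gcongr
    have h2 := Nat.ceil_lt_add_one (show 0 ≤ k * Y ^ 4 / l by positivity)
    have h3 : 0 < ⌈k * Y ^ 4 / l⌉₊ := Nat.ceil_pos.2 (by positivity)
    rw [hN, Nat.cast_sub h3]
    push_cast
    linarith
  have hw : weight n N ≤ Y ^ (8 * n + 6) := by
    have : √(N : ℝ) ≤ Y ^ 2 := by
      rw [show Y ^ 2 = √(Y ^ 4) by
        rw [show Y ^ 4 = (Y ^ 2) ^ 2 by ring, Real.sqrt_sq (by positivity)]]
      exact Real.sqrt_le_sqrt hNU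
    calc weight n N ≤ (Y ^ 4) ^ (2 * n + 1) * Y ^ 2 := by unfold weight; gcongr
      _ = _ := by ring
  have h1 := norm_one_sub_mul_sum_le (monotone_weight n) (weight_nonneg n 0) (norm_ee _) N (z := z)
  have h2 : d ≤ ‖1 - z‖ := le_norm_one_sub_ee h
  rw [norm_mul] at h1
  have h3 : ‖∑ m ∈ Icc 1 N, (weight n m : ℂ) * z ^ m‖ ≤ 2 * Y ^ (8 * n + 6) / d := by
    rw [le_div_iff₀ hd]
    nlinarith [norm_nonneg (∑ m ∈ Icc 1 N, (weight n m : ℂ) * z ^ m)]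
  have hk0 : 0 < k := by linarith
  have hc : (1 : ℝ) ≤ l ^ 2 / k ^ 2 := by
    rw [one_le_div (by positivity)]; gcongr
  have h4 : |(l ^ 2 / k ^ 2 - 1) ^ n * √(2 / k)| ≤ l ^ (2 * n) * 2 := by
    rw [abs_of_nonneg (mul_nonneg (pow_nonneg (by linarith) n) (Real.sqrt_nonneg _)), pow_mul]
    have : l ^ 2 / k ^ 2 ≤ l ^ 2 := div_le_self (by positivity) (one_le_pow₀ hk)
    have : √(2 / k) ≤ 2 := by
      rw [Real.sqrt_le_left (by norm_num), div_le_iff₀ hk0]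
      linarith
    gcongr
    linarith
  rw [mainSum_eq n ℓ hU hk0 hkl, norm_mul, norm_mul, norm_mul, norm_ee, one_mul, Complex.norm_real,
    Real.norm_eq_abs]
  calc _ ≤ 4 * (l ^ (2 * n) * 2) * (2 * Y ^ (8 * n + 6) / d) := by
        gcongr
        exact norm_fresnelConst_le
    _ = _ := by ring

lemma div_le_abs_sub_natCast {l δ : ℝ} (hl : 0 ≤ l) (hδ1 : δ ≤ 1) {k : ℕ}
    (h : δ ≤ |l ^ 2 - (k ^ 2 : ℕ)|) : δ / (2 * l + 2) ≤ |l - k| := by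
  have h1 : |l ^ 2 - (k ^ 2 : ℕ)| = |l - k| * (l + k) := by
    rw [show l ^ 2 - (k ^ 2 : ℕ) = (l - k) * (l + k) by push_cast; ring, abs_mul,
      abs_of_nonneg (show 0 ≤ l + k by positivity)]
  rw [h1] at h
  rw [div_le_iff₀ (by positivity)]
  rcases le_total (k : ℝ) (l + 1) with hk | hk
  · exact h.trans (mul_le_mul_of_nonneg_left (by linarith) (abs_nonneg _))
  · have : 1 ≤ |l - k| := by rw [abs_sub_comm]; exact le_trans (by linarith) (le_abs_self _)
    nlinarith

lemma div_le_abs_phase_sub {l δ : ℝ} {k : ℕ} (hk : 1 ≤ k) (hkl : (k : ℝ) ≤ l)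
    {j : ℤ} (h : δ ≤ |l ^ 2 - ((2 * k * j - k ^ 2 : ℤ) : ℝ)|) :
    δ / (2 * l + 2) ≤ |(l ^ 2 / k + k) / 2 - j| := by
  have hk0 : (0 : ℝ) < k := by exact_mod_cast hk
  have h1 : (l ^ 2 / k + k) / 2 - j = (l ^ 2 - ((2 * k * j - k ^ 2 : ℤ) : ℝ)) / (2 * k) := by
    push_cast; field_simp; ring
  rw [h1, abs_div, abs_of_pos (show (0 : ℝ) < 2 * k by positivity)]
  gcongr
  linarith

lemma error_sum_le {n : ℕ} {l Y δ : ℝ} (hl : 0 ≤ l) (hY : 1 ≤ Y) (hδ : 0 < δ) :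
    (l + 1) ^ (2 * n + 1) * Y ^ (8 * n + 9) * ((2 * n + 24) / (δ / (2 * l + 2))) +
      l * (l ^ (2 * n) * Y ^ (8 * n + 6) * (16 / (δ / (2 * l + 2)))) ≤
    (l + 1) ^ (2 * n + 2) * Y ^ (8 * n + 9) * ((4 * n + 80) / δ) := by
  have h : l * (l ^ (2 * n) * Y ^ (8 * n + 6) * (16 / (δ / (2 * l + 2)))) ≤
      (l + 1) ^ (2 * n + 1) * Y ^ (8 * n + 9) * (16 / (δ / (2 * l + 2))) := by
    rw [← mul_assoc, ← mul_assoc, ← pow_succ']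
    gcongr
    · linarith
    · norm_num
  refine (add_le_add_right h _).trans (le_of_eq ?_)
  field_simp
  ring

lemma norm_integral_Estar_le_of_sep {ℓ : ℕ} {l Y δ : ℝ} (hY : 1 ≤ Y) (hl : 0 ≤ l) (hδ : 0 < δ)
    (hδ1 : δ ≤ 1) (hsep : ∀ D : ℤ, δ ≤ |l ^ 2 - D|) :
    ‖∫ u in (0 : ℝ)..Y ^ 4, (Estar ℓ u : ℂ) * ee (-(l * u))‖ ≤
      (l + 1) ^ (2 * (ℓ - 1) + 2) * Y ^ (8 * (ℓ - 1) + 9) * ((4 * (ℓ - 1 : ℕ) + 80) / δ) := by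
  have hγ : 0 < δ / (2 * l + 2) := by positivity
  have hA := norm_integral_Estar_sub_le (ℓ := ℓ) hY hl hγ
    ((div_le_one (by positivity)).2 (by linarith))
    fun k _ => div_le_abs_sub_natCast hl hδ1 (by
      have := hsep ((k ^ 2 : ℕ) : ℤ); rwa [Int.cast_natCast] at this)
  have hB : ‖∑ k ∈ Icc 1 ⌊l⌋₊, mainSum (ℓ - 1) ℓ l (Y ^ 4) k / (2 * Real.pi * Complex.I * k)‖ ≤
      l * (l ^ (2 * (ℓ - 1)) * Y ^ (8 * (ℓ - 1) + 6) * (16 / (δ / (2 * l + 2)))) := by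
    refine (norm_sum_le_of_le (n := fun _ => l ^ (2 * (ℓ - 1)) * Y ^ (8 * (ℓ - 1) + 6) *
      (16 / (δ / (2 * l + 2)))) _ fun k hk => ?_).trans ?_
    · obtain ⟨hk1, hk2⟩ := Finset.mem_Icc.1 hk
      have hkl : (k : ℝ) ≤ l := (Nat.le_floor_iff hl).1 hk2
      exact (norm_div_two_pi_I_mul_le hk1 _).trans (norm_mainSum_mul_le _ _ hY
        (by exact_mod_cast hk1) hkl hγ fun j => div_le_abs_phase_sub hk1 hkl (hsep _))
    · rw [Finset.sum_const, Nat.card_Icc, nsmul_eq_mul, Nat.add_sub_cancel]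
      gcongr
      exact Nat.floor_le hl
  exact (norm_le_norm_sub_add _ _).trans ((add_le_add hA hB).trans (error_sum_le hl hY hδ))

/-- The unit complex number that rotates the resonant main terms to the positive reals. -/
noncomputable def resonantPhase : ℂ := -Complex.I * ‖fresnelConst‖ / fresnelConst

lemma norm_resonantPhase : ‖resonantPhase‖ = 1 := by
  have := norm_ne_zero_iff.2 fresnelConst_ne_zero
  rw [resonantPhase, norm_div, norm_mul, norm_neg, Complex.norm_I, one_mul, Complex.norm_real,
    norm_norm, div_self this]

lemma mainSum_resonant {n ℓ k b : ℕ} (hk : 1 ≤ k) (hkodd : Odd (k * ℓ)) {l U : ℝ} (hU : 0 < U)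
    (hkl : k ≤ l) (hb : (l ^ 2 / k + k) / 2 = b) :
    resonantPhase * (mainSum n ℓ l U k / (2 * Real.pi * Complex.I * k)) =
      ((‖fresnelConst‖ / (2 * Real.pi * k) * ((l ^ 2 / (k : ℝ) ^ 2 - 1) ^ n * √(2 / k)) *
        ∑ m ∈ Icc 1 (⌈k * U / l⌉₊ - 1), weight n m : ℝ) : ℂ) := by
  have hk0 : (0 : ℝ) < k := by exact_mod_cast hk
  rw [mainSum_eq n ℓ hU hk0 hkl, hb]
  have h1 : ee (-(b : ℝ)) = 1 := by
    have := ee_intCast (-(b : ℤ))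
    push_cast at this
    exact this
  have h2 : ee (-(k * ℓ / 2 : ℝ)) = -1 := by
    obtain ⟨c, hc⟩ := hkodd
    have : -(k * ℓ / 2 : ℝ) = ((-(c : ℤ) : ℤ) : ℝ) + -(1 / 2) := by
      have : (k * ℓ : ℝ) = 2 * c + 1 := by exact_mod_cast hc
      rw [this]; push_cast; ring
    rw [this, ee_add, ee_intCast, one_mul, ee]
    rw [show (2 * Real.pi * -(1 / 2) : ℝ) = -Real.pi by ring]
    push_cast
    rw [neg_mul, Complex.exp_neg, Complex.exp_pi_mul_I]
    norm_num
  rw [h1, h2]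
  simp only [one_pow, mul_one]
  rw [resonantPhase]
  have hf := fresnelConst_ne_zero
  have hpi : (Real.pi : ℂ) ≠ 0 := by exact_mod_cast Real.pi_ne_zero
  have hk' : (k : ℂ) ≠ 0 := by exact_mod_cast hk0.ne'
  rw [← Complex.ofReal_sum]
  generalize (∑ m ∈ Icc 1 (⌈k * U / l⌉₊ - 1), weight n m) = S
  generalize ((l ^ 2 / (k : ℝ) ^ 2 - 1) ^ n * √(2 / k)) = T
  push_cast
  field_simp

lemma le_sum_weight (n : ℕ) {x : ℝ} (hx : 2 ≤ x) :
    (x / 4) ^ (2 * n + 2) * √(x / 4) ≤ ∑ m ∈ Icc 1 (⌈x⌉₊ - 1), weight n m := by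
  set N := ⌈x⌉₊ - 1 with hN
  have hxc := Nat.le_ceil x
  have hc : 2 ≤ ⌈x⌉₊ := by exact_mod_cast hx.trans hxc
  have hNx : x - 1 ≤ N := by
    rw [hN, Nat.cast_sub (by omega)]; push_cast; linarith
  set M := (N + 1) / 2 with hM
  have hsub : Icc M N ⊆ Icc 1 N := Finset.Icc_subset_Icc (by omega) le_rfl
  have hM4 : x / 4 ≤ M := by
    have : (N : ℝ) ≤ 2 * M := by exact_mod_cast (by omega : N ≤ 2 * M)
    linarith
  have hcard : x / 4 ≤ ((Icc M N).card : ℝ) := by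
    rw [Nat.card_Icc]
    have : (N : ℝ) ≤ 2 * (N + 1 - M : ℕ) := by exact_mod_cast (by omega : N ≤ 2 * (N + 1 - M))
    linarith
  calc (x / 4) ^ (2 * n + 2) * √(x / 4) = (x / 4) * ((x / 4) ^ (2 * n + 1) * √(x / 4)) := by ring
    _ ≤ (Icc M N).card * ((x / 4) ^ (2 * n + 1) * √(x / 4)) := by gcongr
    _ = ∑ m ∈ Icc M N, (x / 4) ^ (2 * n + 1) * √(x / 4) := by
        rw [Finset.sum_const, nsmul_eq_mul]
    _ ≤ ∑ m ∈ Icc M N, weight n m := by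
        refine Finset.sum_le_sum fun m hm => ?_
        have : x / 4 ≤ m := hM4.trans (by exact_mod_cast (Finset.mem_Icc.1 hm).1)
        unfold weight
        gcongr
    _ ≤ _ := Finset.sum_le_sum_of_subset_of_nonneg hsub fun m _ _ => weight_nonneg n m

lemma le_resonant_main {n p r : ℕ} (hp : 1 ≤ p) (hpr : 2 * p ≤ r) {X Y : ℝ} (hrX : r ≤ X)
    (hY : 2 * X ≤ Y ^ 4) :
    ‖fresnelConst‖ / (64 * Real.pi * 32 ^ n) * ((Y ^ 4) ^ (2 * n + 2) * √(Y ^ 4) / (X * √X)) ≤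
    ‖fresnelConst‖ / (2 * Real.pi * p) * ((√(p * r) ^ 2 / (p : ℝ) ^ 2 - 1) ^ n * √(2 / p)) *
        ∑ m ∈ Icc 1 (⌈p * Y ^ 4 / √(p * r)⌉₊ - 1), weight n m := by
  have hp0 : (0 : ℝ) < p := by exact_mod_cast hp
  have hpr' : 2 * (p : ℝ) ≤ r := by exact_mod_cast hpr
  have hr0 : (0 : ℝ) < r := by linarith
  have hX0 : 0 < X := by linarith
  set U := Y ^ 4 with hU
  have hU0 : 0 < U := by linarith
  set q : ℝ := √(p * r) with hq
  have hq0 : 0 < q := Real.sqrt_pos.2 (by positivity)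
  have hq2 : q ^ 2 = p * r := Real.sq_sqrt (by positivity)
  have hqX : q ≤ X := by
    rw [hq, Real.sqrt_le_left hX0.le]; nlinarith
  set x := p * U / q with hx
  have hx2 : 2 ≤ x := by
    rw [hx, le_div_iff₀ hq0]
    have : (1 : ℝ) ≤ p := by exact_mod_cast hp
    nlinarith
  have hxx : x ^ 2 = U ^ 2 * p / r := by
    rw [hx, div_pow, hq2]; field_simp
  have hS := le_sum_weight n hx2
  have hbase : r / (2 * p) ≤ q ^ 2 / (p : ℝ) ^ 2 - 1 := by
    rw [hq2, show (p * r : ℝ) / p ^ 2 = r / p by field_simp, div_le_iff₀ (by positivity), sub_mul]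
    rw [show (r : ℝ) / p * (2 * p) = 2 * r by field_simp]
    linarith
  have hbase0 : 0 ≤ q ^ 2 / (p : ℝ) ^ 2 - 1 := le_trans (by positivity) hbase
  have hxp : U / X ≤ x / p := by
    rw [hx, show p * U / q / p = U / q by field_simp]
    gcongr
  have hsqrt : √U / √X ≤ √x * √(1 / p) := by
    rw [← Real.sqrt_div hU0.le, ← Real.sqrt_mul (by positivity), mul_one_div]
    exact Real.sqrt_le_sqrt hxp
  have hs4 : √(x / 4) = √x / 2 := by
    rw [Real.sqrt_div (by positivity), show (4 : ℝ) = 2 ^ 2 by norm_num, Real.sqrt_sq (by norm_num)]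
  have h2p : √(1 / p) ≤ √(2 / p) := Real.sqrt_le_sqrt (by gcongr; norm_num)
  have hpi := Real.pi_pos
  calc _ = ‖fresnelConst‖ / (64 * Real.pi * 32 ^ n) * (U ^ (2 * n + 2) / X * (√U / √X)) := by
        congr 1; field_simp
    _ ≤ ‖fresnelConst‖ / (64 * Real.pi * 32 ^ n) * (U ^ (2 * n + 2) / r * (√x * √(1 / p))) := by
        gcongr
    _ = ‖fresnelConst‖ / (2 * Real.pi * p) * ((r / (2 * p)) ^ n * √(1 / p)) *
        ((x / 4) ^ (2 * n + 2) * √(x / 4)) := by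
        rw [hs4, show (x / 4) ^ (2 * n + 2) = ((U ^ 2 * p / r) / 16) ^ (n + 1) by
          rw [← hxx, show x ^ 2 / 16 = (x / 4) ^ 2 by ring, ← pow_mul]; ring_nf]
        rw [show 2 * n + 2 = 2 * (n + 1) by ring, pow_mul, div_pow, div_pow, div_pow, mul_pow,
          mul_pow, pow_succ (16 : ℝ), pow_succ (r : ℝ), pow_succ (p : ℝ),
          show (32 : ℝ) = 2 * 16 by norm_num, mul_pow]
        field_simp
        ring
    _ ≤ _ := by
        have := pow_nonneg hbase0 n
        gcongr

lemma le_re_resonantPhase_mul_integral {ℓ p r : ℕ} (hp : p.Prime) (hr : r.Prime) (hpo : Odd p)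
    (hro : Odd r) (hpr : 2 * p ≤ r) (hℓ : Odd ℓ) {X Y : ℝ} (hY : 1 ≤ Y) (hrX : r ≤ X)
    (hYX : 2 * X ≤ Y ^ 4) :
    ‖fresnelConst‖ / (64 * Real.pi * 32 ^ (ℓ - 1)) *
        ((Y ^ 4) ^ (2 * (ℓ - 1) + 2) * √(Y ^ 4) / (X * √X)) -
      (√(p * r) + 1) ^ (2 * (ℓ - 1) + 2) * Y ^ (8 * (ℓ - 1) + 9) * (4 * (ℓ - 1 : ℕ) + 80) ≤
    (resonantPhase * ∫ u in (0 : ℝ)..Y ^ 4, (Estar ℓ u : ℂ) * ee (-(√(p * r) * u))).re := by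
  have hp1 : 1 ≤ p := hp.one_lt.le
  have hU : 0 < Y ^ 4 := by positivity
  refine le_trans (sub_le_sub_right (le_resonant_main (n := ℓ - 1) hp1 hpr hrX hYX) _) ?_
  set n := ℓ - 1 with hn
  set l : ℝ := √(p * r) with hl
  have hl0 : 0 ≤ l := Real.sqrt_nonneg _
  have hl2 : l ^ 2 = p * r := Real.sq_sqrt (by positivity)
  have hlt : p < r := by omega
  have hpl : (p : ℝ) ≤ l := by
    have : (p : ℝ) ≤ r := by exact_mod_cast hlt.le
    exact Real.le_sqrt_of_sq_le (by rw [sq]; gcongr)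
  have hlr : l < r := by
    have : (p : ℝ) < r := by exact_mod_cast hlt
    have hr0 : (0 : ℝ) < r := by exact_mod_cast hr.pos
    rw [hl, Real.sqrt_lt' hr0, sq]
    exact mul_lt_mul_of_pos_right this hr0
  have hintegral : ∀ D : ℤ, (p * r : ℤ) ≠ D → 1 ≤ |l ^ 2 - (D : ℝ)| := fun D hD => by
    rw [hl2]
    have : 1 ≤ |(p * r : ℤ) - D| := Int.one_le_abs (sub_ne_zero.2 hD)
    exact_mod_cast this
  have hsq : ∀ k : ℕ, (p * r : ℤ) ≠ ((k ^ 2 : ℕ) : ℤ) := fun k hk => by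
    have hk' : p * r = k ^ 2 := by exact_mod_cast hk
    have h1 : p ∣ k := hp.dvd_of_dvd_pow (hk' ▸ Dvd.intro _ rfl)
    have h2 : p * p ∣ p * r := by rw [hk', sq]; exact mul_dvd_mul h1 h1
    exact hlt.ne ((Nat.prime_dvd_prime_iff_eq hp hr).1 (Nat.dvd_of_mul_dvd_mul_left hp.pos h2))
  set γ : ℝ := 1 / (2 * l + 2) with hγ
  have hγ0 : 0 < γ := by positivity
  set F := ∫ u in (0 : ℝ)..Y ^ 4, (Estar ℓ u : ℂ) * ee (-(l * u)) with hF
  have hA := norm_integral_Estar_sub_le (ℓ := ℓ) hY hl0 hγ0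
    ((div_le_one (by positivity)).2 (by linarith))
    fun k _ => div_le_abs_sub_natCast hl0 le_rfl (by simpa using hintegral _ (hsq k))
  rw [← hn, ← hF] at hA
  set S := ∑ k ∈ Icc 1 ⌊l⌋₊, mainSum n ℓ l (Y ^ 4) k / (2 * Real.pi * Complex.I * k) with hS
  set B := l ^ (2 * n) * Y ^ (8 * n + 6) * (16 / γ) with hB
  have hB0 : 0 ≤ B := by positivity
  set Q : ℕ → ℝ := fun k => ‖fresnelConst‖ / (2 * Real.pi * k) *
    ((l ^ 2 / (k : ℝ) ^ 2 - 1) ^ n * √(2 / k)) *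
      ∑ m ∈ Icc 1 (⌈k * Y ^ 4 / l⌉₊ - 1), weight n m with hQ
  have hQ0 : ∀ k : ℕ, 1 ≤ k → (k : ℝ) ≤ l → 0 ≤ Q k := fun k hk hkl => by
    have hk0 : (0 : ℝ) < k := by exact_mod_cast hk
    have h1 : 0 ≤ l ^ 2 / (k : ℝ) ^ 2 - 1 := by
      rw [sub_nonneg, one_le_div (by positivity)]; gcongr
    have h2 := pow_nonneg h1 n
    have h3 := Finset.sum_nonneg fun m (_ : m ∈ Icc 1 (⌈k * Y ^ 4 / l⌉₊ - 1)) => weight_nonneg n m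
    have := Real.pi_pos
    simp only [hQ]
    positivity
  have hterm : ∀ k ∈ Icc 1 ⌊l⌋₊, (if k = p then Q p else 0) - B ≤
      (resonantPhase * (mainSum n ℓ l (Y ^ 4) k / (2 * Real.pi * Complex.I * k))).re := by
    intro k hk
    obtain ⟨hk1, hk2⟩ := Finset.mem_Icc.1 hk
    have hk0 : (0 : ℝ) < k := by exact_mod_cast hk1
    have hkl : (k : ℝ) ≤ l := (Nat.le_floor_iff hl0).1 hk2
    by_cases hkp : k = p
    · subst hkp
      rw [if_pos rfl]
      obtain ⟨b, hb⟩ := (hpo.add_odd hro)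
      rw [mainSum_resonant hk1 (hpo.mul hℓ) hU hkl (b := b) (by
        have : (k + r : ℝ) = b + b := by exact_mod_cast hb
        rw [hl2]; field_simp; linarith), Complex.ofReal_re]
      exact sub_le_self _ hB0
    rw [if_neg hkp, zero_sub]
    by_cases hk1' : k = 1
    · subst hk1'
      obtain ⟨b, hb⟩ := ((hpo.mul hro).add_odd odd_one)
      rw [mainSum_resonant le_rfl (by simpa using hℓ) hU hkl (b := b) (by
        have : (p * r + 1 : ℝ) = b + b := by exact_mod_cast hb
        rw [hl2]; push_cast; linarith), Complex.ofReal_re]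
      exact (neg_nonpos.2 hB0).trans (hQ0 1 le_rfl hkl)
    have hndvd : ¬ k ∣ p * r := fun hdvd => by
      rcases (Nat.dvd_mul.1 hdvd) with ⟨a, b, ha, hb, hab⟩
      rcases (Nat.dvd_prime hr).1 hb with rfl | rfl
      · rcases (Nat.dvd_prime hp).1 ha with rfl | rfl
        · exact hk1' (by simpa using hab.symm)
        · exact hkp (by simpa using hab.symm)
      · have : (b : ℝ) ≤ k := by
          exact_mod_cast Nat.le_of_dvd hk1 (hab ▸ Dvd.intro_left _ rfl)
        linarith
    have hle : ‖resonantPhase * (mainSum n ℓ l (Y ^ 4) k / (2 * Real.pi * Complex.I * k))‖ ≤ B := by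
      rw [norm_mul, norm_resonantPhase, one_mul]
      refine (norm_div_two_pi_I_mul_le hk1 _).trans (norm_mainSum_mul_le _ _ hY
        (by exact_mod_cast hk1) hkl hγ0 fun j => div_le_abs_phase_sub hk1 hkl (hintegral _ fun h => hndvd ?_))
      have : (k : ℤ) ∣ (p * r : ℤ) := by
        rw [h]
        exact ⟨2 * j - k, by ring⟩
      exact_mod_cast this
    linarith [neg_abs_le (resonantPhase * (mainSum n ℓ l (Y ^ 4) k /
      (2 * Real.pi * Complex.I * k))).re, Complex.abs_re_le_norm (resonantPhase *
      (mainSum n ℓ l (Y ^ 4) k / (2 * Real.pi * Complex.I * k)))]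
  have hSre : Q p - l * B ≤ (resonantPhase * S).re := by
    rw [hS, Finset.mul_sum, Complex.re_sum]
    refine le_trans ?_ (Finset.sum_le_sum hterm)
    rw [Finset.sum_sub_distrib, Finset.sum_ite_eq' , if_pos (Finset.mem_Icc.2
      ⟨hp1, Nat.le_floor hpl⟩), Finset.sum_const, Nat.card_Icc, nsmul_eq_mul, Nat.add_sub_cancel]
    have := Nat.floor_le hl0
    gcongr
  have hdiff : -‖F - S‖ ≤ (resonantPhase * (F - S)).re := by
    have h1 := Complex.abs_re_le_norm (resonantPhase * (F - S))
    rw [norm_mul, norm_resonantPhase, one_mul] at h1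
    linarith [neg_abs_le (resonantPhase * (F - S)).re]
  have hsplit : (resonantPhase * F).re = (resonantPhase * S).re + (resonantPhase * (F - S)).re := by
    rw [← Complex.add_re]; ring_nf
  have herr := error_sum_le (n := n) hl0 hY one_pos
  rw [div_one, ← hγ, ← hB] at herr
  rw [hsplit]
  change Q p - _ ≤ _
  linarith

lemma norm_integral_ofReal_mul_ee_abs (F : ℝ → ℝ) (l U : ℝ) :
    ‖∫ u in (0 : ℝ)..U, (F u : ℂ) * ee (-(l * u))‖ =
      ‖∫ u in (0 : ℝ)..U, (F u : ℂ) * ee (-(|l| * u))‖ := by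
  rcases abs_choice l with h | h
  · rw [h]
  · rw [h, ← RCLike.norm_conj (∫ u in (0 : ℝ)..U, (F u : ℂ) * ee (-(l * u))),
      ← intervalIntegral.intervalIntegral_conj]
    congr 2
    funext u
    rw [map_mul, Complex.conj_ofReal, conj_ee]
    congr 2
    ring

lemma norm_integral_Estar_le {ℓ : ℕ} {Y : ℝ} (hY : 1 ≤ Y) :
    ‖∫ u in (0 : ℝ)..Y ^ 4, (Estar ℓ u : ℂ) * ee (-(0 * u))‖ ≤
      Y ^ (8 * (ℓ - 1) + 9) * (2 * (ℓ - 1 : ℕ) + 24) := by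
  have h := norm_integral_Estar_sub_le (ℓ := ℓ) hY le_rfl one_pos le_rfl fun k hk => by
    rw [zero_sub, abs_neg, Nat.abs_cast]; exact_mod_cast hk
  simpa using h

lemma exists_ne_zero_of_ne_single {ι : Type*} [DecidableEq ι] {ε : ι → ℤ}
    (hε : ∀ i, ε i = -1 ∨ ε i = 0 ∨ ε i = 1) (h1 : ∀ i, ε ≠ Pi.single i 1)
    (h2 : ∀ i, ε ≠ Pi.single i (-1)) (h0 : ε ≠ 0) : ∃ i j, i ≠ j ∧ ε i ≠ 0 ∧ ε j ≠ 0 := by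
  obtain ⟨i, hi⟩ := Function.ne_iff.1 h0
  by_contra! hc
  have hsing : ε = Pi.single i (ε i) := by
    funext j
    by_cases hj : j = i
    · subst hj; simp
    · rw [Pi.single_eq_of_ne hj]; exact hc i j (Ne.symm hj) hi
  rcases hε i with h | h | h
  · exact h2 i (h ▸ hsing)
  · exact hi h
  · exact h1 i (h ▸ hsing)

lemma sum_signVector_eq {A B : Finset ℕ} (ε : (A ×ˢ B : Finset (ℕ × ℕ)) → ℤ) :
    ∑ i, (ε i : ℝ) * √((i.1.1 : ℝ) * i.1.2) = ∑ a ∈ A, ∑ b ∈ B,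
      ((if h : (a, b) ∈ A ×ˢ B then ε ⟨(a, b), h⟩ else 0 : ℤ) : ℝ) * (√a * √b) := by
  rw [← Finset.sum_product' A B fun a b =>
    ((if h : (a, b) ∈ A ×ˢ B then ε ⟨(a, b), h⟩ else 0 : ℤ) : ℝ) * (√a * √b),
    ← Finset.sum_coe_sort (A ×ˢ B)]
  refine Finset.sum_congr rfl fun i _ => ?_
  rw [dif_pos i.2, Real.sqrt_mul (Nat.cast_nonneg _)]

lemma inv_le_abs_sum_sq_sub {A B : Finset ℕ} (hA : ∀ p ∈ A, p.Prime) (hB : ∀ p ∈ B, p.Prime)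
    (hAB : Disjoint A B) {ε : (A ×ˢ B : Finset (ℕ × ℕ)) → ℤ}
    (hε : ∀ i, ε i = -1 ∨ ε i = 0 ∨ ε i = 1) {i j : (A ×ˢ B : Finset (ℕ × ℕ))} (hij : i ≠ j)
    (hi : ε i ≠ 0) (hj : ε j ≠ 0) {L : ℝ} (hL : ∑ a ∈ A, ∑ b ∈ B, √a * √b ≤ L) (D : ℤ) :
    ((2 * L ^ 2 + 1) ^ (2 ^ (#A + #B)))⁻¹ ≤
      |(∑ i, (ε i : ℝ) * √((i.1.1 : ℝ) * i.1.2)) ^ 2 - D| := by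
  obtain ⟨⟨p, r⟩, hi'⟩ := i
  obtain ⟨⟨p', r'⟩, hj'⟩ := j
  have hpr := Finset.mem_product.1 hi'
  have hpr' := Finset.mem_product.1 hj'
  have h := one_le_abs_bilinear_sq_sub hA hB hAB
    (ε := fun a b => if h : (a, b) ∈ A ×ˢ B then ε ⟨(a, b), h⟩ else 0) (fun a b => by
      split_ifs with hab
      · rcases hε ⟨(a, b), hab⟩ with h | h | h <;> rw [h] <;> norm_num
      · norm_num) hpr.1 hpr'.1 hpr.2 hpr'.2 (by rw [dif_pos hi']; exact hi)
    (by rw [dif_pos hj']; exact hj) (fun h => hij (Subtype.ext h)) hL D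
  rw [← sum_signVector_eq] at h
  rw [inv_eq_one_div, div_le_iff₀ (by positivity)]
  exact h

/-- A nonnegative test function that detects the resonances of `E*` at all the frequencies
`√(p r)` simultaneously. -/
lemma exists_test_function {A B : Finset ℕ} (hA : ∀ p ∈ A, p.Prime ∧ Odd p)
    (hB : ∀ r ∈ B, r.Prime ∧ Odd r) (hAB : ∀ p ∈ A, ∀ r ∈ B, 2 * p ≤ r) {X Y : ℝ}
    (hX : ∀ r ∈ B, (r : ℝ) ≤ X) (hY : 1 ≤ Y) (hX1 : 1 ≤ X) (hYX : 2 * X ≤ Y ^ 4) {ℓ : ℕ} (hℓ : Odd ℓ) {N : ℕ}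
    (hN : N = #A * #B) {L δ E : ℝ} (hL : L = N * X)
    (hδ : δ = ((2 * L ^ 2 + 1) ^ (2 ^ (#A + #B)))⁻¹)
    (hE : E = (L + 1) ^ (2 * (ℓ - 1) + 2) * Y ^ (8 * (ℓ - 1) + 9) *
      ((4 * (ℓ - 1 : ℕ) + 80) / δ)) :
    ∃ R : ℝ → ℝ, Continuous R ∧ (∀ u, 0 ≤ R u) ∧
      ∫ u in (0 : ℝ)..Y ^ 4, R u ≤ Y ^ 4 + 3 ^ N / δ ∧
      N * (‖fresnelConst‖ / (64 * Real.pi * 32 ^ (ℓ - 1)) *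
        ((Y ^ 4) ^ (2 * (ℓ - 1) + 2) * √(Y ^ 4) / (X * √X))) - (N + 3 ^ N) * E ≤
      ∫ u in (0 : ℝ)..Y ^ 4, Estar ℓ u * R u := by
  have hAp := fun p hp => (hA p hp).1
  have hBp := fun r hr => (hB r hr).1
  have hdisj : Disjoint A B := Finset.disjoint_left.2 fun p hp hp' => by
    have := hAB p hp p hp'
    have := (hAp p hp).pos
    omega
  have hcard : Fintype.card (A ×ˢ B : Finset (ℕ × ℕ)) = N := by
    rw [Fintype.card_coe, Finset.card_product, hN]
  set μ : (A ×ˢ B : Finset (ℕ × ℕ)) → ℝ := fun i => √((i.1.1 : ℝ) * i.1.2) with hμ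
  have hX0 : 0 ≤ X := by linarith
  have hL0 : 0 ≤ L := by rw [hL]; positivity
  have hμX : ∀ i, μ i ≤ X := fun i => by
    have hi := Finset.mem_product.1 i.2
    have h1 : (i.1.1 : ℝ) ≤ i.1.2 := by
      exact_mod_cast (show i.1.1 ≤ i.1.2 by have := hAB _ hi.1 _ hi.2; omega)
    have h2 := hX _ hi.2
    simp only [hμ]
    rw [Real.sqrt_le_left hX0, sq]
    exact mul_le_mul (h1.trans h2) h2 (by positivity) hX0
  have hμ1 : ∀ i, 1 ≤ μ i := fun i => by
    have hi := Finset.mem_product.1 i.2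
    have h1 : (1 : ℝ) ≤ i.1.1 := by exact_mod_cast (hAp _ hi.1).one_lt.le
    have h2 : (1 : ℝ) ≤ i.1.2 := by exact_mod_cast (hBp _ hi.2).one_lt.le
    simp only [hμ]
    rw [Real.one_le_sqrt]
    nlinarith
  have hμsum : ∑ i, μ i ≤ L := by
    refine (Finset.sum_le_card_nsmul _ _ X fun i _ => hμX i).trans (le_of_eq ?_)
    rw [Finset.card_univ, hcard, nsmul_eq_mul, hL]
  have hLbil : ∑ a ∈ A, ∑ b ∈ B, √(a : ℝ) * √(b : ℝ) ≤ L := by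
    rw [← Finset.sum_product' A B fun a b => √(a : ℝ) * √(b : ℝ), ← Finset.sum_coe_sort (A ×ˢ B)]
    refine le_trans (le_of_eq (Finset.sum_congr rfl fun i _ => ?_)) hμsum
    simp only [hμ]
    rw [Real.sqrt_mul (Nat.cast_nonneg _)]
  have hδ0 : 0 < δ := by rw [hδ]; positivity
  have hδ1 : δ ≤ 1 := by
    rw [hδ]
    exact inv_le_one_of_one_le₀ (one_le_pow₀ (by nlinarith))
  have hE0 : 0 ≤ E := by rw [hE]; positivity
  have hlam : ∀ ε ∈ signVectors (A ×ˢ B : Finset (ℕ × ℕ)), |∑ i, (ε i : ℝ) * μ i| ≤ L := by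
    intro ε hε
    rw [mem_signVectors] at hε
    refine (Finset.abs_sum_le_sum_abs _ _).trans (le_trans (Finset.sum_le_sum fun i _ => ?_) hμsum)
    rw [abs_mul, abs_of_nonneg (show 0 ≤ μ i by linarith [hμ1 i])]
    refine mul_le_of_le_one_left (by linarith [hμ1 i]) ?_
    rcases hε i with h | h | h <;> rw [h] <;> norm_num
  have hsep : ∀ ε ∈ signVectors (A ×ˢ B : Finset (ℕ × ℕ)), (∀ i, ε ≠ Pi.single i 1) →
      (∀ i, ε ≠ Pi.single i (-1)) → ε ≠ 0 → ∀ D : ℤ, δ ≤ |(∑ i, (ε i : ℝ) * μ i) ^ 2 - D| := by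
    intro ε hε h1 h2 h0 D
    rw [mem_signVectors] at hε
    obtain ⟨i, j, hij, hi, hj⟩ := exists_ne_zero_of_ne_single hε h1 h2 h0
    rw [hδ]
    exact inv_le_abs_sum_sq_sub hAp hBp hdisj hε hij hi hj hLbil D
  have hω : ∀ _ : (A ×ˢ B : Finset (ℕ × ℕ)), ‖resonantPhase‖ = 1 := fun _ => norm_resonantPhase
  have hYE : ∀ l : ℝ, 0 ≤ l → l ≤ L →
      (l + 1) ^ (2 * (ℓ - 1) + 2) * Y ^ (8 * (ℓ - 1) + 9) * ((4 * (ℓ - 1 : ℕ) + 80) / δ) ≤ E := by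
    intro l hl hlL
    rw [hE]
    gcongr
  have hnon : ∀ ε ∈ signVectors (A ×ˢ B : Finset (ℕ × ℕ)), (∀ i, ε ≠ Pi.single i 1) →
      (∀ i, ε ≠ Pi.single i (-1)) →
      ‖∫ u in (0 : ℝ)..Y ^ 4, (Estar ℓ u : ℂ) * ee (-((∑ i, (ε i : ℝ) * μ i) * u))‖ ≤ E := by
    intro ε hε h1 h2
    by_cases h0 : ε = 0
    · subst h0
      simp only [Pi.zero_apply, Int.cast_zero, zero_mul, Finset.sum_const_zero]
      refine le_trans ?_ (hYE 0 le_rfl hL0)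
      have := norm_integral_Estar_le (ℓ := ℓ) hY
      simp only [zero_mul] at this
      refine this.trans ?_
      rw [zero_add, one_pow, one_mul]
      have : (2 * (ℓ - 1 : ℕ) + 24 : ℝ) ≤ (4 * (ℓ - 1 : ℕ) + 80) / δ := by
        rw [le_div_iff₀ hδ0]
        have : (0 : ℝ) ≤ (ℓ - 1 : ℕ) := Nat.cast_nonneg _
        nlinarith
      gcongr
    · rw [norm_integral_ofReal_mul_ee_abs]
      refine (norm_integral_Estar_le_of_sep hY (abs_nonneg _) hδ0 hδ1 fun D => ?_).trans
        (hYE _ (abs_nonneg _) (hlam ε hε))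
      rw [sq_abs]
      exact hsep ε hε h1 h2 h0 D
  have hgap : ∀ ε ∈ signVectors (A ×ˢ B : Finset (ℕ × ℕ)), ε ≠ 0 →
      δ ≤ |∑ i, (ε i : ℝ) * μ i| := by
    intro ε hε h0
    by_cases h1 : ∀ i, ε ≠ Pi.single i 1
    · by_cases h2 : ∀ i, ε ≠ Pi.single i (-1)
      · have h := hsep ε hε h1 h2 h0 0
        rw [Int.cast_zero, sub_zero, abs_pow, sq] at h
        rcases le_total 1 |∑ i, (ε i : ℝ) * μ i| with h3 | h3
        · exact hδ1.trans h3
        · exact h.trans (mul_le_of_le_one_left (abs_nonneg _) h3)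
      · push Not at h2
        obtain ⟨i, rfl⟩ := h2
        refine hδ1.trans ((hμ1 i).trans ?_)
        simp [Pi.single_apply, le_abs_self]
    · push Not at h1
      obtain ⟨i, rfl⟩ := h1
      refine hδ1.trans ((hμ1 i).trans ?_)
      simp [Pi.single_apply, le_abs_self]
  refine ⟨riesz μ fun _ => resonantPhase, continuous_riesz _ _, riesz_nonneg μ hω, ?_, ?_⟩
  · have := integral_riesz_le μ hω (U := Y ^ 4) hδ0 hgap
    rwa [hcard] at this
  · have h := sum_re_le_integral_mul_riesz μ hω
      (intervalIntegrable_Estar ℓ (show 0 ≤ Y ^ 4 by positivity)) hE0 hnon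
    rw [hcard] at h
    refine le_trans ?_ h
    have hterm : ∀ i, ‖fresnelConst‖ / (64 * Real.pi * 32 ^ (ℓ - 1)) *
        ((Y ^ 4) ^ (2 * (ℓ - 1) + 2) * √(Y ^ 4) / (X * √X)) - E ≤
        (resonantPhase * ∫ u in (0 : ℝ)..Y ^ 4, (Estar ℓ u : ℂ) * ee (-(μ i * u))).re := by
      intro i
      have hi := Finset.mem_product.1 i.2
      refine le_trans (sub_le_sub_left ?_ _) (le_re_resonantPhase_mul_integral (hAp _ hi.1)
        (hBp _ hi.2) (hA _ hi.1).2 (hB _ hi.2).2 (hAB _ hi.1 _ hi.2) hℓ hY (hX _ hi.2) hYX)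
      have hN1 : μ i ≤ L := le_trans (Finset.single_le_sum (f := μ)
        (fun j _ => by linarith [hμ1 j]) (Finset.mem_univ i)) hμsum
      refine le_trans ?_ (hYE (μ i) (by linarith [hμ1 i]) hN1)
      have : (4 * (ℓ - 1 : ℕ) + 80 : ℝ) ≤ (4 * (ℓ - 1 : ℕ) + 80) / δ :=
        le_div_self (by positivity) hδ0 hδ1
      have := hμ1 i
      gcongr
    have hsum := Finset.sum_le_sum fun i (_ : i ∈ Finset.univ) => hterm i
    rw [Finset.sum_const, Finset.card_univ, hcard, nsmul_eq_mul] at hsum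
    linarith

lemma eventually_le_primeCounting {k : ℕ} (hk : 1 ≤ k) :
    ∀ᶠ W : ℕ in Filter.atTop, 3 * W ^ (k - 1) ≤ Nat.primeCounting (W ^ k) := by
  have hlog2 : 0 < Real.log 2 := Real.log_pos one_lt_two
  have hk0 : (0 : ℝ) < k := by exact_mod_cast hk
  have h1 : ∀ᶠ x : ℝ in Filter.atTop, Real.log x ≤ Real.log 2 / (8 * k) * x := by
    have := Real.isLittleO_log_id_atTop.bound (show 0 < Real.log 2 / (8 * k) by positivity)
    filter_upwards [this, Filter.eventually_ge_atTop 1] with x hx hx1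
    rw [Real.norm_eq_abs, Real.norm_eq_abs, id, abs_of_nonneg (by linarith : 0 ≤ x)] at hx
    exact (le_abs_self _).trans hx
  filter_upwards [tendsto_natCast_atTop_atTop.eventually h1, Filter.eventually_ge_atTop 2]
    with W hW hW2
  have hW2' : (2 : ℝ) ≤ W := by exact_mod_cast hW2
  have hlogW : 0 < Real.log W := Real.log_pos (by linarith)
  have hP : (1 : ℝ) ≤ (W : ℝ) ^ (k - 1) := one_le_pow₀ (by linarith)
  have hWk : (W : ℝ) ^ k = (W : ℝ) ^ (k - 1) * W := by
    rw [← pow_succ, Nat.sub_add_cancel hk]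
  have hWk1 : (1 : ℝ) ≤ (W : ℝ) ^ k := one_le_pow₀ (by linarith)
  have hlog1 : Real.log ((W : ℝ) ^ k + 1) ≤ Real.log 2 + k * Real.log W := by
    rw [← Real.log_pow, ← Real.log_mul (by norm_num) (by positivity)]
    exact Real.log_le_log (by positivity) (by linarith)
  have hkey : 8 * k * Real.log W ≤ Real.log 2 * W := by
    calc 8 * k * Real.log W ≤ 8 * k * (Real.log 2 / (8 * k) * W) := by gcongr
      _ = _ := by field_simp
  have h := Chebyshev.pi_ge (W ^ k)
  push_cast at h
  rw [Real.log_pow] at h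
  have h3 : (3 * W ^ (k - 1) : ℝ) ≤ Nat.primeCounting (W ^ k) := by
    refine le_trans ?_ h
    rw [le_div_iff₀ (by positivity), hWk]
    rw [hWk] at hlog1
    set P := (W : ℝ) ^ (k - 1)
    have hkl : 0 < k * Real.log W := by positivity
    have e1 : P * (4 * (k * Real.log W) + Real.log 2) ≤ P * (Real.log 2 * W) := by
      gcongr
      nlinarith
    have e2 : Real.log 2 + k * Real.log W ≤ P * (Real.log 2 + k * Real.log W) :=
      le_mul_of_one_le_left (by positivity) hP
    nlinarith
  exact_mod_cast h3

lemma card_filter_prime_range (n : ℕ) : #{p ∈ range (n + 1) | p.Prime} = Nat.primeCounting n := by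
  rw [Nat.primeCounting, Nat.primeCounting', Nat.count_eq_card_filter_range]

/-- The odd primes in `[a, b]`. -/
def oddPrimes (a b : ℕ) : Finset ℕ := {p ∈ Icc a b | p.Prime ∧ Odd p}

lemma mem_oddPrimes {a b p : ℕ} : p ∈ oddPrimes a b ↔ (a ≤ p ∧ p ≤ b) ∧ p.Prime ∧ Odd p := by
  rw [oddPrimes, Finset.mem_filter, Finset.mem_Icc]

lemma primeCounting_le_card_oddPrimes (a b : ℕ) :
    Nat.primeCounting b ≤ #(oddPrimes a b) + a + 1 := by
  have hsub : {p ∈ range (b + 1) | p.Prime} ⊆ insert 2 (oddPrimes a b ∪ range a) := by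
    intro p hp
    rw [Finset.mem_filter, Finset.mem_range] at hp
    rw [Finset.mem_insert, Finset.mem_union, mem_oddPrimes, Finset.mem_range]
    rcases hp.2.eq_two_or_odd' with h | h
    · exact Or.inl h
    · rcases lt_or_ge p a with h' | h'
      · exact Or.inr (Or.inr h')
      · exact Or.inr (Or.inl ⟨⟨h', by omega⟩, hp.2, h⟩)
  rw [← card_filter_prime_range]
  refine (Finset.card_le_card hsub).trans ((Finset.card_insert_le _ _).trans ?_)
  have := Finset.card_union_le (oddPrimes a b) (range a)
  rw [Finset.card_range] at this
  omega

lemma eventually_pow_mul_lt_exp (n : ℕ) :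
    ∀ᶠ X : ℕ in Filter.atTop, 4 * ((6 * n + 92) * (X : ℝ) ^ 6 * 4 ^ X) < Real.exp (2 * X) := by
  have hc : (0 : ℝ) < 1 / (2 * (4 * (6 * n + 92))) := by positivity
  have h := (isLittleO_pow_exp_pos_mul_atTop 6 (show (0 : ℝ) < 1 / 2 by norm_num)).bound hc
  filter_upwards [tendsto_natCast_atTop_atTop.eventually h] with X hX
  rw [Real.norm_eq_abs, Real.norm_eq_abs, abs_of_nonneg (by positivity), Real.abs_exp] at hX
  have h4 : (4 : ℝ) ^ X ≤ Real.exp (3 / 2 * X) := by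
    rw [mul_comm, Real.exp_nat_mul]
    gcongr
    rw [← Real.log_le_iff_le_exp (by norm_num), show (4 : ℝ) = 2 ^ 2 by norm_num, Real.log_pow]
    have := Real.log_two_lt_d9
    push_cast
    linarith
  calc 4 * ((6 * n + 92) * (X : ℝ) ^ 6 * 4 ^ X) = (4 * (6 * n + 92)) * (X : ℝ) ^ 6 * 4 ^ X := by ring
    _ ≤ (4 * (6 * n + 92)) * (1 / (2 * (4 * (6 * n + 92))) * Real.exp (1 / 2 * X)) *
        Real.exp (3 / 2 * X) := by gcongr
    _ = 1 / 2 * Real.exp (2 * X) := by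
        rw [show (2 * X : ℝ) = 1 / 2 * X + 3 / 2 * X by ring, Real.exp_add]
        field_simp
    _ < _ := by linarith [Real.exp_pos (2 * X)]

lemma error_le_exp {n N X a : ℕ} (hX : 1 ≤ X) (hN : N ≤ X ^ 2) (ha : a ≤ 2 * X) {M L : ℝ}
    (hMX : M ≤ X) (hL : L = N * X) :
    ((N + 3 ^ N) * (L + 1) ^ (2 * n + 2) * (4 * n + 80) + M * 3 ^ N) * (2 * L ^ 2 + 1) ^ (2 ^ a) ≤
      Real.exp ((6 * n + 92) * (X : ℝ) ^ 6 * 4 ^ X) := by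
  have hX' : (1 : ℝ) ≤ X := by exact_mod_cast hX
  have hN' : (N : ℝ) ≤ (X : ℝ) ^ 2 := by exact_mod_cast hN
  have hL0 : 0 ≤ L := by rw [hL]; positivity
  have hL3 : L ≤ (X : ℝ) ^ 3 := by
    rw [hL, pow_succ]; gcongr
  have h3N : (3 : ℝ) ^ N ≤ Real.exp (2 * (X : ℝ) ^ 2) := by
    calc (3 : ℝ) ^ N ≤ Real.exp 2 ^ N := by
          gcongr
          linarith [Real.add_one_le_exp (2 : ℝ)]
      _ = Real.exp (N * 2) := (Real.exp_nat_mul _ _).symm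
      _ ≤ _ := Real.exp_le_exp.2 (by linarith)
  have hN3 : (N : ℝ) ≤ 3 ^ N := by exact_mod_cast (Nat.lt_pow_self (by norm_num : 1 < 3)).le
  have h2 : (2 : ℝ) ≤ Real.exp 1 := by linarith [Real.add_one_le_exp (1 : ℝ)]
  have hX2 : (1 : ℝ) ≤ (X : ℝ) ^ 2 := one_le_pow₀ hX'
  have hX3 : (1 : ℝ) ≤ (X : ℝ) ^ 3 := one_le_pow₀ hX'
  have hX23 : (X : ℝ) ^ 2 ≤ (X : ℝ) ^ 3 := pow_le_pow_right₀ hX' (by norm_num)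
  have hX12 : (X : ℝ) ≤ (X : ℝ) ^ 2 := le_self_pow₀ hX' (by norm_num)
  have e1 : (N + 3 ^ N : ℝ) ≤ Real.exp (3 * (X : ℝ) ^ 3) := by
    calc (N + 3 ^ N : ℝ) ≤ 2 * 3 ^ N := by linarith
      _ ≤ Real.exp 1 * Real.exp (2 * (X : ℝ) ^ 2) := by gcongr
      _ = Real.exp (1 + 2 * (X : ℝ) ^ 2) := (Real.exp_add _ _).symm
      _ ≤ _ := by gcongr; linarith
  have e2 : (L + 1) ^ (2 * n + 2) ≤ Real.exp ((2 * n + 2) * (X : ℝ) ^ 3) := by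
    calc (L + 1) ^ (2 * n + 2) ≤ Real.exp ((X : ℝ) ^ 3) ^ (2 * n + 2) := by
          gcongr
          linarith [Real.add_one_le_exp ((X : ℝ) ^ 3)]
      _ = _ := by rw [← Real.exp_nat_mul]; push_cast; rfl
  have e3 : (4 * n + 80 : ℝ) ≤ Real.exp ((4 * n + 80) * (X : ℝ) ^ 3) := by
    have : (4 * n + 80 : ℝ) ≤ (4 * n + 80) * (X : ℝ) ^ 3 := le_mul_of_one_le_right (by positivity) hX3
    linarith [Real.add_one_le_exp ((4 * n + 80) * (X : ℝ) ^ 3)]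
  have e4 : M * 3 ^ N ≤ Real.exp (3 * (X : ℝ) ^ 3) := by
    calc M * 3 ^ N ≤ Real.exp (X : ℝ) * Real.exp (2 * (X : ℝ) ^ 2) := by
          gcongr
          linarith [Real.add_one_le_exp (X : ℝ)]
      _ = Real.exp (X + 2 * (X : ℝ) ^ 2) := (Real.exp_add _ _).symm
      _ ≤ _ := by gcongr; linarith
  have e5 : (2 * L ^ 2 + 1) ^ (2 ^ a) ≤ Real.exp (2 * (X : ℝ) ^ 6 * 4 ^ X) := by
    have hL6 : L ^ 2 ≤ (X : ℝ) ^ 6 := by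
      calc L ^ 2 ≤ ((X : ℝ) ^ 3) ^ 2 := by gcongr
        _ = _ := by ring
    have ha4 : (2 : ℝ) ^ a ≤ 4 ^ X := by
      rw [show (4 : ℝ) = 2 ^ 2 by norm_num, ← pow_mul]
      exact pow_le_pow_right₀ (by norm_num) ha
    calc (2 * L ^ 2 + 1) ^ (2 ^ a) ≤ Real.exp (2 * (X : ℝ) ^ 6) ^ (2 ^ a) := by
          gcongr
          linarith [Real.add_one_le_exp (2 * (X : ℝ) ^ 6)]
      _ = Real.exp (2 ^ a * (2 * (X : ℝ) ^ 6)) := by rw [← Real.exp_nat_mul]; push_cast; rfl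
      _ ≤ _ := by
          rw [mul_comm (2 ^ a : ℝ)]
          gcongr
  have e6 : (N + 3 ^ N) * (L + 1) ^ (2 * n + 2) * (4 * n + 80) + M * 3 ^ N ≤
      Real.exp ((6 * n + 90) * (X : ℝ) ^ 3) := by
    have f1 : (N + 3 ^ N) * (L + 1) ^ (2 * n + 2) * (4 * n + 80) ≤
        Real.exp ((6 * n + 85) * (X : ℝ) ^ 3) := by
      calc (N + 3 ^ N) * (L + 1) ^ (2 * n + 2) * (4 * n + 80) ≤ Real.exp (3 * (X : ℝ) ^ 3) *
            Real.exp ((2 * n + 2) * (X : ℝ) ^ 3) * Real.exp ((4 * n + 80) * (X : ℝ) ^ 3) := by gcongr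
        _ = _ := by rw [← Real.exp_add, ← Real.exp_add]; congr 1; ring
    have f2 : M * 3 ^ N ≤ Real.exp ((6 * n + 85) * (X : ℝ) ^ 3) := by
      refine e4.trans ?_
      gcongr
      have : (0 : ℝ) ≤ n := Nat.cast_nonneg _
      linarith
    calc _ ≤ 2 * Real.exp ((6 * n + 85) * (X : ℝ) ^ 3) := by linarith
      _ ≤ Real.exp 1 * Real.exp ((6 * n + 85) * (X : ℝ) ^ 3) := by gcongr
      _ = Real.exp (1 + (6 * n + 85) * (X : ℝ) ^ 3) := (Real.exp_add _ _).symm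
      _ ≤ _ := by gcongr; linarith
  calc _ ≤ Real.exp ((6 * n + 90) * (X : ℝ) ^ 3) * Real.exp (2 * (X : ℝ) ^ 6 * 4 ^ X) := by gcongr
    _ = Real.exp ((6 * n + 90) * (X : ℝ) ^ 3 + 2 * (X : ℝ) ^ 6 * 4 ^ X) := (Real.exp_add _ _).symm
    _ ≤ _ := by
      gcongr
      have g1 : (X : ℝ) ^ 3 ≤ (X : ℝ) ^ 6 * 4 ^ X := by
        calc (X : ℝ) ^ 3 ≤ (X : ℝ) ^ 6 * 1 := by
              rw [mul_one]; exact pow_le_pow_right₀ hX' (by norm_num)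
          _ ≤ _ := by gcongr; exact one_le_pow₀ (by norm_num)
      have : (6 * n + 90) * (X : ℝ) ^ 3 ≤ (6 * n + 90) * ((X : ℝ) ^ 6 * 4 ^ X) := by gcongr
      linarith

lemma Estar_le_pow {ℓ : ℕ} {u : ℝ} (hu : 0 ≤ u) : Estar ℓ u ≤ u ^ (2 * (ℓ - 1) + 2) := by
  have hfl := Nat.floor_le hu
  rw [Estar, ← Finset.sum_neg_distrib]
  refine (Finset.sum_le_card_nsmul _ _ (u * u ^ (2 * (ℓ - 1))) fun m hm => ?_).trans ?_
  · have hmu : (m : ℝ) ≤ u := (Nat.le_floor_iff hu).1 (Finset.mem_Icc.1 hm).2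
    have h0 : 0 ≤ (u ^ 2 - (m : ℝ) ^ 2) ^ (ℓ - 1) := pow_nonneg (by
      have := pow_le_pow_left₀ (Nat.cast_nonneg m) hmu 2; linarith) _
    have h1 : (u ^ 2 - (m : ℝ) ^ 2) ^ (ℓ - 1) ≤ u ^ (2 * (ℓ - 1)) := by
      rw [pow_mul]
      refine pow_le_pow_left₀ (by
        have := pow_le_pow_left₀ (Nat.cast_nonneg m) hmu 2; linarith) ?_ _
      linarith [sq_nonneg (m : ℝ)]
    have h2 : (m : ℝ) * (u ^ 2 - (m : ℝ) ^ 2) ^ (ℓ - 1) ≤ u * u ^ (2 * (ℓ - 1)) := by gcongr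
    have h3 : 0 ≤ (m : ℝ) * (u ^ 2 - (m : ℝ) ^ 2) ^ (ℓ - 1) := by positivity
    nlinarith [Int.fract_nonneg (u ^ 2 / (2 * m) - (m : ℝ) / 2 - (ℓ : ℝ) / 2),
      Int.fract_lt_one (u ^ 2 / (2 * m) - (m : ℝ) / 2 - (ℓ : ℝ) / 2)]
  · rw [Nat.card_Icc, nsmul_eq_mul, Nat.add_sub_cancel]
    calc (⌊u⌋₊ : ℝ) * (u * u ^ (2 * (ℓ - 1))) ≤ u * (u * u ^ (2 * (ℓ - 1))) := by gcongr
      _ = _ := by ring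

lemma card_oddPrimes_le {a b : ℕ} (ha : 1 ≤ a) : #(oddPrimes a b) ≤ b := by
  refine (Finset.card_filter_le _ _).trans ?_
  rw [Nat.card_Icc]
  omega

lemma eventually_le_card_oddPrimes :
    ∀ᶠ W : ℕ in Filter.atTop, W ^ 27 ≤ #(oddPrimes 1 (W ^ 28)) ∧
      W ^ 31 ≤ #(oddPrimes (2 * W ^ 28) (W ^ 32)) := by
  filter_upwards [eventually_le_primeCounting (k := 28) (by norm_num),
    eventually_le_primeCounting (k := 32) (by norm_num), Filter.eventually_ge_atTop 2]
    with W h1 h2 hW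
  have h3 := h1.trans (primeCounting_le_card_oddPrimes 1 (W ^ 28))
  have h4 := h2.trans (primeCounting_le_card_oddPrimes (2 * W ^ 28) (W ^ 32))
  norm_num at h3 h4
  have h5 : 1 ≤ W ^ 27 := Nat.one_le_pow _ _ (by omega)
  have h6 : 2 * W ^ 28 ≤ W ^ 31 := by
    calc 2 * W ^ 28 ≤ W * W ^ 28 := by gcongr
      _ = W ^ 29 := by ring
      _ ≤ W ^ 31 := Nat.pow_le_pow_right (by omega) (by norm_num)
  have h7 : 1 ≤ W ^ 31 := Nat.one_le_pow _ _ (by omega)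
  constructor <;> omega

/-- The size `(log log u · log log log u)^{1/4}` at `u = exp (exp t)`. -/
noncomputable def logLogFactor (t : ℝ) : ℝ := (t * Real.log t) ^ ((1 : ℝ) / 4)

lemma eventually_logLogFactor_le :
    ∀ᶠ W : ℕ in Filter.atTop, logLogFactor (2 * (W : ℝ) ^ 32) ≤ (W : ℝ) ^ 9 := by
  filter_upwards [Filter.eventually_ge_atTop 68] with W hW
  have hW' : (68 : ℝ) ≤ W := by exact_mod_cast hW
  have h0 : (0 : ℝ) < W := by linarith
  have h1 : Real.log (2 * (W : ℝ) ^ 32) ≤ 1 + 32 * W := by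
    rw [Real.log_mul (by norm_num) (by positivity), Real.log_pow]
    have := Real.log_two_lt_d9
    have := Real.log_le_self h0.le
    push_cast
    linarith
  have h2 : 2 * (W : ℝ) ^ 32 * Real.log (2 * (W : ℝ) ^ 32) ≤ ((W : ℝ) ^ 9) ^ (4 : ℕ) := by
    calc 2 * (W : ℝ) ^ 32 * Real.log (2 * (W : ℝ) ^ 32) ≤ 2 * (W : ℝ) ^ 32 * (1 + 32 * W) := by gcongr
      _ = (W : ℝ) ^ 32 * (2 + 64 * W) := by ring
      _ ≤ (W : ℝ) ^ 32 * (W ^ 2 * (1 * 1)) := by gcongr; nlinarith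
      _ ≤ (W : ℝ) ^ 32 * (W ^ 2 * (W * W)) := by gcongr <;> linarith
      _ = _ := by ring
  have h3 : 0 ≤ 2 * (W : ℝ) ^ 32 * Real.log (2 * (W : ℝ) ^ 32) := by
    have : (1 : ℝ) ≤ (W : ℝ) ^ 32 := one_le_pow₀ (by linarith)
    exact mul_nonneg (by positivity) (Real.log_nonneg (by linarith))
  rw [logLogFactor]
  calc _ ≤ (((W : ℝ) ^ 9) ^ (4 : ℕ)) ^ ((1 : ℝ) / 4) := Real.rpow_le_rpow h3 h2 (by norm_num)
    _ = _ := by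
      rw [← Real.rpow_natCast, ← Real.rpow_mul (by positivity)]
      norm_num

lemma one_le_logLogFactor {t : ℝ} (ht : Real.exp 1 ≤ t) : 1 ≤ logLogFactor t := by
  have h2 : (2 : ℝ) ≤ Real.exp 1 := by linarith [Real.add_one_le_exp (1 : ℝ)]
  have h3 : 1 ≤ Real.log t := (Real.le_log_iff_exp_le (by linarith)).2 ht
  exact Real.one_le_rpow (by nlinarith) (by norm_num)

lemma logLogFactor_mono {s t : ℝ} (hs : 1 ≤ s) (hst : s ≤ t) :
    logLogFactor s ≤ logLogFactor t := by
  have h := Real.log_nonneg hs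
  exact Real.rpow_le_rpow (by positivity)
    (mul_le_mul hst (Real.log_le_log (by linarith) hst) h (by linarith)) (by norm_num)

lemma exists_le_of_intervalIntegral_lt {f R : ℝ → ℝ} {U V : ℝ} (hU : 0 ≤ U)
    (hf : IntervalIntegrable f MeasureTheory.volume 0 U) (hR : Continuous R) (hR0 : ∀ u, 0 ≤ R u)
    (h : V * ∫ u in 0..U, R u < ∫ u in 0..U, f u * R u) : ∃ u ∈ Set.Icc 0 U, V < f u := by
  by_contra! hcon
  refine h.not_ge ?_
  rw [← intervalIntegral.integral_const_mul]
  refine intervalIntegral.integral_mono_on hU (hf.mul_continuousOn hR.continuousOn)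
    ((hR.const_mul V).intervalIntegrable _ _) fun u hu => ?_
  exact mul_le_mul_of_nonneg_right (hcon u hu) (hR0 u)

lemma exists_lt_Estar {ℓ : ℕ} (hℓ : Odd ℓ) :
    ∀ᶠ W : ℕ in Filter.atTop, ∃ u ∈ Set.Icc 0 (Real.exp (Real.exp (2 * (W : ℝ) ^ 32))),
      Real.exp (Real.exp (2 * (W : ℝ) ^ 32) / 4) ^ (8 * (ℓ - 1) + 6) *
        logLogFactor (2 * (W : ℝ) ^ 32) < Estar ℓ u := by
  set c := ‖fresnelConst‖ / (64 * Real.pi * 32 ^ (ℓ - 1)) with hc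
  have hc0 : 0 < c := by
    have := norm_pos_iff.2 fresnelConst_ne_zero
    positivity
  have hpow : Filter.Tendsto (fun W : ℕ => W ^ 32) Filter.atTop Filter.atTop :=
    Filter.tendsto_pow_atTop (by norm_num)
  have hcW : ∀ᶠ W : ℕ in Filter.atTop, 2 / c ≤ W :=
    tendsto_natCast_atTop_atTop.eventually (Filter.eventually_ge_atTop (2 / c))
  filter_upwards [eventually_le_card_oddPrimes, eventually_logLogFactor_le,
    hpow.eventually (eventually_pow_mul_lt_exp (ℓ - 1)), hcW, Filter.eventually_ge_atTop 2]
    with W hcard hM hexp hcW hW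
  obtain ⟨X, hXW⟩ : ∃ X : ℕ, X = W ^ 32 := ⟨_, rfl⟩
  have hXW' : (X : ℝ) = (W : ℝ) ^ 32 := by exact_mod_cast hXW
  rw [← hXW] at hexp
  rw [← hXW'] at hM ⊢
  have hW' : (2 : ℝ) ≤ W := by exact_mod_cast hW
  have hX1 : 1 ≤ X := by rw [hXW]; exact Nat.one_le_pow _ _ (by omega)
  have hX1' : (1 : ℝ) ≤ X := by exact_mod_cast hX1
  have hX2 : (4 : ℝ) ≤ 2 * X := by
    have : (2 : ℝ) ≤ X := by rw [hXW']; exact hW'.trans (le_self_pow₀ (by linarith) (by norm_num))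
    linarith
  set M := logLogFactor (2 * X) with hMdef
  have hM1 : 1 ≤ M := one_le_logLogFactor (by linarith [Real.exp_one_lt_d9])
  have hMX : M ≤ X := hM.trans (by
    rw [hXW']; exact pow_le_pow_right₀ (by linarith) (by norm_num))
  set Y := Real.exp (Real.exp (2 * X) / 4) with hYdef
  have hY4 : Y ^ 4 = Real.exp (Real.exp (2 * X)) := by
    rw [hYdef, ← Real.exp_nat_mul]; congr 1; push_cast; ring
  have hY1 : 1 ≤ Y := Real.one_le_exp (by positivity)
  have hY0 : 0 < Y := by linarith
  set A := oddPrimes 1 (W ^ 28) with hA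
  set B := oddPrimes (2 * W ^ 28) (W ^ 32) with hB
  have hW28 : 1 ≤ W ^ 28 := Nat.one_le_pow _ _ (by omega)
  have hA' : #A ≤ X := (card_oddPrimes_le le_rfl).trans (by
    rw [hXW]; exact Nat.pow_le_pow_right (by omega) (by norm_num))
  have hB' : #B ≤ X := (card_oddPrimes_le (by omega)).trans hXW.ge
  obtain ⟨N, hN⟩ : ∃ N, N = #A * #B := ⟨_, rfl⟩
  have hNX : N ≤ X ^ 2 := by rw [hN, sq]; exact Nat.mul_le_mul hA' hB'
  have hNW : (W : ℝ) ^ 58 ≤ N := by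
    have : W ^ 58 ≤ N := by
      rw [hN, show 58 = 27 + 31 by norm_num, pow_add]; exact Nat.mul_le_mul hcard.1 hcard.2
    exact_mod_cast this
  obtain ⟨L, hL⟩ : ∃ L : ℝ, L = N * X := ⟨_, rfl⟩
  obtain ⟨δ, hδ⟩ : ∃ δ : ℝ, δ = ((2 * L ^ 2 + 1) ^ (2 ^ (#A + #B)))⁻¹ := ⟨_, rfl⟩
  have hδ0 : 0 < δ := by rw [hδ]; positivity
  obtain ⟨R, hRc, hR0, hRint, hmain⟩ := exists_test_function (A := A) (B := B)
    (fun p hp => (mem_oddPrimes.1 hp).2) (fun p hp => (mem_oddPrimes.1 hp).2)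
    (fun p hp r hr => by
      have h1 := (mem_oddPrimes.1 hp).1.2
      have h2 := (mem_oddPrimes.1 hr).1.1
      omega) (X := X) (Y := Y)
    (fun r hr => by rw [hXW]; exact_mod_cast (mem_oddPrimes.1 hr).1.2) hY1 hX1'
    (by rw [hY4]; linarith [Real.add_one_le_exp (2 * (X : ℝ)), Real.add_one_le_exp (Real.exp (2 * X))])
    hℓ hN hL hδ rfl
  rw [← hc] at hmain
  rw [← hY4]
  refine exists_le_of_intervalIntegral_lt (by positivity) (intervalIntegrable_Estar ℓ (by positivity))
    hRc hR0 (lt_of_lt_of_le ?_ hmain)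
  have hsqrtY : √(Y ^ 4) = Y ^ 2 := by
    rw [show Y ^ 4 = (Y ^ 2) ^ 2 by ring, Real.sqrt_sq (by positivity)]
  have hsqrtX : √(X : ℝ) = (W : ℝ) ^ 16 := by
    rw [hXW', show (W : ℝ) ^ 32 = ((W : ℝ) ^ 16) ^ 2 by ring, Real.sqrt_sq (by positivity)]
  set n := ℓ - 1
  have hmainterm : (M + 1) * Y ^ (8 * n + 10) ≤
      N * (c * ((Y ^ 4) ^ (2 * n + 2) * √(Y ^ 4) / (X * √X))) := by
    have h1 : M + 1 ≤ c * (W : ℝ) ^ 10 := by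
      have hW9 : 1 ≤ (W : ℝ) ^ 9 := one_le_pow₀ (by linarith)
      have h2 : 2 ≤ c * W := by
        rw [div_le_iff₀ hc0] at hcW; linarith
      calc M + 1 ≤ 2 * (W : ℝ) ^ 9 := by linarith
        _ ≤ c * W * (W : ℝ) ^ 9 := by gcongr
        _ = _ := by ring
    rw [hsqrtY, hsqrtX, hXW']
    calc (M + 1) * Y ^ (8 * n + 10) ≤ c * (W : ℝ) ^ 10 * Y ^ (8 * n + 10) := by gcongr
      _ = (W : ℝ) ^ 58 * (c * (Y ^ (8 * n + 10) / ((W : ℝ) ^ 32 * (W : ℝ) ^ 16))) := by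
          field_simp
      _ ≤ N * (c * (Y ^ (8 * n + 10) / ((W : ℝ) ^ 32 * (W : ℝ) ^ 16))) := by gcongr
      _ = _ := by congr 4; ring
  have herr : ((N + 3 ^ N) * (L + 1) ^ (2 * n + 2) * (4 * n + 80) + M * 3 ^ N) / δ < Y := by
    rw [hδ, div_inv_eq_mul]
    refine (error_le_exp hX1 hNX (by omega) hMX hL).trans_lt ?_
    exact Real.exp_lt_exp.2 (by linarith)
  have hintegral : Y ^ (8 * n + 6) * M * ∫ u in 0..Y ^ 4, R u ≤
      M * Y ^ (8 * n + 10) + M * 3 ^ N / δ * Y ^ (8 * n + 9) := by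
    calc _ ≤ Y ^ (8 * n + 6) * M * (Y ^ 4 + 3 ^ N / δ) := by gcongr
      _ = M * Y ^ (8 * n + 10) + M * 3 ^ N / δ * Y ^ (8 * n + 6) := by ring
      _ ≤ _ := by
        have : Y ^ (8 * n + 6) ≤ Y ^ (8 * n + 9) := pow_le_pow_right₀ hY1 (by omega)
        gcongr
  have hfin : ((N + 3 ^ N) * (L + 1) ^ (2 * n + 2) * (4 * n + 80) + M * 3 ^ N) / δ *
      Y ^ (8 * n + 9) < Y ^ (8 * n + 10) := by
    calc _ < Y * Y ^ (8 * n + 9) := by gcongr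
      _ = _ := by ring
  refine hintegral.trans_lt (lt_of_lt_of_le ?_ (sub_le_sub_right hmainterm _))
  have : ((N : ℝ) + 3 ^ N) * ((L + 1) ^ (2 * n + 2) * Y ^ (8 * n + 9) * ((4 * n + 80) / δ)) +
      M * 3 ^ N / δ * Y ^ (8 * n + 9) = ((N + 3 ^ N) * (L + 1) ^ (2 * n + 2) * (4 * n + 80) +
      M * 3 ^ N) / δ * Y ^ (8 * n + 9) := by ring
  linarith

lemma exists_gt_lt_Estar {ℓ : ℕ} (hℓ : Odd ℓ) (u₀ : ℝ) :
    ∃ u > u₀, u ^ (2 * (ℓ : ℝ) - 1 / 2) * logLogFactor (Real.log (Real.log u)) ≤ Estar ℓ u := by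
  obtain ⟨u₁, hu₁⟩ : ∃ u₁, u₁ = max u₀ (Real.exp (Real.exp 1)) := ⟨_, rfl⟩
  have hu₁pos : 0 < u₁ := hu₁ ▸ lt_max_of_lt_right (Real.exp_pos _)
  have hlarge : ∀ᶠ W : ℕ in Filter.atTop, u₁ ^ (2 * (ℓ - 1) + 2) ≤ W :=
    tendsto_natCast_atTop_atTop.eventually (Filter.eventually_ge_atTop _)
  obtain ⟨W, ⟨⟨u, hu, hlt⟩, hW⟩, hW2⟩ := ((exists_lt_Estar hℓ).and hlarge).and
    (Filter.eventually_ge_atTop 2) |>.exists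
  have hW2' : (2 : ℝ) ≤ W := by exact_mod_cast hW2
  set t := 2 * (W : ℝ) ^ 32 with ht
  have hWt : 2 * (W : ℝ) ≤ t := by
    have : (W : ℝ) ≤ (W : ℝ) ^ 32 := le_self_pow₀ (by linarith) (by norm_num)
    linarith
  have hM1 : 1 ≤ logLogFactor t := one_le_logLogFactor (by linarith [Real.exp_one_lt_d9])
  set Y := Real.exp (Real.exp t / 4) with hY
  have hY1 : 1 ≤ Y := Real.one_le_exp (by positivity)
  have hYW : (W : ℝ) ≤ Y := by
    have h1 := Real.add_one_le_exp (Real.exp t / 4)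
    have h2 := Real.quadratic_le_exp_of_nonneg (show 0 ≤ t by linarith)
    nlinarith
  have hu₁u : u₁ < u := by
    by_contra! hle
    have h1 : Estar ℓ u ≤ W := (Estar_le_pow hu.1).trans ((pow_le_pow_left₀ hu.1 hle _).trans hW)
    have h2 : Y ≤ Y ^ (8 * (ℓ - 1) + 6) := le_self_pow₀ hY1 (by omega)
    have h3 : Y ^ (8 * (ℓ - 1) + 6) ≤ Y ^ (8 * (ℓ - 1) + 6) * logLogFactor t :=
      le_mul_of_one_le_right (by positivity) hM1
    linarith
  have hu0 : 0 < u := hu₁pos.trans hu₁u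
  have he : Real.exp (Real.exp 1) < u := (hu₁ ▸ le_max_right _ _).trans_lt hu₁u
  have hlog : Real.exp 1 < Real.log u := (Real.lt_log_iff_exp_lt hu0).2 he
  have hlog0 : 0 < Real.log u := (Real.exp_pos 1).trans hlog
  have hloglog : 1 < Real.log (Real.log u) := (Real.lt_log_iff_exp_lt hlog0).2 hlog
  refine ⟨u, (hu₁ ▸ le_max_left _ _).trans_lt hu₁u, le_trans ?_ hlt.le⟩
  have hll : Real.log (Real.log u) ≤ t := by
    rw [Real.log_le_iff_le_exp hlog0, Real.log_le_iff_le_exp hu0]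
    exact hu.2
  have hℓ1 : 1 ≤ ℓ := hℓ.pos
  have hℓ1' : (1 : ℝ) ≤ ℓ := by exact_mod_cast hℓ1
  have hpow : u ^ (2 * (ℓ : ℝ) - 1 / 2) ≤ Y ^ (8 * (ℓ - 1) + 6) := by
    calc u ^ (2 * (ℓ : ℝ) - 1 / 2) ≤ Real.exp (Real.exp t) ^ (2 * (ℓ : ℝ) - 1 / 2) :=
          Real.rpow_le_rpow hu0.le hu.2 (by linarith)
      _ = Y ^ (8 * (ℓ - 1) + 6) := by
          rw [← Real.exp_mul, hY, ← Real.exp_nat_mul]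
          congr 1
          push_cast [Nat.cast_sub hℓ1]
          ring
  have := logLogFactor_mono hloglog.le hll
  have h0 : 0 ≤ logLogFactor (Real.log (Real.log u)) :=
    Real.rpow_nonneg (mul_nonneg (by linarith) (Real.log_nonneg hloglog.le)) _
  gcongr

end HeisenbergCount

/-- For odd `ℓ`, the fractional-part sum `E*(u)` attains values `≫ u^{2ℓ-1/2}(log₂u · log₃u)^{1/4}`
on an unbounded set of `u`. -/
theorem Estar_omega_result (ℓ : ℕ) (hℓ : 1 ≤ ℓ) (hodd : Odd ℓ) :
    ∃ c : ℝ, 0 < c ∧ ∀ u₀ : ℝ, ∃ u : ℝ, u₀ < u ∧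
      c * u ^ (2 * (ℓ : ℝ) - 1/2) *
          (Real.log (Real.log u) * Real.log (Real.log (Real.log u))) ^ ((1 : ℝ)/4)
        ≤ -∑ m ∈ Finset.Icc 1 ⌊u⌋₊,
            (m : ℝ) * (u ^ 2 - (m : ℝ) ^ 2) ^ (ℓ - 1) *
              (Int.fract (u ^ 2 / (2 * m) - (m : ℝ)/2 - (ℓ : ℝ)/2) - 1/2) := by
  refine ⟨1, one_pos, fun u₀ => ?_⟩
  obtain ⟨u, hu, h⟩ := HeisenbergCount.exists_gt_lt_Estar hodd u₀
  refine ⟨u, hu, ?_⟩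
  rw [one_mul]
  exact h
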